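/- Universality of the MCMC-based fixed-slope lossy coder: let μ be a stationary ergodic source on 𝒳^ℕ, let α > 0, and let (k_n) be nonnegative integers with k_n → ∞ and k_n/log n → 0 (and k_n < n). For x ∈ 𝒳^ℕ and n ≥ 1, define the energy E_{n,x}(y) = n[ H_{k_n}(y) + α d_n((x_0,…,x_{n−1}), y) ] on 𝒳̂ⁿ, let Δ_{n,x} = max_{i,u,a,b} |E_{n,x}(u[i:=a]) − E_{n,x}(u[i:=b])|, choose any T₀^{(n)} > n·Δ_{n,x} with T₀^{(n)} > 0, set β_t = ln(⌊t/n⌋ + 1)/T₀^{(n)}, and let ν_r^{(n,x)} = μ₀ P^{(0,r)} be the distribution after r steps of the nonhomogeneous Markov chain on 𝒳̂ⁿ with transition matrices P^{(t)} = P_{β_t} (the Gibbs sampler for E_{n,x}) started from an arbitrary initial distribution μ₀. Then for μ-almost every x, lim_{n→∞} lim_{r→∞} Σ_{y∈𝒳̂ⁿ} ν_r^{(n,x)}(y)·[ H_{k_n}(y) + α d_n((x_0,…,x_{n−1}), y) ] = inf_{D ≥ 0} [ R(D) + αD ]. -/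

import Mathlib

open Filter MeasureTheory

/-- The `(k+1)`-th order empirical count `m_{a,b}(y)`: the fraction of positions
`i` of `y` (indices extended cyclically) whose preceding `k`-context is `b` and
whose symbol is `a`. -/
noncomputable def empCount {A : Type*} [Fintype A] [DecidableEq A] (n k : ℕ)
    (y : Fin n → A) (a : A) (b : Fin k → A) : ℝ :=
  ((Finset.univ.filter fun i : Fin n =>
      y i = a ∧ ∀ j : Fin k,
        y ⟨(i.val + (n - (k - j.val) % n)) % n, Nat.mod_lt _ i.pos⟩ = b j).card : ℝ) / n

/-- The conditional empirical entropy `H_k(y)` of order `k` (base-2 logarithms,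
with the convention `0·log 0 = 0`): the conditional Shannon entropy
`H(Y_{k+1} | Y_1,…,Y_k)` of a random vector distributed according to the
empirical counts of `y`. -/
noncomputable def condEmpEntropy {A : Type*} [Fintype A] [DecidableEq A]
    (n k : ℕ) (y : Fin n → A) : ℝ :=
  -∑ b : Fin k → A, ∑ a : A,
      empCount n k y a b *
        Real.logb 2 (empCount n k y a b / ∑ a' : A, empCount n k y a' b)

/-- Average per-letter distortion `d_n(x,y) = (1/n) Σ_i d(x_i, y_i)`. -/
noncomputable def avgDist {X Xh : Type*} (d : X → Xh → ℝ) (n : ℕ)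
    (x : Fin n → X) (y : Fin n → Xh) : ℝ :=
  (∑ i, d (x i) (y i)) / n

/-- Base-2 Shannon entropy of a pmf on a finite set (convention `0·log 0 = 0`). -/
noncomputable def shannonEntropy {Ω : Type*} [Fintype Ω] (p : Ω → ℝ) : ℝ :=
  -∑ ω, p ω * Real.logb 2 (p ω)

/-- Mutual information `I(ν) = H(ν₁) + H(ν₂) − H(ν)` of a joint pmf on a finite
product space. -/
noncomputable def mutualInfo {Ω₁ Ω₂ : Type*} [Fintype Ω₁] [Fintype Ω₂]
    (ν : Ω₁ × Ω₂ → ℝ) : ℝ :=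
  shannonEntropy (fun a => ∑ b, ν (a, b)) + shannonEntropy (fun b => ∑ a, ν (a, b)) -
    shannonEntropy ν

/-- The `n`-th order rate-distortion function `R_n(D) = (1/n)·inf I(ν)`, the
infimum over joint pmfs `ν` on `𝒳ⁿ × 𝒳̂ⁿ` with first marginal the law of the
first `n` source coordinates and expected distortion at most `D` (the infimum
over the empty set being `+∞`, whence the `EReal` value). -/
noncomputable def RDn {X Xh : Type*} [Fintype X] [Fintype Xh] [DecidableEq X]
    [DecidableEq Xh] [MeasurableSpace X]
    (μ : MeasureTheory.Measure (ℕ → X)) (d : X → Xh → ℝ) (n : ℕ) (D : ℝ) : EReal :=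
  sInf {r : EReal | ∃ ν : (Fin n → X) × (Fin n → Xh) → ℝ,
    (∀ p, 0 ≤ ν p) ∧ (∑ p, ν p = 1) ∧
    (∀ w : Fin n → X, ∑ y : Fin n → Xh, ν (w, y) =
      (μ {x : ℕ → X | ∀ i : Fin n, x i.val = w i}).toReal) ∧
    (∑ p : (Fin n → X) × (Fin n → Xh), ν p * avgDist d n p.1 p.2 ≤ D) ∧
    r = ((mutualInfo ν / n : ℝ) : EReal)}

/-- The rate-distortion function `R(D) = inf_{n ≥ 1} R_n(D)`. -/
noncomputable def RDfun {X Xh : Type*} [Fintype X] [Fintype Xh] [DecidableEq X]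
    [DecidableEq Xh] [MeasurableSpace X]
    (μ : MeasureTheory.Measure (ℕ → X)) (d : X → Xh → ℝ) (D : ℝ) : EReal :=
  ⨅ n : {m : ℕ // 1 ≤ m}, RDn (Xh := Xh) μ d n D

/-- The Gibbs-sampler (heat bath) transition matrix at inverse temperature `β`
for the energy `E` on the state space `Fin n → A`. -/
noncomputable def gibbs {A : Type*} [Fintype A] [DecidableEq A]
    (n : ℕ) (E : (Fin n → A) → ℝ) (β : ℝ) :
    Matrix (Fin n → A) (Fin n → A) ℝ := fun u v =>
  (∑ i : Fin n,
    if ∀ j, j ≠ i → v j = u j then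
      Real.exp (-β * E v) / ∑ b : A, Real.exp (-β * E (Function.update u i b))
    else 0) / n

/-- The maximal change of the energy `E` when a single coordinate is modified. -/
noncomputable def energySpan {A : Type*} [Fintype A] [DecidableEq A]
    (n : ℕ) (E : (Fin n → A) → ℝ) : ℝ :=
  ⨆ q : (Fin n → A) × Fin n × A × A,
    |E (Function.update q.1 q.2.1 q.2.2.1) - E (Function.update q.1 q.2.1 q.2.2.2)|

/-- The product `P^{(n1,n2)} = P^{(n1)} P^{(n1+1)} ⋯ P^{(n2−1)}` of the transition
matrices of a nonhomogeneous Markov chain. -/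
noncomputable def Pprod {S : Type*} [Fintype S] [DecidableEq S]
    (P : ℕ → Matrix S S ℝ) (n1 n2 : ℕ) : Matrix S S ℝ :=
  ((List.range (n2 - n1)).map fun t => P (n1 + t)).prod

/-- A probability distribution (row vector) on a finite state space. -/
def IsDist {S : Type*} [Fintype S] (μ : S → ℝ) : Prop :=
  (∀ k, 0 ≤ μ k) ∧ ∑ k, μ k = 1

/-- The fixed-slope lossy-coding energy
`E_{n,x}(y) = n[H_{k_n}(y) + α d_n(xⁿ, y)]`. -/
noncomputable def lossyEnergy {X Xh : Type*} [Fintype Xh] [DecidableEq Xh]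
    (d : X → Xh → ℝ) (α : ℝ) (kn : ℕ → ℕ) (n : ℕ) (x : ℕ → X) :
    (Fin n → Xh) → ℝ :=
  fun y => n * (condEmpEntropy n (kn n) y +
    α * avgDist d n (fun i : Fin n => x i.val) y)

open Filter MeasureTheory

set_option linter.unusedSectionVars false
set_option linter.unusedVariables false

section annealing

lemma mc_sum_agree {A : Type*} [Fintype A] [DecidableEq A] {n : ℕ} (u : Fin n → A) (i : Fin n)
    (f : (Fin n → A) → ℝ) :
    ∑ v, (if ∀ j, j ≠ i → v j = u j then f v else 0) = ∑ b, f (Function.update u i b) := by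
  classical
  rw [← Finset.sum_filter]
  have : (Finset.univ.filter fun v : Fin n → A => ∀ j, j ≠ i → v j = u j)
      = Finset.univ.image (fun b => Function.update u i b) := by
    ext v
    simp only [Finset.mem_filter, Finset.mem_univ, true_and, Finset.mem_image]
    constructor
    · intro h
      refine ⟨v i, ?_⟩
      funext j
      by_cases hj : j = i
      · subst hj; simp
      · simp [hj, h j hj]
    · rintro ⟨b, rfl⟩ j hj
      simp [hj]
  rw [this, Finset.sum_image]
  intro a _ b _ h
  exact Function.update_injective u i h

variable {A : Type*} [Fintype A] [DecidableEq A] [Nonempty A] {n : ℕ}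

lemma mc_gibbs_nonneg (E : (Fin n → A) → ℝ) (β : ℝ) (u v) : 0 ≤ gibbs n E β u v := by
  unfold gibbs
  refine div_nonneg (Finset.sum_nonneg fun i _ => ?_) (by positivity)
  split_ifs
  · exact div_nonneg (Real.exp_pos _).le (Finset.sum_nonneg fun b _ => (Real.exp_pos _).le)
  · exact le_rfl

lemma mc_sumexp_pos (f : A → ℝ) : 0 < ∑ b : A, Real.exp (f b) :=
  Finset.sum_pos (fun b _ => Real.exp_pos _) Finset.univ_nonempty

lemma mc_gibbs_row (hn : 0 < n) (E : (Fin n → A) → ℝ) (β : ℝ) (u) : ∑ v, gibbs n E β u v = 1 := by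
  unfold gibbs
  rw [← Finset.sum_div, Finset.sum_comm]
  have : ∀ i : Fin n, ∑ v : Fin n → A, (if ∀ j, j ≠ i → v j = u j then
      Real.exp (-β * E v) / ∑ b : A, Real.exp (-β * E (Function.update u i b))
    else 0) = 1 := by
    intro i
    rw [mc_sum_agree u i (fun v => Real.exp (-β * E v) /
      ∑ b : A, Real.exp (-β * E (Function.update u i b)))]
    rw [← Finset.sum_div]
    exact div_self (mc_sumexp_pos _).ne'
  rw [Finset.sum_congr rfl (fun i _ => this i)]
  simp
  omega

noncomputable def mcPi (E : (Fin n → A) → ℝ) (β : ℝ) (v : Fin n → A) : ℝ :=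
  Real.exp (-β * E v) / ∑ w, Real.exp (-β * E w)

lemma mc_pi_pos (E : (Fin n → A) → ℝ) (β : ℝ) (v) : 0 < mcPi E β v :=
  div_pos (Real.exp_pos _) (mc_sumexp_pos _)

lemma mc_pi_sum (E : (Fin n → A) → ℝ) (β : ℝ) : ∑ v, mcPi E β v = 1 := by
  unfold mcPi
  rw [← Finset.sum_div]
  exact div_self (mc_sumexp_pos _).ne'

lemma mc_balance (E : (Fin n → A) → ℝ) (β : ℝ) (u v) :
    mcPi E β u * gibbs n E β u v = mcPi E β v * gibbs n E β v u := by
  unfold mcPi gibbs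
  rw [← mul_div_assoc, ← mul_div_assoc, Finset.mul_sum, Finset.mul_sum]
  congr 1
  refine Finset.sum_congr rfl fun i _ => ?_
  by_cases h : ∀ j, j ≠ i → v j = u j
  · have h' : ∀ j, j ≠ i → u j = v j := fun j hj => (h j hj).symm
    rw [if_pos h, if_pos h']
    have : ∀ b, Function.update u i b = Function.update v i b := by
      intro b
      funext j
      by_cases hj : j = i
      · subst hj; simp
      · simp [hj, h j hj]
    simp only [this]
    ring
  · have h' : ¬ ∀ j, j ≠ i → u j = v j := fun hh => h fun j hj => (hh j hj).symm
    rw [if_neg h, if_neg h']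
    simp

lemma mc_stationary (hn : 0 < n) (E : (Fin n → A) → ℝ) (β : ℝ) :
    Matrix.vecMul (mcPi E β) (gibbs n E β) = mcPi E β := by
  funext v
  simp only [Matrix.vecMul, dotProduct]
  rw [Finset.sum_congr rfl (fun u _ => mc_balance E β u v), ← Finset.mul_sum, mc_gibbs_row hn, mul_one]

lemma mc_gibbs_lower (E : (Fin n → A) → ℝ) {β : ℝ} (hβ : 0 ≤ β) (u) (i : Fin n) (a : A) :
    Real.exp (-β * energySpan n E) / (n * Fintype.card A) ≤ gibbs n E β u (Function.update u i a) := by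
  have hcard : (0:ℝ) < Fintype.card A := by exact_mod_cast Fintype.card_pos
  have hspan : ∀ b c, |E (Function.update u i b) - E (Function.update u i c)| ≤ energySpan n E := by
    intro b c
    exact le_ciSup (f := fun q : (Fin n → A) × Fin n × A × A =>
      |E (Function.update q.1 q.2.1 q.2.2.1) - E (Function.update q.1 q.2.1 q.2.2.2)|)
      (Set.finite_range _).bddAbove (u, i, b, c)
  have hterm : Real.exp (-β * energySpan n E) / Fintype.card A ≤
      Real.exp (-β * E (Function.update u i a)) / ∑ b : A, Real.exp (-β * E (Function.update u i b)) := by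
    rw [div_le_div_iff₀ hcard (mc_sumexp_pos _), Finset.mul_sum]
    calc ∑ b, Real.exp (-β * energySpan n E) * Real.exp (-β * E (Function.update u i b))
        ≤ ∑ b : A, Real.exp (-β * E (Function.update u i a)) := by
          refine Finset.sum_le_sum fun b _ => ?_
          rw [← Real.exp_add]
          apply Real.exp_le_exp.2
          have := (abs_le.1 (hspan a b)).2
          nlinarith
      _ = _ := by simp [mul_comm]
  unfold gibbs
  have hn : (0:ℝ) < n := by exact_mod_cast i.pos
  rw [mul_comm (n:ℝ), ← div_div]
  gcongr
  refine hterm.trans ?_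
  have := Finset.single_le_sum (f := fun k : Fin n => if ∀ j, j ≠ k → (Function.update u i a) j = u j then
      Real.exp (-β * E (Function.update u i a)) / ∑ b : A, Real.exp (-β * E (Function.update u k b))
    else 0) (s := Finset.univ) (fun k _ => by
      split_ifs
      · exact div_nonneg (Real.exp_pos _).le (Finset.sum_nonneg fun b _ => (Real.exp_pos _).le)
      · exact le_rfl) (Finset.mem_univ i)
  refine le_trans (le_of_eq ?_) this
  rw [if_pos]
  intro j hj
  simp [hj]

lemma mc_pow_lower (E : (Fin n → A) → ℝ) {β : ℝ} (hβ : 0 ≤ β) (u v) :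
    (Real.exp (-β * energySpan n E) / (n * Fintype.card A)) ^ n ≤ (gibbs n E β ^ n) u v := by
  set ρ := Real.exp (-β * energySpan n E) / (n * Fintype.card A) with hρ
  have hρ0 : 0 ≤ ρ := by positivity
  have hpn : ∀ j u v, 0 ≤ (gibbs n E β ^ j) u v := by
    intro j
    induction j with
    | zero => intro u v; simp [Matrix.one_apply]; split_ifs <;> norm_num
    | succ j ih =>
      intro u v
      rw [pow_succ, Matrix.mul_apply]
      exact Finset.sum_nonneg fun w _ => mul_nonneg (ih _ _) (mc_gibbs_nonneg _ _ _ _)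
  have key : ∀ j ≤ n, ρ ^ j ≤ (gibbs n E β ^ j) u (fun t => if t.val < j then v t else u t) := by
    intro j
    induction j with
    | zero => intro _; simp
    | succ j ih =>
      intro hj
      rw [pow_succ, pow_succ, Matrix.mul_apply]
      have hupd : (fun t : Fin n => if t.val < j + 1 then v t else u t) =
          Function.update (fun t : Fin n => if t.val < j then v t else u t) ⟨j, hj⟩ (v ⟨j, hj⟩) := by
        funext t
        by_cases ht : t = ⟨j, hj⟩
        · subst ht; simp
        · have : t.val ≠ j := fun h => ht (Fin.ext h)
          simp only [Function.update_of_ne ht]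
          congr 1
          simp only [eq_iff_iff]
          omega
      calc ρ ^ j * ρ ≤ (gibbs n E β ^ j) u (fun t => if t.val < j then v t else u t) *
            gibbs n E β (fun t => if t.val < j then v t else u t)
              (fun t => if t.val < j + 1 then v t else u t) := by
            refine mul_le_mul (ih (by omega)) ?_ hρ0 (hpn _ _ _)
            rw [hupd]
            exact mc_gibbs_lower E hβ _ _ _
        _ ≤ _ := Finset.single_le_sum (f := fun w => (gibbs n E β ^ j) u w *
            gibbs n E β w (fun t => if t.val < j + 1 then v t else u t))
            (fun w _ => mul_nonneg (hpn _ _ _) (mc_gibbs_nonneg _ _ _ _)) (Finset.mem_univ _)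
  have := key n le_rfl
  simpa using this

lemma mc_contract {S : Type*} [Fintype S] (P : Matrix S S ℝ) (ε : ℝ)
    (hP : ∀ u v, ε ≤ P u v) (hrow : ∀ u, ∑ v, P u v = 1) (hε : 0 ≤ ε) (f : S → ℝ)
    (hf : ∑ u, f u = 0) : ∑ v, |Matrix.vecMul f P v| ≤ (1 - ε) * ∑ u, |f u| := by
  have h1 : ∀ v, |Matrix.vecMul f P v| ≤ ∑ u, |f u| * (P u v - ε) := by
    intro v
    have : Matrix.vecMul f P v = ∑ u, f u * (P u v - ε) := by
      simp only [Matrix.vecMul, dotProduct, mul_sub, Finset.sum_sub_distrib]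
      rw [← Finset.sum_mul, hf]; simp
    rw [this]
    refine (Finset.abs_sum_le_sum_abs _ _).trans (Finset.sum_le_sum fun u _ => ?_)
    rw [abs_mul, abs_of_nonneg (sub_nonneg.2 (hP u v))]
  calc ∑ v, |Matrix.vecMul f P v| ≤ ∑ v, ∑ u, |f u| * (P u v - ε) := Finset.sum_le_sum fun v _ => h1 v
    _ = ∑ u, |f u| * (1 - Fintype.card S * ε) := by
        rw [Finset.sum_comm]
        refine Finset.sum_congr rfl fun u _ => ?_
        rw [← Finset.mul_sum, Finset.sum_sub_distrib, hrow]; simp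
    _ ≤ ∑ u, |f u| * (1 - ε) := by
        refine Finset.sum_le_sum fun u _ => ?_
        have : (1:ℝ) ≤ Fintype.card S := by
          have : Nonempty S := ⟨u⟩
          exact_mod_cast Fintype.card_pos
        have : ε ≤ Fintype.card S * ε := by nlinarith
        exact mul_le_mul_of_nonneg_left (by linarith) (abs_nonneg _)
    _ = _ := by rw [← Finset.sum_mul, mul_comm]

lemma mc_row_pow {S : Type*} [Fintype S] [DecidableEq S] (P : Matrix S S ℝ)
    (hrow : ∀ u, ∑ v, P u v = 1) (j : ℕ) : ∀ u, ∑ v, (P ^ j) u v = 1 := by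
  induction j with
  | zero => intro u; simp [Matrix.one_apply]
  | succ j ih =>
    intro u
    simp only [pow_succ, Matrix.mul_apply]
    rw [Finset.sum_comm]
    simp only [← Finset.mul_sum, hrow, mul_one, ih]

lemma mc_nonneg_pow {S : Type*} [Fintype S] [DecidableEq S] (P : Matrix S S ℝ)
    (h : ∀ u v, 0 ≤ P u v) (j : ℕ) : ∀ u v, 0 ≤ (P ^ j) u v := by
  induction j with
  | zero => intro u v; simp [Matrix.one_apply]; split_ifs <;> norm_num
  | succ j ih =>
    intro u v
    rw [pow_succ, Matrix.mul_apply]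
    exact Finset.sum_nonneg fun w _ => mul_nonneg (ih _ _) (h _ _)

lemma mc_sum_vecMul {S : Type*} [Fintype S] (P : Matrix S S ℝ)
    (hrow : ∀ u, ∑ v, P u v = 1) (f : S → ℝ) : ∑ v, Matrix.vecMul f P v = ∑ u, f u := by
  simp only [Matrix.vecMul, dotProduct]
  rw [Finset.sum_comm]
  simp only [← Finset.mul_sum, hrow, mul_one]

/-- real recursion lemma -/
lemma mc_real_rec (δ ε η : ℕ → ℝ) (hrec : ∀ t, δ (t+1) ≤ (1 - ε t) * δ t + η t)
    (hδ : ∀ t, 0 ≤ δ t)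
    (hε0 : ∀ t, 0 ≤ ε t) (hε1 : ∀ t, ε t ≤ 1)
    (hdiv : Tendsto (fun N => ∑ t ∈ Finset.range N, ε t) atTop atTop)
    (hη : ∀ θ > 0, ∀ᶠ t in atTop, η t ≤ θ * ε t) : Tendsto δ atTop (nhds 0) := by
  rw [Metric.tendsto_atTop]
  intro θ hθ
  obtain ⟨T, hT⟩ := eventually_atTop.1 (hη (θ/2) (by positivity))
  set e := fun t => max (δ t - θ/2) 0 with he
  have he0 : ∀ t, 0 ≤ e t := fun t => le_max_right _ _
  have hstep : ∀ t ≥ T, e (t+1) ≤ (1 - ε t) * e t := by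
    intro t ht
    have h1 := hT t ht
    have h2 := hrec t
    have h3 : 0 ≤ 1 - ε t := by linarith [hε1 t]
    refine max_le ?_ (mul_nonneg h3 (he0 t))
    have : (1 - ε t) * (δ t - θ/2) ≤ (1 - ε t) * e t := mul_le_mul_of_nonneg_left (le_max_left _ _) h3
    nlinarith
  have hexp : ∀ j, e (T + j) ≤ e T * Real.exp (-(∑ i ∈ Finset.range j, ε (T + i))) := by
    intro j
    induction j with
    | zero => simp
    | succ j ih =>
      have h3 : 0 ≤ 1 - ε (T+j) := by linarith [hε1 (T+j)]
      calc e (T + (j+1)) ≤ (1 - ε (T+j)) * e (T+j) := hstep (T+j) (by omega)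
        _ ≤ (1 - ε (T+j)) * (e T * Real.exp (-(∑ i ∈ Finset.range j, ε (T + i)))) :=
            mul_le_mul_of_nonneg_left ih h3
        _ ≤ Real.exp (-ε (T+j)) * (e T * Real.exp (-(∑ i ∈ Finset.range j, ε (T + i)))) := by
            refine mul_le_mul_of_nonneg_right ?_ (mul_nonneg (he0 T) (Real.exp_pos _).le)
            have := Real.add_one_le_exp (-ε (T+j))
            linarith
        _ = _ := by
            rw [Finset.sum_range_succ, neg_add, Real.exp_add]; ring
  have hlim : Tendsto (fun j => e T * Real.exp (-(∑ i ∈ Finset.range j, ε (T + i)))) atTop (nhds 0) := by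
    have h1 : Tendsto (fun j => ∑ i ∈ Finset.range j, ε (T + i)) atTop atTop := by
      have h2 : ∀ j, ∑ i ∈ Finset.range j, ε (T + i) =
          ∑ i ∈ Finset.range (j + T), ε i - ∑ i ∈ Finset.range T, ε i := by
        intro j
        rw [add_comm j T, Finset.sum_range_add]; ring
      simp only [h2]
      exact tendsto_atTop_add_const_right _ _ (hdiv.comp (tendsto_add_atTop_nat T))
    have := (Real.tendsto_exp_neg_atTop_nhds_zero.comp h1).const_mul (e T)
    simpa using this
  obtain ⟨J, hJ⟩ := eventually_atTop.1 (hlim.eventually (gt_mem_nhds (show (0:ℝ) < θ/2 by positivity)))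
  refine ⟨T + J, fun t ht => ?_⟩
  obtain ⟨j, rfl⟩ := Nat.exists_eq_add_of_le (show T ≤ t by omega)
  have h1 := (hexp j).trans_lt (hJ j (by omega))
  have h2 : δ (T + j) - θ/2 ≤ e (T+j) := le_max_left _ _
  rw [Real.dist_eq, sub_zero, abs_of_nonneg (hδ _)]
  linarith

lemma mc_pi_lip (E : (Fin n → A) → ℝ) (M : ℝ) (hM : ∀ y, |E y| ≤ M) (β h : ℝ) (hh : 0 ≤ h) :
    ∑ v, |mcPi E β v - mcPi E (β + h) v| ≤ Real.exp (2 * h * M) - 1 := by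
  have hZ : ∀ b, 0 < ∑ w, Real.exp (-b * E w) := fun b => mc_sumexp_pos _
  have key : ∀ b g, |g| = h → ∀ w, Real.exp (-(b + g) * E w) ≤ Real.exp (h * M) * Real.exp (-b * E w) := by
    intro b g hg w
    rw [← Real.exp_add]
    apply Real.exp_le_exp.2
    have h1 : -(g * E w) ≤ |g * E w| := neg_le_abs _
    rw [abs_mul, hg] at h1
    have := mul_le_mul_of_nonneg_left (hM w) hh
    linarith
  have hup : ∀ b g, |g| = h → ∀ v, mcPi E (b + g) v ≤ Real.exp (2 * h * M) * mcPi E b v := by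
    intro b g hg v
    unfold mcPi
    have hz : ∑ w, Real.exp (-b * E w) ≤ Real.exp (h * M) * ∑ w, Real.exp (-(b + g) * E w) := by
      rw [Finset.mul_sum]
      refine Finset.sum_le_sum fun w _ => ?_
      have := key (b + g) (-g) (by rw [abs_neg, hg]) w
      simpa using this
    rw [← mul_div_assoc, div_le_div_iff₀ (hZ _) (hZ _)]
    have h2 : Real.exp (2 * h * M) = Real.exp (h * M) * Real.exp (h * M) := by
      rw [← Real.exp_add]; ring_nf
    rw [h2]
    calc _ ≤ (Real.exp (h * M) * Real.exp (-b * E v)) * (Real.exp (h * M) * ∑ w, Real.exp (-(b + g) * E w)) :=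
          mul_le_mul (key b g hg v) hz (hZ _).le (by positivity)
      _ = _ := by ring
  have hK : 1 ≤ Real.exp (2 * h * M) := by
    apply Real.one_le_exp
    have : 0 ≤ M := (abs_nonneg _).trans (hM (fun _ => Classical.arbitrary A))
    positivity
  set K := Real.exp (2 * h * M)
  have hb : ∀ v, |mcPi E β v - mcPi E (β + h) v| ≤ (K - 1) * mcPi E β v := by
    intro v
    have h1 := hup β h (abs_of_nonneg hh) v
    have h2 := hup (β + h) (-h) (by rw [abs_neg, abs_of_nonneg hh]) v
    rw [add_neg_cancel_right] at h2
    have p1 := mc_pi_pos E β v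
    have p2 := mc_pi_pos E (β + h) v
    rw [abs_le]
    constructor
    · nlinarith
    · by_cases hc : mcPi E (β + h) v ≤ mcPi E β v
      · nlinarith
      · nlinarith
  calc _ ≤ ∑ v, (K - 1) * mcPi E β v := Finset.sum_le_sum fun v _ => hb v
    _ = K - 1 := by rw [← Finset.mul_sum, mc_pi_sum, mul_one]

lemma mc_pi_lim (E : (Fin n → A) → ℝ) :
    Tendsto (fun β => ∑ y, mcPi E β y * E y) atTop (nhds (⨅ y, E y)) := by
  obtain ⟨y0, hy0⟩ := exists_eq_ciInf_of_finite (f := E)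
  have hmin : ∀ y, E y0 ≤ E y := fun y => by
    rw [hy0]; exact ciInf_le (Set.finite_range E).bddBelow y
  rw [← hy0]
  have heq : ∀ β, ∑ y, mcPi E β y * E y = E y0 + ∑ y, mcPi E β y * (E y - E y0) := by
    intro β
    simp only [mul_sub, Finset.sum_sub_distrib]
    rw [← Finset.sum_mul, mc_pi_sum]; ring
  simp only [heq]
  have h0 : Tendsto (fun β => ∑ y, mcPi E β y * (E y - E y0)) atTop (nhds (∑ y : Fin n → A, 0)) := by
    refine tendsto_finsetSum _ fun y _ => ?_
    by_cases hy : E y = E y0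
    · simp [hy]
    have hpos : 0 < E y - E y0 := sub_pos.2 (lt_of_le_of_ne (hmin y) (Ne.symm hy))
    have hle : ∀ β, mcPi E β y ≤ Real.exp (-(β * (E y - E y0))) := by
      intro β
      unfold mcPi
      rw [div_le_iff₀ (mc_sumexp_pos _)]
      calc Real.exp (-β * E y) = Real.exp (-(β * (E y - E y0))) * Real.exp (-β * E y0) := by
            rw [← Real.exp_add]; ring_nf
        _ ≤ _ := mul_le_mul_of_nonneg_left
            (Finset.single_le_sum (f := fun w => Real.exp (-β * E w)) (fun w _ => (Real.exp_pos _).le)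
              (Finset.mem_univ y0)) (Real.exp_pos _).le
    have hl : Tendsto (fun β : ℝ => Real.exp (-(β * (E y - E y0))) * (E y - E y0)) atTop (nhds 0) := by
      have := (Real.tendsto_exp_neg_atTop_nhds_zero.comp
        (tendsto_id.atTop_mul_const hpos)).mul_const (E y - E y0)
      simpa using this
    refine squeeze_zero (fun β => mul_nonneg (mc_pi_pos _ _ _).le hpos.le) (fun β => ?_) hl
    exact mul_le_mul_of_nonneg_right (hle β) hpos.le
  have := h0.const_add (E y0)
  simpa using this

lemma mc_Pprod_succ {S : Type*} [Fintype S] [DecidableEq S] (P : ℕ → Matrix S S ℝ) (r : ℕ) :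
    Pprod P 0 (r+1) = Pprod P 0 r * P r := by
  simp [Pprod, List.range_succ]

lemma mc_anneal (hn : 0 < n) (E : (Fin n → A) → ℝ) (T : ℝ) (hT : 0 < T)
    (hT' : (n:ℝ) * energySpan n E < T) (μ₀ : (Fin n → A) → ℝ) (hμ : IsDist μ₀) :
    Tendsto (fun r : ℕ => ∑ y, Matrix.vecMul μ₀ (Pprod (fun t => gibbs n E
      (Real.log ((t / n + 1 : ℕ) : ℝ) / T)) 0 r) y * E y) atTop (nhds (⨅ y, E y)) := by
  classical
  have hn' : (0:ℝ) < n := by exact_mod_cast hn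
  have hcard : (1:ℝ) ≤ Fintype.card A := by exact_mod_cast Fintype.card_pos
  have hn1 : (1:ℝ) ≤ n := by exact_mod_cast hn
  set b : ℕ → ℝ := fun τ => Real.log ((τ + 1 : ℕ) : ℝ) / T with hb
  have hb0 : ∀ τ, 0 ≤ b τ := fun τ => div_nonneg (Real.log_nonneg (by push_cast; linarith [(Nat.cast_nonneg τ : (0:ℝ) ≤ τ)])) hT.le
  set ν : ℕ → (Fin n → A) → ℝ := fun r => Matrix.vecMul μ₀ (Pprod (fun t => gibbs n E (b (t / n))) 0 r) with hν
  have hνs : ∀ r, ν (r+1) = Matrix.vecMul (ν r) (gibbs n E (b (r / n))) := by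
    intro r
    simp only [hν, mc_Pprod_succ, Matrix.vecMul_vecMul]
  have hνsum : ∀ r, ∑ y, ν r y = 1 := by
    intro r
    induction r with
    | zero => simp [hν, Pprod]; exact hμ.2
    | succ r ih => rw [hνs, mc_sum_vecMul _ (mc_gibbs_row hn E _), ih]
  have hsweep : ∀ τ s, s ≤ n → ν (n * τ + s) = Matrix.vecMul (ν (n * τ)) (gibbs n E (b τ) ^ s) := by
    intro τ s
    induction s with
    | zero => intro _; simp
    | succ s ih =>
      intro hs
      have : (n * τ + s) / n = τ := by
        rw [Nat.mul_add_div hn, Nat.div_eq_of_lt (by omega)]; simp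
      rw [← add_assoc, hνs, this, ih (by omega), Matrix.vecMul_vecMul, pow_succ]
  have hstat : ∀ τ s, Matrix.vecMul (mcPi E (b τ)) (gibbs n E (b τ) ^ s) = mcPi E (b τ) := by
    intro τ s
    induction s with
    | zero => simp
    | succ s ih => rw [pow_succ, ← Matrix.vecMul_vecMul, ih, mc_stationary hn]
  set D : ℝ := energySpan n E with hD
  have hD0 : 0 ≤ D := Real.iSup_nonneg fun q => abs_nonneg _
  set ε : ℕ → ℝ := fun τ => (Real.exp (-(b τ) * D) / (n * Fintype.card A)) ^ n with hε
  set δ : ℕ → ℝ := fun τ => ∑ y, |ν (n * τ) y - mcPi E (b τ) y| with hδ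
  set η : ℕ → ℝ := fun τ => ∑ y, |mcPi E (b τ) y - mcPi E (b (τ+1)) y| with hη
  have hε0 : ∀ τ, 0 ≤ ε τ := fun τ => by positivity
  have hdiffsum : ∀ τ, ∑ y, (ν (n * τ) - mcPi E (b τ)) y = 0 := by
    intro τ; simp only [Pi.sub_apply, Finset.sum_sub_distrib, hνsum, mc_pi_sum, sub_self]
  have hdiff : ∀ τ s, s ≤ n → ν (n * τ + s) - mcPi E (b τ) =
      Matrix.vecMul (ν (n * τ) - mcPi E (b τ)) (gibbs n E (b τ) ^ s) := by
    intro τ s hs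
    rw [Matrix.sub_vecMul, hstat, hsweep τ s hs]
  have hmid : ∀ τ s, s ≤ n → ∑ y, |ν (n * τ + s) y - mcPi E (b τ) y| ≤ δ τ := by
    intro τ s hs
    have := mc_contract (gibbs n E (b τ) ^ s) 0 (mc_nonneg_pow _ (mc_gibbs_nonneg E _) s)
      (mc_row_pow _ (mc_gibbs_row hn E _) s) le_rfl (ν (n * τ) - mcPi E (b τ)) (hdiffsum τ)
    rw [← hdiff τ s hs] at this
    simpa [hδ] using this
  have hend : ∀ τ, ∑ y, |ν (n * τ + n) y - mcPi E (b τ) y| ≤ (1 - ε τ) * δ τ := by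
    intro τ
    have := mc_contract (gibbs n E (b τ) ^ n) (ε τ) (mc_pow_lower E (hb0 τ))
      (mc_row_pow _ (mc_gibbs_row hn E _) n) (hε0 τ) (ν (n * τ) - mcPi E (b τ)) (hdiffsum τ)
    rw [← hdiff τ n le_rfl] at this
    simpa [hδ] using this
  have hrec : ∀ τ, δ (τ+1) ≤ (1 - ε τ) * δ τ + η τ := by
    intro τ
    refine le_trans ?_ (add_le_add_left (hend τ) _)
    simp only [hδ, hη, ← Finset.sum_add_distrib]
    refine Finset.sum_le_sum fun y _ => ?_
    rw [mul_add, mul_one]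
    exact abs_sub_le _ _ _
  have hε1 : ∀ τ, ε τ ≤ 1 := by
    intro τ
    apply pow_le_one₀ (by positivity)
    rw [div_le_one (by positivity)]
    have : Real.exp (-(b τ) * D) ≤ 1 := Real.exp_le_one_iff.2 (by nlinarith [hb0 τ])
    nlinarith
  set a : ℝ := n * D / T with ha
  have ha1 : a < 1 := by rw [ha, div_lt_one hT]; exact hT'
  set ρ : ℝ := (1 / (n * Fintype.card A : ℝ)) ^ n with hρ
  have hρ0 : 0 < ρ := by positivity
  have hεeq : ∀ τ : ℕ, ε τ = ρ * ((τ:ℝ) + 1) ^ (-a) := by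
    intro τ
    have h1 : (0:ℝ) < (τ:ℝ) + 1 := by positivity
    rw [Real.rpow_def_of_pos h1, hε, hρ]
    dsimp only
    rw [div_pow, div_pow, ← Real.exp_nat_mul, one_pow, one_div, mul_comm, div_eq_mul_inv, mul_comm]
    congr 2
    simp only [hb, ha]; push_cast; ring
  have hdiv : Tendsto (fun N => ∑ t ∈ Finset.range N, ε t) atTop atTop := by
    refine tendsto_atTop_mono (fun N => ?_) (Real.tendsto_sum_range_one_div_nat_succ_atTop.const_mul_atTop hρ0)
    rw [Finset.mul_sum]
    refine Finset.sum_le_sum fun t _ => ?_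
    rw [hεeq]
    refine mul_le_mul_of_nonneg_left ?_ hρ0.le
    rw [one_div, ← Real.rpow_neg_one]
    exact Real.rpow_le_rpow_of_exponent_le (by linarith [(Nat.cast_nonneg t : (0:ℝ) ≤ t)]) (by linarith)
  obtain ⟨M, hM⟩ : ∃ M, ∀ y, |E y| ≤ M := by
    obtain ⟨M, hM⟩ := (Set.finite_range fun y => |E y|).bddAbove
    exact ⟨M, fun y => hM ⟨y, rfl⟩⟩
  have hM0 : 0 ≤ M := (abs_nonneg _).trans (hM (fun _ => Classical.arbitrary A))
  have hηle : ∀ τ : ℕ, η τ ≤ Real.exp (2 * (M / T) / ((τ:ℝ) + 1)) - 1 := by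
    intro τ
    have h1 : (0:ℝ) < (τ:ℝ) + 1 := by positivity
    set h := b (τ + 1) - b τ with hh
    have hlog : Real.log (((τ + 1 + 1 : ℕ)) : ℝ) - Real.log ((τ + 1 : ℕ) : ℝ) ≤ 1 / ((τ:ℝ) + 1) := by
      rw [← Real.log_div (by positivity) (by positivity)]
      refine (Real.log_le_sub_one_of_pos (by positivity)).trans (le_of_eq ?_)
      push_cast; field_simp; ring
    have hh0 : 0 ≤ h := by
      rw [hh, hb]; dsimp only; rw [← sub_div]
      refine div_nonneg (sub_nonneg.2 (Real.log_le_log (by positivity) (by push_cast; linarith))) hT.le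
    have hhle : h ≤ 1 / ((τ:ℝ) + 1) / T := by
      rw [hh, hb]; dsimp only; rw [← sub_div]
      exact div_le_div_of_nonneg_right hlog hT.le
    have := mc_pi_lip E M hM (b τ) h hh0
    have hbh : b τ + h = b (τ + 1) := by rw [hh]; ring
    rw [hbh] at this
    refine this.trans (sub_le_sub_right (Real.exp_le_exp.2 ?_) _)
    calc 2 * h * M ≤ 2 * (1 / ((τ:ℝ) + 1) / T) * M := by gcongr
      _ = _ := by ring
  have hηε : ∀ θ > 0, ∀ᶠ τ in atTop, η τ ≤ θ * ε τ := by
    intro θ hθ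
    set c := 2 * (M / T) with hc
    have hc0 : 0 ≤ c := by positivity
    have hl1 : Tendsto (fun τ : ℕ => c / ((τ:ℝ) + 1)) atTop (nhds 0) := by
      have := (tendsto_one_div_add_atTop_nhds_zero_nat (𝕜 := ℝ)).const_mul c
      simpa [div_eq_mul_inv] using this
    have hl2 : Tendsto (fun τ : ℕ => ((τ:ℝ) + 1) ^ (-(1 - a))) atTop (nhds 0) :=
      (tendsto_rpow_neg_atTop (by linarith)).comp
        (tendsto_atTop_add_const_right _ _ tendsto_natCast_atTop_atTop)
    have hl3 : Tendsto (fun τ : ℕ => 2 * c * ((τ:ℝ) + 1) ^ (-(1 - a))) atTop (nhds 0) := by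
      simpa using hl2.const_mul (2 * c)
    filter_upwards [hl1.eventually (gt_mem_nhds zero_lt_one),
      hl3.eventually (gt_mem_nhds (show (0:ℝ) < θ * ρ by positivity))] with τ h1 h2
    have hp : (0:ℝ) < (τ:ℝ) + 1 := by positivity
    have hx0 : 0 ≤ c / ((τ:ℝ) + 1) := by positivity
    have hexp : Real.exp (c / ((τ:ℝ) + 1)) - 1 ≤ 2 * (c / ((τ:ℝ) + 1)) := by
      have := Real.abs_exp_sub_one_le (x := c / ((τ:ℝ) + 1)) (by rw [abs_of_nonneg hx0]; exact h1.le)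
      rw [abs_of_nonneg hx0] at this
      exact (le_abs_self _).trans this
    refine (hηle τ).trans (hexp.trans ?_)
    rw [hεeq]
    have e1 : ((τ:ℝ) + 1) ^ (-(1 - a)) * ((τ:ℝ) + 1) = ((τ:ℝ) + 1) ^ a := by
      rw [← Real.rpow_add_one hp.ne']; ring_nf
    have e2 : ((τ:ℝ) + 1) ^ a * ((τ:ℝ) + 1) ^ (-a) = 1 := by
      rw [← Real.rpow_add hp]; simp
    have e3 : 0 < ((τ:ℝ) + 1) ^ (-a) := Real.rpow_pos_of_pos hp _
    have h3 : 2 * c * ((τ:ℝ) + 1) ^ a ≤ θ * ρ * ((τ:ℝ) + 1) := by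
      rw [← e1, ← mul_assoc]; exact mul_le_mul_of_nonneg_right h2.le hp.le
    rw [← mul_div_assoc, div_le_iff₀ hp]
    calc 2 * c = 2 * c * (((τ:ℝ) + 1) ^ a * ((τ:ℝ) + 1) ^ (-a)) := by rw [e2, mul_one]
      _ = (2 * c * ((τ:ℝ) + 1) ^ a) * ((τ:ℝ) + 1) ^ (-a) := by ring
      _ ≤ (θ * ρ * ((τ:ℝ) + 1)) * ((τ:ℝ) + 1) ^ (-a) := mul_le_mul_of_nonneg_right h3 e3.le
      _ = _ := by ring
  have hδlim : Tendsto δ atTop (nhds 0) :=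
    mc_real_rec δ ε η hrec (fun τ => Finset.sum_nonneg fun y _ => abs_nonneg _) hε0 hε1 hdiv hηε
  have hdivn : Tendsto (fun r : ℕ => r / n) atTop atTop := by
    apply tendsto_atTop.2
    intro B
    filter_upwards [eventually_ge_atTop (B * n)] with r hr
    exact (Nat.le_div_iff_mul_le hn).2 hr
  have hblim : Tendsto b atTop atTop := by
    refine Tendsto.atTop_div_const hT ?_
    exact Real.tendsto_log_atTop.comp (tendsto_natCast_atTop_atTop.comp (tendsto_add_atTop_nat 1))
  have hmain := (mc_pi_lim E).comp (hblim.comp hdivn)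
  have herr : Tendsto (fun r : ℕ => ∑ y, (ν r y - mcPi E (b (r / n)) y) * E y) atTop (nhds 0) := by
    have hz : Tendsto (fun r : ℕ => M * δ (r / n)) atTop (nhds 0) := by
      simpa using (hδlim.comp hdivn).const_mul M
    refine squeeze_zero_norm (fun r => ?_) hz
    rw [Real.norm_eq_abs]
    have hr : n * (r / n) + r % n = r := Nat.div_add_mod r n
    have h1 := hmid (r / n) (r % n) (Nat.mod_lt _ hn).le
    rw [hr] at h1
    calc |∑ y, (ν r y - mcPi E (b (r / n)) y) * E y| ≤ ∑ y, |(ν r y - mcPi E (b (r / n)) y) * E y| :=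
          Finset.abs_sum_le_sum_abs _ _
      _ ≤ ∑ y, M * |ν r y - mcPi E (b (r / n)) y| := by
          refine Finset.sum_le_sum fun y _ => ?_
          rw [abs_mul, mul_comm]
          exact mul_le_mul_of_nonneg_right (hM y) (abs_nonneg _)
      _ = M * ∑ y, |ν r y - mcPi E (b (r / n)) y| := by rw [Finset.mul_sum]
      _ ≤ _ := mul_le_mul_of_nonneg_left h1 hM0
  have := hmain.add herr
  rw [add_zero] at this
  refine this.congr fun r => ?_
  simp only [Function.comp, ← Finset.sum_add_distrib]
  refine Finset.sum_congr rfl fun y _ => ?_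
  ring

end annealing

open Filter MeasureTheory

lemma mc_kingman {Ω : Type*} [MeasurableSpace Ω] {T : Ω → Ω} {μ : Measure Ω}
    [IsProbabilityMeasure μ] (hT : Ergodic T μ) (F : ℕ → Ω → ℝ) (hm : ∀ n, Measurable (F n))
    (C : ℝ) (hC : ∀ n x, |F n x| ≤ C * n)
    (hsub : ∀ n m x, F (n + m) x ≤ F n x + F m (T^[n] x)) (V : ℝ)
    (hV : ∀ n, V * n ≤ ∫ x, F n x ∂μ) (c : ℝ) (hc : c < V) :
    ∀ᵐ x ∂μ, ∀ᶠ n : ℕ in atTop, c * n ≤ F n x := by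
  have hΩ : Nonempty Ω := by
    by_contra h
    rw [not_nonempty_iff] at h
    have := measure_univ (μ := μ)
    rw [Set.univ_eq_empty_iff.2 h] at this
    simp at this
  have hC0 : 0 ≤ C := by
    have := (abs_nonneg _).trans (hC 1 hΩ.some); simpa using this
  have hTm := hT.measurable
  obtain ⟨c', hcc', hc'V⟩ := exists_between hc
  set G : Set Ω := {x | ∀ j : ℕ, ∃ᶠ n : ℕ in atTop, F n x < c' * n - j} with hG
  have hGm : MeasurableSet G := by
    have : G = ⋂ j : ℕ, ⋂ N : ℕ, ⋃ n : ℕ, ⋃ (_ : N ≤ n), {x | F n x < c' * n - j} := by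
      ext x
      simp only [hG, Set.mem_ofPred_eq, frequently_atTop, Set.mem_iInter, Set.mem_iUnion]
      simp
    rw [this]
    refine MeasurableSet.iInter fun j => MeasurableSet.iInter fun N => MeasurableSet.iUnion fun n =>
      MeasurableSet.iUnion fun _ => measurableSet_lt (hm n) measurable_const
  have hGinv : T ⁻¹' G ⊆ G := by
    intro x hx j
    obtain ⟨j', hj'⟩ := exists_nat_ge (j + C + |c'|)
    have h1 : ∃ᶠ n : ℕ in atTop, F n (T x) < c' * n - j' := hx j'
    rw [frequently_atTop] at h1 ⊢
    intro N
    obtain ⟨n, hn, h2⟩ := h1 N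
    refine ⟨1 + n, by omega, ?_⟩
    have h3 := hsub 1 n x
    have h4 := (abs_le.1 (hC 1 x)).2
    have h5 := neg_abs_le c'
    simp only [Function.iterate_one] at h3
    push_cast at h4 ⊢
    linarith
  have hG01 := hT.ae_empty_or_univ_of_preimage_ae_le hGm.nullMeasurableSet
    (Eventually.of_forall hGinv)
  have hGnull : G =ᵐ[μ] (∅ : Set Ω) := by
    rcases hG01 with h | h
    · exact h
    exfalso
    -- bad sets
    set B : ℕ → Set Ω := fun N => {x | ∀ n, 1 ≤ n → n ≤ N → c' * n ≤ F n x} with hB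
    have hBm : ∀ N, MeasurableSet (B N) := by
      intro N
      have : B N = ⋂ n : ℕ, ⋂ (_ : 1 ≤ n), ⋂ (_ : n ≤ N), {x | c' * n ≤ F n x} := by
        ext x; simp [hB]
      rw [this]
      exact MeasurableSet.iInter fun n => MeasurableSet.iInter fun _ => MeasurableSet.iInter fun _ =>
        measurableSet_le measurable_const (hm n)
    have hBanti : Antitone B := fun N M hNM x hx n h1 h2 => hx n h1 (h2.trans hNM)
    have hBinter : μ (⋂ N, B N) = 0 := by
      have hsubset : (⋂ N, B N) ⊆ Gᶜ := by
        intro x hx hxG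
        have := hxG 0
        rw [frequently_atTop] at this
        obtain ⟨n, hn, h2⟩ := this 1
        have h3 := (Set.mem_iInter.1 hx n) n hn le_rfl
        push_cast at h2
        linarith
      refine measure_mono_null hsubset ?_
      rw [ae_eq_univ] at h
      exact h
    have hBlim : Tendsto (fun N => μ.real (B N)) atTop (nhds 0) := by
      have h1 := tendsto_measure_iInter_atTop (μ := μ) (fun N => (hBm N).nullMeasurableSet) hBanti
        ⟨0, measure_ne_top _ _⟩
      rw [hBinter] at h1
      have := (ENNReal.tendsto_toReal ENNReal.zero_ne_top).comp h1
      simpa [Measure.real, Function.comp_def] using this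
    set K := C + |c'| with hK
    have hK0 : 0 ≤ K := by positivity
    have hparse : ∀ N M x, F M x ≤ c' * M + K * ∑ i ∈ Finset.range M, (B N).indicator 1 (T^[i] x) + K * N := by
      intro N M
      induction M using Nat.strong_induction_on with
      | _ M ih =>
        intro x
        have hind : ∀ S : Finset ℕ, ∀ x, 0 ≤ ∑ i ∈ S, (B N).indicator (1 : Ω → ℝ) (T^[i] x) :=
          fun S x => Finset.sum_nonneg fun i _ => Set.indicator_nonneg (fun _ _ => zero_le_one) _
        have hstep : ∀ m, 1 ≤ m → m ≤ M → F M x ≤ F m x + (c' * (M - m) +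
            K * ∑ i ∈ Finset.range (M - m), (B N).indicator 1 (T^[m + i] x) + K * N) := by
          intro m h1 h2
          have h3 := hsub m (M - m) x
          rw [Nat.add_sub_cancel' h2] at h3
          have h4 := ih (M - m) (by omega) (T^[m] x)
          simp only [← Function.iterate_add_apply, Nat.cast_sub h2] at h4
          simp only [add_comm _ m] at h4
          linarith
        have hsplit : ∀ m, m ≤ M → ∑ i ∈ Finset.range M, (B N).indicator (1 : Ω → ℝ) (T^[i] x) =
            ∑ i ∈ Finset.range m, (B N).indicator (1 : Ω → ℝ) (T^[i] x) +
            ∑ i ∈ Finset.range (M - m), (B N).indicator 1 (T^[m + i] x) := by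
          intro m h2
          rw [← Finset.sum_range_add, Nat.add_sub_cancel' h2]
        by_cases hxB : x ∈ B N
        · rcases Nat.eq_zero_or_pos M with rfl | hM
          · have := (abs_le.1 (hC 0 x)).2
            simp at this ⊢
            have : 0 ≤ K * N := by positivity
            linarith
          · have h1 := hstep 1 le_rfl hM
            have h2 := hsplit 1 hM
            simp only [Finset.range_one, Finset.sum_singleton, Function.iterate_zero, id,
              Set.indicator_of_mem hxB, Pi.one_apply] at h2
            have h3 := (abs_le.1 (hC 1 x)).2
            have h5 := neg_abs_le c'
            rw [h2, mul_add]
            push_cast at h1 h3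
            linarith
        · simp only [hB, Set.mem_ofPred_eq, not_forall, not_le] at hxB
          obtain ⟨m, h1, h2, h3⟩ := hxB
          by_cases hmM : m ≤ M
          · have h4 := hstep m h1 hmM
            have h5 := hsplit m hmM
            have h6 := mul_nonneg hK0 (hind (Finset.range m) x)
            rw [h5, mul_add]
            linarith
          · have h4 := (abs_le.1 (hC M x)).2
            have h6 := mul_nonneg hK0 (hind (Finset.range M) x)
            have h7 : (M:ℝ) ≤ N := by exact_mod_cast (by omega : M ≤ N)
            have h8 : K * M ≤ K * N := mul_le_mul_of_nonneg_left h7 hK0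
            have h9 : -(|c'|) * M ≤ c' * M := mul_le_mul_of_nonneg_right (neg_abs_le c') (Nat.cast_nonneg _)
            rw [hK] at h8
            have : (C + |c'|) * M = C * M + |c'| * M := by ring
            linarith
    have hiter : ∀ i, MeasurePreserving (T^[i]) μ μ := fun i => hT.toMeasurePreserving.iterate i
    have hindint : ∀ N i, Integrable (fun x => (B N).indicator (1 : Ω → ℝ) (T^[i] x)) μ := by
      intro N i
      have : Integrable ((B N).indicator (1 : Ω → ℝ)) μ := (integrable_const (1:ℝ)).indicator (hBm N)
      exact (hiter i).integrable_comp_of_integrable this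
    have hindval : ∀ N i, ∫ x, (B N).indicator (1 : Ω → ℝ) (T^[i] x) ∂μ = μ.real (B N) := by
      intro N i
      have h1 : ∫ x, (B N).indicator (1 : Ω → ℝ) (T^[i] x) ∂μ = ∫ x, (B N).indicator (1 : Ω → ℝ) x ∂(μ.map T^[i]) := by
        rw [integral_map (hiter i).aemeasurable]
        exact ((measurable_one.indicator (hBm N))).aestronglyMeasurable
      rw [h1, (hiter i).map_eq, integral_indicator_one (hBm N)]
    have hFint : ∀ M, Integrable (F M) μ := fun M =>
      Integrable.of_bound (hm M).aestronglyMeasurable (C * M) (Eventually.of_forall (hC M))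
    have hbound : ∀ N (M : ℕ), V * M ≤ c' * M + K * (M * μ.real (B N)) + K * N := by
      intro N M
      have h1 : ∫ x, F M x ∂μ ≤ ∫ x, (c' * M + K * ∑ i ∈ Finset.range M, (B N).indicator 1 (T^[i] x) + K * N) ∂μ := by
        refine integral_mono (hFint M) ?_ (hparse N M)
        exact (((integrable_const _).add ((integrable_finsetSum _ fun i _ => hindint N i).const_mul K)).add
          (integrable_const _))
      have hi2 : Integrable (fun x => K * ∑ i ∈ Finset.range M, (B N).indicator (1 : Ω → ℝ) (T^[i] x)) μ :=
        (integrable_finsetSum _ fun i _ => hindint N i).const_mul K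
      have hi3 : ∫ x, K * ∑ i ∈ Finset.range M, (B N).indicator (1 : Ω → ℝ) (T^[i] x) ∂μ =
          K * (M * μ.real (B N)) := by
        rw [integral_const_mul, integral_finsetSum _ (fun i _ => hindint N i)]
        simp only [hindval]
        simp
      rw [integral_add (by exact (integrable_const _).add hi2) (integrable_const _),
        integral_add (integrable_const _) hi2, hi3] at h1
      simp at h1
      linarith [hV M]
    have hbound2 : ∀ N, V ≤ c' + K * μ.real (B N) := by
      intro N
      by_contra hcon
      push Not at hcon
      obtain ⟨M, hM⟩ := exists_nat_gt (K * N / (V - (c' + K * μ.real (B N))))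
      have hp : 0 < V - (c' + K * μ.real (B N)) := by linarith
      rw [div_lt_iff₀ hp] at hM
      have := hbound N M
      nlinarith
    have hl : Tendsto (fun N => c' + K * μ.real (B N)) atTop (nhds (c' + K * 0)) :=
      (hBlim.const_mul K).const_add c'
    have := ge_of_tendsto' hl hbound2
    linarith
  rw [ae_eq_empty] at hGnull
  have hae : ∀ᵐ x ∂μ, x ∉ G := by
    rw [ae_iff]; simpa using hGnull
  filter_upwards [hae] with x hx
  simp only [hG, Set.mem_ofPred_eq, not_forall, not_frequently, not_lt] at hx
  obtain ⟨j, hj⟩ := hx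
  obtain ⟨n0, hn0⟩ := exists_nat_ge (j / (c' - c))
  filter_upwards [hj, eventually_ge_atTop n0] with n h1 h2
  have h3 : (j:ℝ) / (c' - c) ≤ n := hn0.trans (by exact_mod_cast h2)
  rw [div_le_iff₀ (by linarith)] at h3
  linarith

open Filter MeasureTheory

set_option linter.unusedSectionVars false
set_option linter.unusedVariables false

section renewal

variable {A : Type*} [Fintype A] [DecidableEq A] [Nonempty A]

def mcRes {A : Type*} (n : ℕ) (y : ℕ → A) : Fin n → A := fun i => y i.val

noncomputable def mcExt {A : Type*} [Nonempty A] {n : ℕ} (v : Fin n → A) : ℕ → A :=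
  fun t => if h : t < n then v ⟨t, h⟩ else Classical.arbitrary A

def mcSh {A : Type*} (i : ℕ) (y : ℕ → A) : ℕ → A := fun t => y (i + t)

lemma mcExt_lt {n : ℕ} (v : Fin n → A) (t : ℕ) (h : t < n) : mcExt v t = v ⟨t, h⟩ := by
  simp [mcExt, h]

lemma mcRes_ext {n : ℕ} (v : Fin n → A) : mcRes n (mcExt v) = v := by
  funext i; simp [mcRes, mcExt]

lemma mcExt_res {n : ℕ} (y : ℕ → A) (t : ℕ) (h : t < n) : mcExt (mcRes n y) t = y t := by
  simp [mcExt, h, mcRes]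

lemma mcSh_sh (i j : ℕ) (y : ℕ → A) : mcSh i (mcSh j y) = mcSh (j + i) y := by
  funext t; simp [mcSh, add_assoc]

lemma mcSh_zero (y : ℕ → A) : mcSh 0 y = y := by
  funext t; simp [mcSh]

lemma mcSh_iter (n : ℕ) (y : ℕ → A) : (fun (x : ℕ → A) i => x (i + 1))^[n] y = mcSh n y := by
  induction n with
  | zero => simp [mcSh_zero]
  | succ n ih =>
    rw [Function.iterate_succ_apply', ih]
    funext t; simp only [mcSh]; congr 1; omega

noncomputable def mcRen (p : (n : ℕ) → (Fin n → A) → ℝ) : ℕ → (ℕ → A) → ℝ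
  | 0, _ => 1
  | n + 1, y => ∑ j : Fin (n + 1), p (j.val + 1) (mcRes (j.val + 1) y) *
      mcRen p (n - j.val) (mcSh (j.val + 1) y)
termination_by n _ => n
decreasing_by omega

lemma mcRen_zero (p : (n : ℕ) → (Fin n → A) → ℝ) (y) : mcRen p 0 y = 1 := by
  rw [mcRen]

lemma mcRen_succ (p : (n : ℕ) → (Fin n → A) → ℝ) (n y) : mcRen p (n+1) y =
    ∑ j ∈ Finset.range (n + 1), p (j + 1) (mcRes (j + 1) y) *
      mcRen p (n - j) (mcSh (j + 1) y) := by
  rw [mcRen, Finset.sum_range]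

lemma mcRes_congr {n : ℕ} {y y' : ℕ → A} (h : ∀ t < n, y t = y' t) : mcRes n y = mcRes n y' := by
  funext i; exact h i i.2

lemma mcRen_local (p : (n : ℕ) → (Fin n → A) → ℝ) (n : ℕ) :
    ∀ y y', (∀ t < n, y t = y' t) → mcRen p n y = mcRen p n y' := by
  induction n using Nat.strong_induction_on with
  | _ n ih =>
    intro y y' h
    cases n with
    | zero => rw [mcRen_zero, mcRen_zero]
    | succ n =>
      rw [mcRen_succ, mcRen_succ]
      refine Finset.sum_congr rfl fun j hj => ?_
      have hj' : j < n + 1 := Finset.mem_range.1 hj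
      rw [mcRes_congr (fun t ht => h t (by omega)),
        ih (n - j) (by omega) (mcSh (j+1) y) (mcSh (j+1) y') (fun t ht => h _ (by omega))]

lemma mcRen_nonneg (p : (n : ℕ) → (Fin n → A) → ℝ) (hp : ∀ n v, 0 ≤ p n v) (n : ℕ) :
    ∀ y, 0 ≤ mcRen p n y := by
  induction n using Nat.strong_induction_on with
  | _ n ih =>
    intro y
    cases n with
    | zero => rw [mcRen_zero]; norm_num
    | succ n =>
      rw [mcRen_succ]
      exact Finset.sum_nonneg fun j hj => mul_nonneg (hp _ _) (ih _ (by omega) _)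

lemma mcRen_super (p : (n : ℕ) → (Fin n → A) → ℝ) (hp : ∀ n v, 0 ≤ p n v) (m n : ℕ) :
    ∀ y, mcRen p n y * mcRen p m (mcSh n y) ≤ mcRen p (n + m) y := by
  induction n using Nat.strong_induction_on with
  | _ n ih =>
    intro y
    cases n with
    | zero => rw [mcRen_zero, mcSh_zero, one_mul, zero_add]
    | succ n =>
      rw [show n + 1 + m = (n + m) + 1 by omega, mcRen_succ, mcRen_succ, Finset.sum_mul]
      calc ∑ j ∈ Finset.range (n + 1), p (j + 1) (mcRes (j + 1) y) *
              mcRen p (n - j) (mcSh (j + 1) y) * mcRen p m (mcSh (n+1) y)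
          ≤ ∑ j ∈ Finset.range (n + 1), p (j + 1) (mcRes (j + 1) y) *
              mcRen p (n + m - j) (mcSh (j + 1) y) := by
            refine Finset.sum_le_sum fun j hj => ?_
            have hj' : j < n + 1 := Finset.mem_range.1 hj
            rw [mul_assoc]
            refine mul_le_mul_of_nonneg_left ?_ (hp _ _)
            have := ih (n - j) (by omega) (mcSh (j+1) y)
            rw [mcSh_sh, show j + 1 + (n - j) = n + 1 by omega,
              show n - j + m = n + m - j by omega] at this
            exact this
        _ ≤ _ := Finset.sum_le_sum_of_subset_of_nonneg
            (Finset.range_subset_range.2 (by omega))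
            (fun j _ _ => mul_nonneg (hp _ _) (mcRen_nonneg p hp _ _))

lemma mcRen_ge (p : (n : ℕ) → (Fin n → A) → ℝ) (hp : ∀ n v, 0 ≤ p n v) (n : ℕ) (hn : 1 ≤ n) (y) :
    p n (mcRes n y) ≤ mcRen p n y := by
  obtain ⟨m, rfl⟩ : ∃ m, n = m + 1 := ⟨n - 1, by omega⟩
  rw [mcRen_succ]
  have := Finset.single_le_sum (f := fun j => p (j + 1) (mcRes (j + 1) y) *
      mcRen p (m - j) (mcSh (j + 1) y)) (s := Finset.range (m+1))
      (fun j _ => mul_nonneg (hp _ _) (mcRen_nonneg p hp _ _)) (Finset.mem_range.2 (Nat.lt_succ_self m))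
  simpa [mcRen_zero] using this

lemma mc_split_sum (a b : ℕ) (f : (Fin a → A) → ℝ) (g : (ℕ → A) → ℝ)
    (hg : ∀ y y', (∀ t < b, y t = y' t) → g y = g y') :
    ∑ v : Fin (a + b) → A, f (mcRes a (mcExt v)) * g (mcSh a (mcExt v)) =
      (∑ u, f u) * ∑ w : Fin b → A, g (mcExt w) := by
  rw [← (Fin.appendEquiv a b).sum_comp, Fintype.sum_prod_type, Finset.sum_mul]
  refine Finset.sum_congr rfl fun u _ => ?_
  rw [Finset.mul_sum]
  refine Finset.sum_congr rfl fun w _ => ?_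
  have h1 : mcRes a (mcExt (Fin.appendEquiv a b (u, w))) = u := by
    funext i
    have : i.val < a + b := by omega
    simp only [mcRes, mcExt, this, dif_pos, Fin.appendEquiv, Equiv.coe_fn_mk]
    exact Fin.append_left u w i
  have h2 : g (mcSh a (mcExt (Fin.appendEquiv a b (u, w)))) = g (mcExt w) := by
    apply hg
    intro t ht
    have : a + t < a + b := by omega
    simp only [mcSh, mcExt, this, ht, dif_pos, Fin.appendEquiv, Equiv.coe_fn_mk]
    exact Fin.append_right u w ⟨t, ht⟩
  rw [h1, h2]

lemma mcRen_kraft (p : (n : ℕ) → (Fin n → A) → ℝ) (hp : ∀ n v, 0 ≤ p n v) (w : ℕ → ℝ)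
    (hw : ∀ n, ∑ j ∈ Finset.range n, w (j + 1) ≤ 1)
    (hpw : ∀ n, 1 ≤ n → ∑ v, p n v ≤ w n) (n : ℕ) :
    ∑ v : Fin n → A, mcRen p n (mcExt v) ≤ 1 := by
  induction n using Nat.strong_induction_on with
  | _ n ih =>
    cases n with
    | zero => simp [mcRen_zero]
    | succ n =>
      simp only [mcRen_succ]
      rw [Finset.sum_comm]
      refine le_trans (Finset.sum_le_sum fun j hj => ?_) (hw (n+1))
      have hj' : j < n + 1 := Finset.mem_range.1 hj
      obtain ⟨b, hb⟩ : ∃ b, n + 1 = (j + 1) + b := ⟨n - j, by omega⟩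
      have hb' : n - j = b := by omega
      rw [hb', hb, mc_split_sum (j+1) b (p (j+1)) (mcRen p b) (mcRen_local p b)]
      have h0 : 0 ≤ ∑ u, p (j+1) u := Finset.sum_nonneg fun u _ => hp _ _
      calc _ ≤ (∑ u, p (j+1) u) * 1 := mul_le_mul_of_nonneg_left (ih b (by omega)) h0
        _ ≤ _ := by rw [mul_one]; exact hpw _ (by omega)

structure MCode (A : Type*) [Fintype A] [DecidableEq A] [Nonempty A] where
  L : ℕ → (ℕ → A) → ℝ
  loc : ∀ n y y', (∀ t < n, y t = y' t) → L n y = L n y'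
  sub : ∀ n m y, L (n + m) y ≤ L n y + L m (mcSh n y)
  zero : ∀ y, L 0 y = 0
  kraft : ∀ n, ∑ v : Fin n → A, (2:ℝ) ^ (-L n (mcExt v)) ≤ 1
  C : ℝ
  one : ∀ y, L 1 y ≤ C

lemma mcRen_pos (p : (n : ℕ) → (Fin n → A) → ℝ) (hp : ∀ n v, 0 ≤ p n v) (hp1 : ∀ v, 0 < p 1 v)
    (n : ℕ) : ∀ y, 0 < mcRen p n y := by
  induction n with
  | zero => intro y; rw [mcRen_zero]; norm_num
  | succ n ih =>
    intro y
    have h1 := mcRen_super p hp 1 n y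
    have h2 := mcRen_ge p hp 1 le_rfl (mcSh n y)
    exact lt_of_lt_of_le (mul_pos (ih y) (lt_of_lt_of_le (hp1 _) h2)) h1

lemma mc_exists_code (p : (n : ℕ) → (Fin n → A) → ℝ) (hp : ∀ n v, 0 ≤ p n v) (hp1 : ∀ v, 0 < p 1 v)
    (w : ℕ → ℝ) (hw : ∀ n, ∑ j ∈ Finset.range n, w (j + 1) ≤ 1)
    (hpw : ∀ n, 1 ≤ n → ∑ v, p n v ≤ w n) (C : ℝ) (hC : ∀ v, -Real.logb 2 (p 1 v) ≤ C) :
    ∃ c : MCode A, c.C = C ∧ ∀ n, 1 ≤ n → ∀ y, 0 < p n (mcRes n y) →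
      c.L n y ≤ -Real.logb 2 (p n (mcRes n y)) := by
  have hge : ∀ n, 1 ≤ n → ∀ y, 0 < p n (mcRes n y) →
      -Real.logb 2 (mcRen p n y) ≤ -Real.logb 2 (p n (mcRes n y)) := by
    intro n hn y h
    exact neg_le_neg (Real.logb_le_logb_of_le (by norm_num) h (mcRen_ge p hp n hn y))
  refine ⟨⟨fun n y => -Real.logb 2 (mcRen p n y), ?_, ?_, ?_, ?_, C, ?_⟩, rfl, hge⟩
  · intro n y y' h
    rw [mcRen_local p n y y' h]
  · intro n m y
    have h := Real.logb_le_logb_of_le (b := 2) (by norm_num)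
      (mul_pos (mcRen_pos p hp hp1 n y) (mcRen_pos p hp hp1 m (mcSh n y))) (mcRen_super p hp m n y)
    rw [Real.logb_mul (mcRen_pos p hp hp1 n y).ne' (mcRen_pos p hp hp1 m _).ne'] at h
    linarith
  · intro y; simp [mcRen_zero]
  · intro n
    refine le_trans (le_of_eq (Finset.sum_congr rfl fun v _ => ?_)) (mcRen_kraft p hp w hw hpw n)
    rw [neg_neg, Real.rpow_logb (by norm_num) (by norm_num) (mcRen_pos p hp hp1 _ _)]
  · intro y
    exact (hge 1 le_rfl y (hp1 _)).trans (hC _)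

lemma MCode.nonneg (c : MCode A) (n y) : 0 ≤ c.L n y := by
  have h1 := Finset.single_le_sum (f := fun v : Fin n → A => (2:ℝ) ^ (-c.L n (mcExt v)))
    (s := Finset.univ) (fun v _ => by positivity) (Finset.mem_univ (mcRes n y))
  have h2 := h1.trans (c.kraft n)
  have h3 : c.L n (mcExt (mcRes n y)) = c.L n y := c.loc _ _ _ (fun t ht => mcExt_res y t ht)
  simp only [h3] at h2
  by_contra hneg
  push Not at hneg
  have := Real.one_lt_rpow (x := 2) (z := -c.L n y) (by norm_num) (by linarith)
  linarith

lemma MCode.le (c : MCode A) (n) : ∀ y, c.L n y ≤ c.C * n := by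
  induction n with
  | zero => intro y; simp [c.zero]
  | succ n ih =>
    intro y
    have h1 := c.sub n 1 y
    have h2 := ih y
    have h3 := c.one (mcSh n y)
    push_cast
    linarith

lemma MCode.C_nonneg (c : MCode A) : 0 ≤ c.C :=
  (c.nonneg 1 (fun _ => Classical.arbitrary A)).trans (c.one _)

noncomputable def mcCost {X : Type*} (c : MCode A) (d : X → A → ℝ) (α : ℝ) (n : ℕ)
    (x : ℕ → X) (y : ℕ → A) : ℝ := c.L n y + α * ∑ i ∈ Finset.range n, d (x i) (y i)

noncomputable def mcF {X : Type*} (c : MCode A) (d : X → A → ℝ) (α : ℝ) (n : ℕ)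
    (x : ℕ → X) : ℝ := ⨅ v : Fin n → A, mcCost c d α n x (mcExt v)

variable {X : Type*} (c : MCode A) (d : X → A → ℝ) (α : ℝ)

lemma mcCost_local (n : ℕ) (x : ℕ → X) (y y' : ℕ → A) (h : ∀ t < n, y t = y' t) :
    mcCost c d α n x y = mcCost c d α n x y' := by
  unfold mcCost
  rw [c.loc n y y' h]
  congr 2
  refine Finset.sum_congr rfl fun i hi => ?_
  rw [h i (Finset.mem_range.1 hi)]

lemma mcF_le (n : ℕ) (x : ℕ → X) (y : ℕ → A) : mcF c d α n x ≤ mcCost c d α n x y := by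
  rw [← mcCost_local c d α n x (mcExt (mcRes n y)) y (fun t ht => mcExt_res y t ht)]
  exact ciInf_le (f := fun v : Fin n → A => mcCost c d α n x (mcExt v)) (Set.finite_range _).bddBelow _

lemma mcF_exists (n : ℕ) (x : ℕ → X) : ∃ v : Fin n → A, mcCost c d α n x (mcExt v) = mcF c d α n x :=
  exists_eq_ciInf_of_finite (f := fun v : Fin n → A => mcCost c d α n x (mcExt v))

lemma mcF_sub (n m : ℕ) (x : ℕ → X) : mcF c d α (n + m) x ≤ mcF c d α n x + mcF c d α m (mcSh n x) := by
  obtain ⟨u, hu⟩ := mcF_exists c d α n x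
  obtain ⟨v, hv⟩ := mcF_exists c d α m (mcSh n x)
  rw [← hu, ← hv]
  set y : ℕ → A := fun t => if t < n then mcExt u t else mcExt v (t - n) with hy
  refine (mcF_le c d α (n+m) x y).trans ?_
  rw [mcCost_local c d α n x (mcExt u) y (fun t ht => by simp [hy, ht]),
    mcCost_local c d α m (mcSh n x) (mcExt v) (mcSh n y) (fun t ht => by simp [hy, mcSh])]
  unfold mcCost
  rw [Finset.sum_range_add]
  have := c.sub n m y
  simp only [mcSh] at this ⊢
  linarith

lemma mcF_bound (hα : 0 < α) (hd : ∀ a b, 0 ≤ d a b) (dm : ℝ) (hdm : ∀ a b, d a b ≤ dm) (n : ℕ) (x : ℕ → X) :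
    |mcF c d α n x| ≤ (c.C + α * dm) * n := by
  obtain ⟨u, hu⟩ := mcF_exists c d α n x
  rw [← hu]
  unfold mcCost
  have h1 := c.nonneg n (mcExt u)
  have h2 := c.le n (mcExt u)
  have h3 : 0 ≤ ∑ i ∈ Finset.range n, d (x i) (mcExt u i) := Finset.sum_nonneg fun i _ => hd _ _
  have h4 : ∑ i ∈ Finset.range n, d (x i) (mcExt u i) ≤ n * dm := by
    refine (Finset.sum_le_sum fun i _ => hdm _ _).trans ?_
    simp
  have h5 := mul_le_mul_of_nonneg_left h4 hα.le
  have h6 := mul_nonneg hα.le h3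
  rw [abs_of_nonneg (by linarith)]
  linarith

lemma mcF_measurable [Fintype X] [MeasurableSpace X] [DiscreteMeasurableSpace X] (n : ℕ) :
    Measurable (fun x : ℕ → X => mcF c d α n x) := by
  unfold mcF mcCost
  refine Measurable.iInf fun v => ?_
  refine measurable_const.add (Measurable.const_mul (Finset.measurable_sum _ fun i _ => ?_) _)
  exact (measurable_of_finite (fun a : X => d a (mcExt v i))).comp (measurable_pi_apply i)

lemma mcF_congr (n : ℕ) (x x' : ℕ → X) (h : ∀ t < n, x t = x' t) : mcF c d α n x = mcF c d α n x' := by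
  unfold mcF mcCost
  congr 1
  funext v
  congr 2
  exact Finset.sum_congr rfl fun i hi => by rw [h i (Finset.mem_range.1 hi)]

end renewal

open Filter MeasureTheory

set_option linter.unusedSectionVars false
set_option linter.unusedVariables false

section pe

variable {A : Type*} [Fintype A] [DecidableEq A] [Nonempty A]

lemma mc_shift_sum (n : ℕ) (f : ℕ → ℝ) (hf : ∀ t, f (t + n) = f t) (s : ℕ) :
    ∑ i ∈ Finset.range n, f (i + s) = ∑ i ∈ Finset.range n, f i := by
  induction s with
  | zero => simp
  | succ s ih =>
    rw [← ih]
    have h1 := Finset.sum_range_succ (fun i => f (i + s)) n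
    have h2 := Finset.sum_range_succ' (fun i => f (i + s)) n
    have h3 : f (n + s) = f (0 + s) := by rw [zero_add, add_comm, hf]
    have h4 : ∀ i, f (i + 1 + s) = f (i + (s + 1)) := fun i => by congr 1; omega
    simp only [h4] at h2
    linarith

/-- the word at position `i` has letter `a` and context `b` -/
lemma mc_emp (n k : ℕ) (hk : k < n) (z : ℕ → A) (hz : ∀ t, z (t + n) = z t) (a : A) (b : Fin k → A) :
    (n:ℝ) * empCount n k (mcRes n z) a b =
      ∑ i ∈ Finset.range n, if (z (i + k) = a ∧ mcRes k (mcSh i z) = b) then (1:ℝ) else 0 := by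
  have hn : (n:ℝ) ≠ 0 := by
    have : 0 < n := by omega
    positivity
  have hmod : ∀ t, z (t % n) = z t := by
    intro t
    conv_rhs => rw [← Nat.mod_add_div t n]
    generalize t / n = q
    generalize t % n = r
    induction q with
    | zero => simp
    | succ q ih => rw [ih, Nat.mul_succ, ← add_assoc, hz]
  unfold empCount
  rw [mul_div_cancel₀ _ hn, Finset.card_filter, Nat.cast_sum]
  rw [← mc_shift_sum n (fun i => if (z (i + k) = a ∧ mcRes k (mcSh i z) = b) then (1:ℝ) else 0) ?_ (n - k),
    Finset.sum_range]
  · refine Finset.sum_congr rfl fun i _ => ?_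
    push_cast
    have e : ∀ j : Fin k, (i.val + (n - (k - j.val) % n)) = i + (n - k) + j := by
      intro j
      have : (k - j.val) % n = k - j.val := Nat.mod_eq_of_lt (by omega)
      rw [this]; omega
    simp only [mcRes, mcSh, e, hmod, funext_iff]
    rw [show (i:ℕ) + (n - k) + k = i + n by omega, hz]
  · intro t
    have : mcSh (t + n) z = mcSh t z := by
      funext s; simp only [mcSh]; rw [show t + n + s = t + s + n by omega, hz]
    rw [this, show t + n + k = t + k + n by omega, hz]

lemma mc_emp_sum (n k : ℕ) (hk : k < n) (z : ℕ → A) (hz : ∀ t, z (t + n) = z t)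
    (g : A → (Fin k → A) → ℝ) :
    (n:ℝ) * ∑ b, ∑ a, empCount n k (mcRes n z) a b * g a b =
      ∑ i ∈ Finset.range n, g (z (i + k)) (mcRes k (mcSh i z)) := by
  rw [Finset.mul_sum]
  simp_rw [Finset.mul_sum, ← mul_assoc, mc_emp n k hk z hz, Finset.sum_mul]
  rw [Finset.sum_congr rfl fun b _ => Finset.sum_comm, Finset.sum_comm]
  refine Finset.sum_congr rfl fun i _ => ?_
  rw [Finset.sum_eq_single (mcRes k (mcSh i z)), Finset.sum_eq_single (z (i + k))]
  · simp
  · intro a _ h; simp [Ne.symm h]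
  · simp
  · intro b _ h; simp [Ne.symm h]
  · simp

lemma mc_emp_nonneg (n k : ℕ) (y : Fin n → A) (a : A) (b : Fin k → A) : 0 ≤ empCount n k y a b := by
  unfold empCount; positivity

lemma mc_gibbs_fin {B : Type*} [Fintype B] (e P : B → ℝ) (he0 : ∀ a, 0 ≤ e a) (hP : ∀ a, 0 < P a)
    (hP1 : ∑ a, P a ≤ 1) :
    -∑ a, e a * Real.logb 2 (e a / ∑ a', e a') ≤ ∑ a, e a * (-Real.logb 2 (P a)) := by
  obtain ⟨S, hS⟩ : ∃ S, S = ∑ a, e a := ⟨_, rfl⟩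
  rw [← hS]
  have hS0 : 0 ≤ S := hS ▸ Finset.sum_nonneg fun a _ => he0 a
  have key : ∀ a, e a * (Real.log (P a) - Real.log (e a / S)) ≤ P a * S - e a := by
    intro a
    rcases (he0 a).eq_or_lt with h | h
    · rw [← h, zero_mul, sub_zero]; exact mul_nonneg (hP a).le hS0
    · have hSp : 0 < S := hS ▸ lt_of_lt_of_le h (Finset.single_le_sum (fun a _ => he0 a) (Finset.mem_univ a))
      have hq : 0 < e a / S := div_pos h hSp
      rw [← Real.log_div (hP a).ne' hq.ne']
      have h1 := Real.log_le_sub_one_of_pos (div_pos (hP a) hq)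
      calc _ ≤ e a * (P a / (e a / S) - 1) := mul_le_mul_of_nonneg_left h1 h.le
        _ = _ := by have := h.ne'; have := hSp.ne'; field_simp
  have hsum : ∑ a, e a * (Real.log (P a) - Real.log (e a / S)) ≤ 0 := by
    refine (Finset.sum_le_sum fun a _ => key a).trans ?_
    rw [Finset.sum_sub_distrib, ← Finset.sum_mul, ← hS]
    nlinarith [hP1]
  have hlog : 0 < Real.log 2 := Real.log_pos (by norm_num)
  rw [← Finset.sum_neg_distrib, ← sub_nonpos, ← Finset.sum_sub_distrib]
  have : ∑ a, (-(e a * Real.logb 2 (e a / S)) - e a * -Real.logb 2 (P a)) =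
      (∑ a, e a * (Real.log (P a) - Real.log (e a / S))) / Real.log 2 := by
    rw [Finset.sum_div]
    refine Finset.sum_congr rfl fun a _ => ?_
    unfold Real.logb; ring
  rw [this]
  exact div_nonpos_of_nonpos_of_nonneg hsum hlog.le

lemma mc_gibbs_emp (n k : ℕ) (y : Fin n → A) (P : A → (Fin k → A) → ℝ) (hP : ∀ a b, 0 < P a b)
    (hP1 : ∀ b, ∑ a, P a b ≤ 1) :
    condEmpEntropy n k y ≤ ∑ b, ∑ a, empCount n k y a b * (-Real.logb 2 (P a b)) := by
  unfold condEmpEntropy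
  rw [← Finset.sum_neg_distrib]
  exact Finset.sum_le_sum fun b _ => mc_gibbs_fin (fun a => empCount n k y a b) (fun a => P a b)
    (fun a => mc_emp_nonneg _ _ _ _ _) (fun a => hP a b) (hP1 b)

/-- initial marginals of the block code -/
noncomputable def mcQ (c : MCode A) (K j : ℕ) (y : ℕ → A) : ℝ :=
  ∑ v : Fin K → A, if (∀ t < j, mcExt v t = y t) then (2:ℝ) ^ (-c.L K (mcExt v)) else 0

lemma mcQ_local (c : MCode A) (K j : ℕ) (y y' : ℕ → A) (h : ∀ t < j, y t = y' t) :
    mcQ c K j y = mcQ c K j y' := by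
  unfold mcQ
  refine Finset.sum_congr rfl fun v _ => ?_
  have : (∀ t < j, mcExt v t = y t) ↔ (∀ t < j, mcExt v t = y' t) :=
    forall₂_congr fun t ht => by rw [h t ht]
  simp only [this]

lemma mcQ_pos (c : MCode A) (K j : ℕ) (hj : j ≤ K) (y : ℕ → A) : 0 < mcQ c K j y := by
  unfold mcQ
  refine Finset.sum_pos' (fun v _ => by split_ifs <;> positivity) ⟨mcRes K y, Finset.mem_univ _, ?_⟩
  rw [if_pos (fun t ht => mcExt_res y t (by omega))]
  positivity

lemma mcQ_zero (c : MCode A) (K : ℕ) (y : ℕ → A) : mcQ c K 0 y ≤ 1 := by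
  unfold mcQ
  simpa using c.kraft K

lemma mcQ_top (c : MCode A) (K : ℕ) (y : ℕ → A) : mcQ c K K y = (2:ℝ) ^ (-c.L K y) := by
  unfold mcQ
  rw [Finset.sum_eq_single (mcRes K y)]
  · rw [if_pos (fun t ht => mcExt_res y t (by omega)), c.loc K _ y (fun t ht => mcExt_res y t ht)]
  · intro v _ hv
    rw [if_neg]
    intro h
    apply hv
    funext t
    rw [← mcExt_lt v t t.2, h t t.2]; rfl
  · simp

lemma mcQ_step (c : MCode A) (K j : ℕ) (y : A → ℕ → A) (y0 : ℕ → A)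
    (h1 : ∀ a, ∀ t < j, y a t = y0 t) (h2 : ∀ a, y a j = a) :
    ∑ a, mcQ c K (j + 1) (y a) = mcQ c K j y0 := by
  unfold mcQ
  rw [Finset.sum_comm]
  refine Finset.sum_congr rfl fun v _ => ?_
  rw [Finset.sum_eq_single (mcExt v j)]
  · have : (∀ t < j + 1, mcExt v t = y (mcExt v j) t) ↔ (∀ t < j, mcExt v t = y0 t) := by
      constructor
      · intro h t ht; rw [h t (by omega), h1 _ t ht]
      · intro h t ht
        rcases Nat.lt_succ_iff_lt_or_eq.1 ht with h' | h'
        · rw [h t h', h1 _ t h']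
        · subst h'; rw [h2]
    simp only [this]
  · intro a _ ha
    rw [if_neg]
    intro h
    exact ha (by rw [h j (by omega), h2])
  · simp

lemma mc_window (c : MCode A) (n k : ℕ) (hk : k < n) (z : ℕ → A) (hz : ∀ t, z (t + n) = z t) :
    ((k + 1 : ℕ) : ℝ) * (n * condEmpEntropy n k (mcRes n z)) ≤
      ∑ i ∈ Finset.range n, c.L (k + 1) (mcSh i z) := by
  have hzs : ∀ t, mcSh (t + n) z = mcSh t z := by
    intro t
    funext s; simp only [mcSh]; rw [show t + n + s = t + s + n by omega, hz]
  have step : ∀ j ∈ Finset.range (k + 1), (n:ℝ) * condEmpEntropy n k (mcRes n z) ≤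
      ∑ i ∈ Finset.range n, (-Real.logb 2 (mcQ c (k+1) (j+1) (mcSh i z)) -
        -Real.logb 2 (mcQ c (k+1) j (mcSh i z))) := by
    intro j hj
    have hj : j ≤ k := by have := Finset.mem_range.1 hj; omega
    set yb : A → (Fin k → A) → ℕ → A := fun a b t => if t < j then mcExt b (k - j + t) else a with hyb
    have hg := mc_gibbs_emp n k (mcRes n z)
      (fun a b => mcQ c (k+1) (j+1) (yb a b) / mcQ c (k+1) j (yb a b))
      (fun a b => div_pos (mcQ_pos _ _ _ (by omega) _) (mcQ_pos _ _ _ (by omega) _))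
      (fun b => by
        have a0 : A := Classical.arbitrary A
        have hloc : ∀ a, mcQ c (k+1) j (yb a b) = mcQ c (k+1) j (yb a0 b) := fun a =>
          mcQ_local _ _ _ _ _ (fun t ht => by simp [hyb, ht])
        simp_rw [hloc]
        rw [← Finset.sum_div, mcQ_step c (k+1) j (fun a => yb a b) (yb a0 b)
          (fun a t ht => by simp [hyb, ht]) (fun a => by simp [hyb]), div_self (mcQ_pos _ _ _ (by omega) _).ne'])
    have hg2 := mul_le_mul_of_nonneg_left hg (Nat.cast_nonneg n : (0:ℝ) ≤ n)
    rw [mc_emp_sum n k hk z hz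
      (fun a b => -Real.logb 2 (mcQ c (k+1) (j+1) (yb a b) / mcQ c (k+1) j (yb a b)))] at hg2
    refine hg2.trans (le_of_eq ?_)
    rw [← mc_shift_sum n (fun i => -Real.logb 2 (mcQ c (k+1) (j+1) (mcSh i z)) -
        -Real.logb 2 (mcQ c (k+1) j (mcSh i z))) (fun t => by rw [hzs]) (k - j)]
    refine Finset.sum_congr rfl fun i _ => ?_
    have hl : ∀ t < j + 1, yb (z (i + k)) (mcRes k (mcSh i z)) t = mcSh (i + (k - j)) z t := by
      intro t ht
      simp only [hyb]
      split_ifs with h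
      · rw [mcExt_res _ _ (by omega)]; simp only [mcSh]; congr 1; omega
      · simp only [mcSh]; congr 1; omega
    rw [mcQ_local c (k+1) (j+1) _ _ hl, mcQ_local c (k+1) j _ _ (fun t ht => hl t (by omega)),
      Real.logb_div (mcQ_pos _ _ _ (by omega) _).ne' (mcQ_pos _ _ _ (by omega) _).ne']
    ring
  have := Finset.sum_le_sum step
  rw [Finset.sum_const, Finset.card_range, nsmul_eq_mul, Finset.sum_comm] at this
  refine this.trans (Finset.sum_le_sum fun i _ => ?_)
  rw [Finset.sum_range_sub (fun j => -Real.logb 2 (mcQ c (k+1) j (mcSh i z))), mcQ_top,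
    Real.logb_rpow (by norm_num) (by norm_num)]
  have : Real.logb 2 (mcQ c (k+1) 0 (mcSh i z)) ≤ 0 :=
    Real.logb_nonpos (by norm_num) (mcQ_pos _ _ _ (by omega) _).le (mcQ_zero _ _ _)
  linarith

noncomputable def mcPer {n : ℕ} (y : Fin n → A) : ℕ → A := fun t => mcExt y (t % n)

lemma mcPer_per {n : ℕ} (y : Fin n → A) (t : ℕ) : mcPer y (t + n) = mcPer y t := by
  simp [mcPer]

lemma mcPer_res {n : ℕ} (y : Fin n → A) : mcRes n (mcPer y) = y := by
  funext i
  simp only [mcRes, mcPer, Nat.mod_eq_of_lt i.2]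
  exact mcExt_lt y i i.2

lemma mc_kraft_aux (k : ℕ) (θ : A → (Fin k → A) → ℝ) (h0 : ∀ a b, 0 ≤ θ a b) (h1 : ∀ b, ∑ a, θ a b ≤ 1)
    (m : ℕ) : ∑ v : Fin (k + m) → A, ∏ i ∈ Finset.range m,
      θ (mcExt v (i + k)) (mcRes k (mcSh i (mcExt v))) ≤ (Fintype.card A : ℝ) ^ k := by
  induction m with
  | zero => simp
  | succ m ih =>
    refine le_trans ?_ ih
    refine (le_of_eq ((Fin.snocEquiv (fun _ : Fin (k + m + 1) => A)).sum_comp (fun v : Fin (k + m + 1) → A =>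
      ∏ i ∈ Finset.range (m + 1), θ (mcExt v (i + k)) (mcRes k (mcSh i (mcExt v))))).symm).trans ?_
    rw [Fintype.sum_prod_type, Finset.sum_comm]
    refine Finset.sum_le_sum fun v _ => ?_
    have he : ∀ a : A, ∀ t < k + m, mcExt (Fin.snocEquiv (fun _ : Fin (k + m + 1) => A) (a, v)) t = mcExt v t := by
      intro a t ht
      rw [mcExt_lt _ t (by omega), mcExt_lt _ t ht]
      exact Fin.snoc_castSucc (α := fun _ => A) a v ⟨t, ht⟩
    have hl : ∀ a : A, mcExt (Fin.snocEquiv (fun _ : Fin (k + m + 1) => A) (a, v)) (m + k) = a := by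
      intro a
      rw [mcExt_lt _ (m + k) (by omega)]
      have : (⟨m + k, by omega⟩ : Fin (k + m + 1)) = Fin.last (k + m) := by
        ext; simp; omega
      rw [this]
      exact Fin.snoc_last (α := fun _ => A) a v
    have hc : ∀ a : A, ∀ i ≤ m, mcRes k (mcSh i (mcExt (Fin.snocEquiv (fun _ : Fin (k + m + 1) => A) (a, v)))) =
        mcRes k (mcSh i (mcExt v)) := by
      intro a i hi
      apply mcRes_congr
      intro t ht
      exact he a _ (by omega)
    have : ∀ a : A, ∏ i ∈ Finset.range (m + 1),
      θ (mcExt (Fin.snocEquiv (fun _ : Fin (k + m + 1) => A) (a, v)) (i + k))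
        (mcRes k (mcSh i (mcExt (Fin.snocEquiv (fun _ : Fin (k + m + 1) => A) (a, v))))) =
      (∏ i ∈ Finset.range m, θ (mcExt v (i + k)) (mcRes k (mcSh i (mcExt v)))) *
        θ a (mcRes k (mcSh m (mcExt v))) := by
      intro a
      rw [Finset.prod_range_succ, hl, hc a m le_rfl]
      congr 1
      refine Finset.prod_congr rfl fun i hi => ?_
      have := Finset.mem_range.1 hi
      rw [he a _ (by omega), hc a i (by omega)]
    have h2 := Finset.sum_congr (rfl : (Finset.univ : Finset A) = Finset.univ) (fun a _ => this a)
    refine (le_of_eq h2).trans ?_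
    rw [← Finset.mul_sum]
    exact mul_le_of_le_one_right (Finset.prod_nonneg fun _ _ => h0 _ _) (h1 _)

lemma mc_kraft_aux2 (n k : ℕ) (hk : k < n) (θ : A → (Fin k → A) → ℝ) (h0 : ∀ a b, 0 ≤ θ a b)
    (h1 : ∀ b, ∑ a, θ a b ≤ 1) :
    ∑ y : Fin n → A, ∏ i ∈ Finset.range n,
      θ (mcPer y (i + n)) (mcRes k (mcSh (i + (n - k)) (mcPer y))) ≤ (Fintype.card A : ℝ) ^ k := by
  refine le_trans ?_ (mc_kraft_aux k θ h0 h1 n)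
  set φ : (Fin n → A) → (Fin (k + n) → A) := fun y => mcRes (k + n) (mcSh (n - k) (mcPer y)) with hφ
  have hinj : Function.Injective φ := by
    intro y y' h
    rw [← mcPer_res y, ← mcPer_res y']
    funext i
    have := congrFun h ⟨k + i, by omega⟩
    simp only [hφ, mcRes, mcSh] at this
    rw [show n - k + (k + i.val) = i + n by omega, mcPer_per, mcPer_per] at this
    exact this
  have : ∀ y, ∏ i ∈ Finset.range n,
      θ (mcPer y (i + n)) (mcRes k (mcSh (i + (n - k)) (mcPer y))) =
      (fun v : Fin (k + n) → A => ∏ i ∈ Finset.range n,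
      θ (mcExt v (i + k)) (mcRes k (mcSh i (mcExt v)))) (φ y) := by
    intro y
    refine Finset.prod_congr rfl fun i hi => ?_
    have hi := Finset.mem_range.1 hi
    congr 1
    · simp only [hφ]; rw [mcExt_res _ _ (by omega)]; simp only [mcSh]; congr 1; omega
    · apply mcRes_congr
      intro t ht
      simp only [mcSh, hφ]
      rw [mcExt_res _ _ (by omega)]; simp only [mcSh]; congr 1; omega
  simp_rw [this]
  rw [← Finset.sum_image (f := fun v : Fin (k + n) → A => ∏ i ∈ Finset.range n,
      θ (mcExt v (i + k)) (mcRes k (mcSh i (mcExt v)))) (g := φ) (s := Finset.univ) (fun a _ b _ h => hinj h)]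
  exact Finset.sum_le_sum_of_subset_of_nonneg (Finset.subset_univ _)
    (fun v _ _ => Finset.prod_nonneg fun _ _ => h0 _ _)

lemma mc_kraft (n k : ℕ) (hk : k < n) :
    ∑ y : Fin n → A, (2:ℝ) ^ (-(n * condEmpEntropy n k y)) ≤
      ((n:ℝ) + 1) ^ ((Fintype.card A) ^ (k + 1)) * (Fintype.card A : ℝ) ^ k := by
  set θ : (A → (Fin k → A) → Fin (n + 1)) → A → (Fin k → A) → ℝ :=
    fun N a b => (N a b : ℝ) / ∑ a', (N a' b : ℝ) with hθ
  have hθ0 : ∀ N a b, 0 ≤ θ N a b := fun N a b => by simp only [hθ]; positivity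
  have hθ1 : ∀ N b, ∑ a, θ N a b ≤ 1 := by
    intro N b
    simp only [hθ]
    rw [← Finset.sum_div]
    exact div_self_le_one _
  have hnr : (0:ℝ) < n := by have : 0 < n := by omega
                             positivity
  have key : ∀ y : Fin n → A, ∃ N, (2:ℝ) ^ (-(n * condEmpEntropy n k y)) =
      ∏ i ∈ Finset.range n, θ N (mcPer y (i + n)) (mcRes k (mcSh (i + (n - k)) (mcPer y))) := by
    intro y
    set cnt : A → (Fin k → A) → ℕ := fun a b => (Finset.univ.filter fun i : Fin n =>
      y i = a ∧ ∀ j : Fin k,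
        y ⟨(i.val + (n - (k - j.val) % n)) % n, Nat.mod_lt _ i.pos⟩ = b j).card with hcnt
    have hcn : ∀ a b, cnt a b < n + 1 := fun a b => by
      have := Finset.card_le_univ (Finset.univ.filter fun i : Fin n =>
        y i = a ∧ ∀ j : Fin k,
        y ⟨(i.val + (n - (k - j.val) % n)) % n, Nat.mod_lt _ i.pos⟩ = b j)
      simp only [Fintype.card_fin] at this
      simp only [hcnt]; omega
    refine ⟨fun a b => ⟨cnt a b, hcn a b⟩, ?_⟩
    set t := θ (fun a b => ⟨cnt a b, hcn a b⟩) with ht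
    have hemp : ∀ a b, empCount n k y a b = cnt a b / n := fun a b => rfl
    have hth : ∀ a b, empCount n k y a b / ∑ a', empCount n k y a' b = t a b := by
      intro a b
      simp only [hemp, ht, hθ]
      rw [← Finset.sum_div, div_div_div_cancel_right₀ hnr.ne']
    have hz := mcPer_per y
    have hzs : ∀ t, mcSh (t + n) (mcPer y) = mcSh t (mcPer y) := by
      intro t
      funext s; simp only [mcSh]; rw [show t + n + s = t + s + n by omega, hz]
    have e1 := mc_emp_sum n k hk (mcPer y) hz (fun a b => Real.logb 2 (t a b))
    rw [mcPer_res] at e1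
    have e2 : -(n * condEmpEntropy n k y) = ∑ i ∈ Finset.range n,
        Real.logb 2 (t (mcPer y (i + k)) (mcRes k (mcSh i (mcPer y)))) := by
      rw [← e1]; unfold condEmpEntropy; simp only [hth]; ring
    rw [e2, ← mc_shift_sum n _ (fun i => by rw [hzs, show i + n + k = i + k + n by omega, hz]) (n - k),
      Real.rpow_sum_of_pos (by norm_num)]
    refine Finset.prod_congr rfl fun i hi => ?_
    rw [show i + (n - k) + k = i + n by omega]
    refine Real.rpow_logb (by norm_num) (by norm_num) ?_
    have hpos : 0 < empCount n k y (mcPer y (i + n)) (mcRes k (mcSh (i + (n - k)) (mcPer y))) := by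
      have h3 := mc_emp n k hk (mcPer y) hz (mcPer y (i + n)) (mcRes k (mcSh (i + (n - k)) (mcPer y)))
      rw [← mc_shift_sum n _ (fun i => by rw [hzs, show i + n + k = i + k + n by omega, hz]) (n - k),
        mcPer_res] at h3
      have h4 := Finset.single_le_sum (f := fun i' => if (mcPer y (i' + (n - k) + k) = (mcPer y (i + n)) ∧
        mcRes k (mcSh (i' + (n - k)) (mcPer y)) = (mcRes k (mcSh (i + (n - k)) (mcPer y)))) then (1:ℝ) else 0)
        (fun _ _ => by split_ifs <;> norm_num) hi
      rw [← h3] at h4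
      rw [if_pos ⟨by congr 1; omega, rfl⟩] at h4
      by_contra hneg
      push Not at hneg
      nlinarith
    rw [← hth]
    exact div_pos hpos (lt_of_lt_of_le hpos (Finset.single_le_sum
      (f := fun a' => empCount n k y a' (mcRes k (mcSh (i + (n - k)) (mcPer y))))
      (fun a _ => mc_emp_nonneg n k y a _) (Finset.mem_univ _)))
  calc ∑ y : Fin n → A, (2:ℝ) ^ (-(n * condEmpEntropy n k y))
      ≤ ∑ y : Fin n → A, ∑ N, ∏ i ∈ Finset.range n,
          θ N (mcPer y (i + n)) (mcRes k (mcSh (i + (n - k)) (mcPer y))) := by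
        refine Finset.sum_le_sum fun y _ => ?_
        obtain ⟨N, hN⟩ := key y
        rw [hN]
        exact Finset.single_le_sum (f := fun N => ∏ i ∈ Finset.range n,
          θ N (mcPer y (i + n)) (mcRes k (mcSh (i + (n - k)) (mcPer y))))
          (fun N _ => Finset.prod_nonneg fun _ _ => hθ0 _ _ _) (Finset.mem_univ N)
    _ = ∑ N, ∑ y : Fin n → A, ∏ i ∈ Finset.range n,
          θ N (mcPer y (i + n)) (mcRes k (mcSh (i + (n - k)) (mcPer y))) := Finset.sum_comm
    _ ≤ ∑ N : (A → (Fin k → A) → Fin (n + 1)), (Fintype.card A : ℝ) ^ k :=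
        Finset.sum_le_sum fun N _ => mc_kraft_aux2 n k hk (θ N) (hθ0 N) (hθ1 N)
    _ = _ := by
        rw [Finset.sum_const, nsmul_eq_mul, Finset.card_univ]
        congr 1
        simp only [Fintype.card_fun, Fintype.card_fin]
        push_cast
        rw [← pow_mul, pow_succ]

end pe

open Filter MeasureTheory

set_option linter.unusedSectionVars false
set_option linter.unusedVariables false

section lower

variable {X : Type*} [Fintype X] [DecidableEq X] [MeasurableSpace X] [DiscreteMeasurableSpace X]
variable {A : Type*} [Fintype A] [DecidableEq A] [Nonempty A]

noncomputable def mcP (μ : Measure (ℕ → X)) (n : ℕ) (w : Fin n → X) : ℝ :=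
  (μ {x : ℕ → X | ∀ i : Fin n, x i.val = w i}).toReal

def mcFeas (μ : Measure (ℕ → X)) (n : ℕ) (ν : (Fin n → X) × (Fin n → A) → ℝ) : Prop :=
  (∀ p, 0 ≤ ν p) ∧ (∑ p, ν p = 1) ∧ (∀ w : Fin n → X, ∑ y : Fin n → A, ν (w, y) = mcP μ n w)

noncomputable def mcVal (d : X → A → ℝ) (α : ℝ) (n : ℕ) (ν : (Fin n → X) × (Fin n → A) → ℝ) : ℝ :=
  mutualInfo ν / n + α * ∑ p : (Fin n → X) × (Fin n → A), ν p * avgDist d n p.1 p.2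

lemma mcRes_measurable (n : ℕ) : Measurable (fun x : ℕ → X => mcRes n x) :=
  measurable_pi_lambda _ fun i => measurable_pi_apply _

lemma mc_integral (μ : Measure (ℕ → X)) [IsProbabilityMeasure μ] (n : ℕ) (f : (Fin n → X) → ℝ) :
    ∫ x, f (mcRes n x) ∂μ = ∑ w, mcP μ n w * f w := by
  have h1 := integral_map (μ := μ) (φ := fun x : ℕ → X => mcRes n x) (mcRes_measurable n).aemeasurable
    (f := f) (measurable_of_finite f).aestronglyMeasurable
  rw [← h1, integral_fintype]
  · refine Finset.sum_congr rfl fun w _ => ?_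
    rw [smul_eq_mul]
    congr 1
    unfold mcP Measure.real
    rw [Measure.map_apply (mcRes_measurable n) (measurableSet_singleton _)]
    congr 2
    ext x
    simp [mcRes, funext_iff, Set.mem_ofPred_eq]
  · have : IsProbabilityMeasure (Measure.map (fun x : ℕ → X => mcRes n x) μ) :=
      Measure.isProbabilityMeasure_map (mcRes_measurable n).aemeasurable
    exact Integrable.of_finite

lemma mcP_nonneg (μ : Measure (ℕ → X)) (n : ℕ) (w : Fin n → X) : 0 ≤ mcP μ n w :=
  ENNReal.toReal_nonneg

lemma mcP_sum (μ : Measure (ℕ → X)) [IsProbabilityMeasure μ] (n : ℕ) : ∑ w, mcP μ n w = 1 := by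
  have := mc_integral μ n (fun _ => 1)
  simpa using this.symm

lemma mc_nonempty (μ : Measure (ℕ → X)) [IsProbabilityMeasure μ] : Nonempty X := by
  have h : Nonempty (ℕ → X) := μ.nonempty_of_neZero
  exact ⟨h.some 0⟩

lemma mc_converse (μ : Measure (ℕ → X)) [IsProbabilityMeasure μ] (d : X → A → ℝ) (α : ℝ)
    (c : MCode A) (n : ℕ) (hn : 1 ≤ n) (V : ℝ)
    (hV : ∀ ν : (Fin n → X) × (Fin n → A) → ℝ, mcFeas μ n ν → V ≤ mcVal d α n ν) :
    V * n ≤ ∫ x, mcF c d α n x ∂μ := by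
  have := mc_nonempty μ
  choose φ hφ using fun w : Fin n → X => mcF_exists c d α n (mcExt w)
  have hnr : (0:ℝ) < n := by positivity
  set P := mcP μ n with hP
  set ν : (Fin n → X) × (Fin n → A) → ℝ := fun p => if p.2 = φ p.1 then P p.1 else 0 with hν
  have hP0 : ∀ w, 0 ≤ P w := mcP_nonneg μ n
  have hmarg : ∀ w, ∑ y, ν (w, y) = P w := by intro w; simp [hν]
  have hexp : ∀ g : (Fin n → X) × (Fin n → A) → ℝ, ∑ p, ν p * g p = ∑ w, P w * g (w, φ w) := by
    intro g
    rw [Fintype.sum_prod_type]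
    refine Finset.sum_congr rfl fun w _ => ?_
    simp [hν, ite_mul]
  have hf : mcFeas μ n ν := by
    refine ⟨fun p => ?_, ?_, hmarg⟩
    · simp only [hν]; split_ifs; exacts [hP0 _, le_rfl]
    · rw [Fintype.sum_prod_type]; simp_rw [hmarg]; exact mcP_sum μ n
  have h1 := hV ν hf
  set e : (Fin n → A) → ℝ := fun y => ∑ w, ν (w, y) with he
  have he0 : ∀ y, 0 ≤ e y := fun y => Finset.sum_nonneg fun w _ => hf.1 _
  have hes : ∑ y, e y = 1 := by
    rw [← hf.2.1, Fintype.sum_prod_type, Finset.sum_comm]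
  have hH : shannonEntropy e ≤ ∑ w, P w * c.L n (mcExt (φ w)) := by
    have := mc_gibbs_fin e (fun v => (2:ℝ) ^ (-c.L n (mcExt v))) he0 (fun v => by positivity) (c.kraft n)
    simp only [hes, div_one] at this
    refine le_trans this (le_of_eq ?_)
    rw [← hexp (fun p => c.L n (mcExt p.2)), Fintype.sum_prod_type, Finset.sum_comm]
    refine Finset.sum_congr rfl fun y _ => ?_
    rw [Real.logb_rpow (by norm_num) (by norm_num), neg_neg, he, Finset.sum_mul]
  have hI : mutualInfo ν = shannonEntropy e := by
    have h2 : shannonEntropy ν = shannonEntropy P := by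
      unfold shannonEntropy
      rw [hexp (fun p => Real.logb 2 (ν p))]
      simp [hν]
    unfold mutualInfo
    rw [h2]
    simp_rw [hmarg]
    show shannonEntropy P + shannonEntropy e - shannonEntropy P = _
    ring
  have hIntg : ∫ x, mcF c d α n x ∂μ = ∑ w, P w * mcF c d α n (mcExt w) := by
    rw [← mc_integral μ n (fun w => mcF c d α n (mcExt w))]
    refine integral_congr_ae (ae_of_all _ fun x => ?_)
    exact mcF_congr c d α n _ _ (fun t ht => (mcExt_res x t ht).symm)
  rw [hIntg]
  have hD : ∑ p : (Fin n → X) × (Fin n → A), ν p * avgDist d n p.1 p.2 =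
      (∑ w, P w * ∑ i ∈ Finset.range n, d (mcExt w i) (mcExt (φ w) i)) / n := by
    rw [hexp (fun p => avgDist d n p.1 p.2), Finset.sum_div]
    refine Finset.sum_congr rfl fun w _ => ?_
    unfold avgDist
    rw [mul_div_assoc, Finset.sum_range]
    congr 2
    refine Finset.sum_congr rfl fun i _ => ?_
    rw [mcExt_lt w i i.2, mcExt_lt _ i i.2]
  have h3 : ∑ w, P w * mcF c d α n (mcExt w) = ∑ w, P w * c.L n (mcExt (φ w)) +
      α * ∑ w, P w * ∑ i ∈ Finset.range n, d (mcExt w i) (mcExt (φ w) i) := by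
    rw [Finset.mul_sum, ← Finset.sum_add_distrib]
    refine Finset.sum_congr rfl fun w _ => ?_
    rw [← hφ w]; unfold mcCost; ring
  rw [h3]
  unfold mcVal at h1
  rw [hI, hD] at h1
  have h4 := mul_le_mul_of_nonneg_right h1 hnr.le
  rw [add_mul, div_mul_cancel₀ _ hnr.ne', mul_assoc α, div_mul_cancel₀ _ hnr.ne'] at h4
  linarith

noncomputable def mcB (a k n : ℕ) : ℝ := ((n:ℝ) + 1) ^ (a ^ (k + 1)) * (a : ℝ) ^ k

lemma mcB_small (a : ℕ) (ha : 1 ≤ a) (kn : ℕ → ℕ)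
    (hkn2 : Tendsto (fun n => (kn n : ℝ) / Real.log n) atTop (nhds 0)) (ε : ℝ) (hε : 0 < ε) :
    ∀ᶠ n : ℕ in atTop, Real.logb 2 (mcB a (kn n) n) + Real.logb 2 ((n:ℝ) * (n + 1)) ≤ ε * n := by
  have har : (1:ℝ) ≤ a := by exact_mod_cast ha
  have hla : 0 ≤ Real.log a := Real.log_nonneg har
  have hl2 : 0 < Real.log 2 := Real.log_pos (by norm_num)
  set η : ℝ := 1 / (2 * (Real.log a + 1)) with hη
  have hη0 : 0 < η := by positivity
  set ε' : ℝ := ε * Real.log 2 / (2 * (a + 3)) with hε'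
  have hε'0 : 0 < ε' := by positivity
  have h1 := hkn2.eventually (gt_mem_nhds hη0)
  have h2 := (isLittleO_log_rpow_atTop (r := 1/2) (by norm_num)).bound hε'0
  have h3 : Tendsto (fun n : ℕ => (n:ℝ) + 1) atTop atTop :=
    tendsto_atTop_add_const_right _ _ tendsto_natCast_atTop_atTop
  have h4 := h3.eventually h2
  filter_upwards [h1, h4, eventually_ge_atTop 2] with n hn1 hn2 hn3
  have hnr : (2:ℝ) ≤ n := by exact_mod_cast hn3
  have hln : 0 < Real.log n := Real.log_pos (by linarith)
  have hln1 : Real.log n ≤ Real.log (n + 1) := Real.log_le_log (by linarith) (by linarith)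
  rw [div_lt_iff₀ hln] at hn1
  have hk : (kn n : ℝ) * Real.log a ≤ 1/2 * Real.log n := by
    calc (kn n : ℝ) * Real.log a ≤ (η * Real.log n) * Real.log a := mul_le_mul_of_nonneg_right hn1.le hla
      _ = (η * Real.log a) * Real.log n := by ring
      _ ≤ _ := by
        refine mul_le_mul_of_nonneg_right ?_ hln.le
        rw [hη, div_mul_eq_mul_div, div_le_div_iff₀ (by positivity) (by norm_num)]
        linarith
  have hpow : (a:ℝ) ^ (kn n) ≤ (n:ℝ) ^ (1/2 : ℝ) := by
    rw [← Real.rpow_natCast, Real.rpow_def_of_pos (by linarith), Real.rpow_def_of_pos (by linarith)]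
    exact Real.exp_le_exp.2 (by linarith)
  have hs1 : (1:ℝ) ≤ (n:ℝ) ^ (1/2 : ℝ) := Real.one_le_rpow (by linarith) (by norm_num)
  have hlp : 0 < Real.log (n + 1) := by linarith
  rw [Real.norm_of_nonneg hlp.le, Real.norm_of_nonneg (by positivity)] at hn2
  have hmain : Real.log (mcB a (kn n) n) + Real.log ((n:ℝ) * (n + 1)) ≤ ε * n * Real.log 2 := by
    unfold mcB
    rw [Real.log_mul (by positivity) (by positivity), Real.log_mul (by positivity) (by positivity),
      Real.log_pow, Real.log_pow]
    push_cast
    have e1 : (a:ℝ) ^ (kn n + 1) * Real.log (n + 1) ≤ (n:ℝ) ^ (1/2 : ℝ) * a * Real.log (n + 1) := by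
      rw [pow_succ]
      gcongr
    have e2 : Real.log (n + 1) ≤ (n:ℝ) ^ (1/2 : ℝ) * Real.log (n + 1) := le_mul_of_one_le_left hlp.le hs1
    have e3 : (n:ℝ) ^ (1/2 : ℝ) * Real.log (n + 1) ≤ ε' * (2 * n) := by
      calc (n:ℝ) ^ (1/2 : ℝ) * Real.log (n + 1) ≤ ((n:ℝ)+1) ^ (1/2 : ℝ) * (ε' * ((n:ℝ)+1) ^ (1/2 : ℝ)) := by
            gcongr; linarith
        _ = ε' * (((n:ℝ)+1) ^ (1/2 : ℝ) * ((n:ℝ)+1) ^ (1/2 : ℝ)) := by ring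
        _ = ε' * ((n:ℝ)+1) := by rw [← Real.rpow_add (by linarith)]; norm_num
        _ ≤ _ := by gcongr; linarith
    calc _ ≤ (a + 3) * ((n:ℝ) ^ (1/2 : ℝ) * Real.log (n + 1)) := by nlinarith
      _ ≤ (a + 3) * (ε' * (2 * n)) := by gcongr
      _ = _ := by rw [hε']; field_simp
  unfold Real.logb
  rw [← add_div, div_le_iff₀ hl2]
  exact hmain

noncomputable def mcM (d : X → A → ℝ) (α : ℝ) (k n : ℕ) (x : ℕ → X) : ℝ :=
  ⨅ y : Fin n → A, (condEmpEntropy n k y + α * avgDist d n (fun i : Fin n => x i.val) y)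

lemma mc_univ_code (kn : ℕ → ℕ) (hkn3 : ∀ n, 1 ≤ n → kn n < n) :
    ∃ c : MCode A, ∀ n, 1 ≤ n → ∀ v : Fin n → A, c.L n (mcExt v) ≤ n * condEmpEntropy n (kn n) v +
      (Real.logb 2 (mcB (Fintype.card A) (kn n) n) + Real.logb 2 ((n:ℝ) * (n + 1))) := by
  have hA : (0:ℝ) < Fintype.card A := by exact_mod_cast Fintype.card_pos
  have hB : ∀ n, 0 < mcB (Fintype.card A) (kn n) n := fun n => by unfold mcB; positivity
  set w : ℕ → ℝ := fun n => 1 / ((n:ℝ) * (n + 1)) with hw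
  have hw0 : ∀ n, 0 ≤ w n := fun n => by simp only [hw]; positivity
  have hw1 : ∀ n, 1 ≤ n → 0 < w n := fun n hn => by
    have : (0:ℝ) < n := by exact_mod_cast hn
    simp only [hw]; positivity
  set p : (n : ℕ) → (Fin n → A) → ℝ := fun n v =>
    w n * ((2:ℝ) ^ (-(n * condEmpEntropy n (kn n) v)) / mcB (Fintype.card A) (kn n) n) with hp
  have hpp : ∀ n, 1 ≤ n → ∀ v, 0 < p n v := fun n hn v =>
    mul_pos (hw1 n hn) (div_pos (by positivity) (hB n))
  obtain ⟨c, -, hc⟩ := mc_exists_code p (fun n v => mul_nonneg (hw0 n) (div_nonneg (by positivity) (hB n).le))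
    (hpp 1 le_rfl) w (fun n => by
      have : ∀ n, ∑ j ∈ Finset.range n, w (j + 1) = 1 - 1 / ((n:ℝ) + 1) := by
        intro n
        induction n with
        | zero => simp
        | succ n ih =>
          rw [Finset.sum_range_succ, ih]; simp only [hw]; push_cast
          have : (n:ℝ) + 1 ≠ 0 := by positivity
          have : (n:ℝ) + 1 + 1 ≠ 0 := by positivity
          field_simp; ring
      rw [this]
      have : 0 < 1 / ((n:ℝ) + 1) := by positivity
      linarith)
    (fun n hn => by
      simp only [hp]
      rw [← Finset.mul_sum, ← Finset.sum_div]
      refine mul_le_of_le_one_right (hw0 n) ((div_le_one (hB n)).2 ?_)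
      exact mc_kraft n (kn n) (hkn3 n hn))
    (∑ v, |Real.logb 2 (p 1 v)|)
    (fun v => (neg_le_abs _).trans (Finset.single_le_sum (f := fun v => |Real.logb 2 (p 1 v)|)
      (fun v _ => abs_nonneg _) (Finset.mem_univ v)))
  refine ⟨c, fun n hn v => ?_⟩
  have h1 := hc n hn (mcExt v) (hpp n hn _)
  rw [mcRes_ext] at h1
  refine h1.trans (le_of_eq ?_)
  have hnr : (0:ℝ) < n := by exact_mod_cast hn
  simp only [hp, hw]
  rw [Real.logb_mul (by positivity) (by have := hB n; positivity), Real.logb_div (by positivity) (hB n).ne',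
    Real.logb_rpow (by norm_num) (by norm_num), one_div, Real.logb_inv]
  ring

lemma mc_lower (μ : Measure (ℕ → X)) [IsProbabilityMeasure μ]
    (herg : Ergodic (fun x : ℕ → X => fun i => x (i + 1)) μ)
    (d : X → A → ℝ) (hd : ∀ a b, 0 ≤ d a b) (α : ℝ) (hα : 0 < α)
    (kn : ℕ → ℕ)
    (hkn2 : Tendsto (fun n => (kn n : ℝ) / Real.log n) atTop (nhds 0))
    (hkn3 : ∀ n, 1 ≤ n → kn n < n) (V : ℝ)
    (hV : ∀ n, 1 ≤ n → ∀ ν : (Fin n → X) × (Fin n → A) → ℝ, mcFeas μ n ν → V ≤ mcVal d α n ν)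
    (q : ℝ) (hq : q < V) :
    ∀ᵐ x ∂μ, ∀ᶠ n : ℕ in atTop, q ≤ mcM d α (kn n) n x := by
  have := mc_nonempty μ
  obtain ⟨c, hc⟩ := mc_univ_code (A := A) kn hkn3
  obtain ⟨dm, hdm⟩ : ∃ dm, ∀ a b, d a b ≤ dm := by
    refine ⟨∑ p : X × A, d p.1 p.2, fun a b => ?_⟩
    exact Finset.single_le_sum (f := fun p : X × A => d p.1 p.2) (fun p _ => hd _ _) (Finset.mem_univ (a, b))
  set r := (q + V) / 2 with hr
  have hk := mc_kingman herg (fun n x => mcF c d α n x) (fun n => mcF_measurable c d α n)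
    (c.C + α * dm) (fun n x => mcF_bound c d α hα hd dm hdm n x)
    (fun n m x => by rw [mcSh_iter]; exact mcF_sub c d α n m x) V
    (fun n => by
      rcases Nat.eq_zero_or_pos n with h | h
      · subst h
        have : ∀ x : ℕ → X, mcF c d α 0 x = 0 := fun x => by
          obtain ⟨v, hv⟩ := mcF_exists c d α 0 x
          rw [← hv]; simp [mcCost, c.zero]
        simp [this]
      · exact mc_converse μ d α c n h V (hV n h)) r (by rw [hr]; linarith)
  filter_upwards [hk] with x hx
  filter_upwards [hx, mcB_small (Fintype.card A) Fintype.card_pos kn hkn2 (r - q) (by rw [hr]; linarith),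
    eventually_ge_atTop 1] with n h1 h2 h3
  have hnr : (0:ℝ) < n := by exact_mod_cast h3
  unfold mcM
  refine le_ciInf fun y => ?_
  have h4 := hc n h3 y
  have h5 := mcF_le c d α n x (mcExt y)
  have h6 : mcCost c d α n x (mcExt y) = c.L n (mcExt y) + n * (α * avgDist d n (fun i : Fin n => x i.val) y) := by
    unfold mcCost avgDist
    rw [Finset.sum_range]
    have : ∀ i : Fin n, mcExt y i = y i := fun i => mcExt_lt y i i.2
    simp only [this]
    field_simp
  rw [h6] at h5
  have h7 : q * n ≤ n * (condEmpEntropy n (kn n) y + α * avgDist d n (fun i : Fin n => x i.val) y) := by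
    nlinarith
  rw [mul_comm] at h7
  exact le_of_mul_le_mul_left h7 hnr

end lower

open Filter MeasureTheory

set_option linter.unusedSectionVars false
set_option linter.unusedVariables false

section upperdet

variable {X : Type*} [Fintype X] [DecidableEq X] [MeasurableSpace X] [DiscreteMeasurableSpace X]
variable {A : Type*} [Fintype A] [DecidableEq A] [Nonempty A]

lemma mc_align (c : MCode A) (n m : ℕ) (hn : 0 < n) (z : ℕ → A) (hz : ∀ t, z (t + n) = z t)
    (S : ℕ → Prop) (e : ℕ → ℝ) (he : ∀ r, 0 ≤ e r) (hS0 : S 0)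
    (nxt : ∀ r < n, S r → ∃ s, 1 ≤ s ∧ s ≤ m ∧ r + s ≤ n ∧ S (r + s) ∧ c.L s (mcSh r z) ≤ e r)
    (hal : ∀ r < n, ∃ s ≤ m, r + s ≤ n ∧ S (r + s)) (K i : ℕ) :
    c.L K (mcSh i z) ≤ ∑ t ∈ Finset.range K, e ((i + t) % n) + 2 * m * c.C := by
  have hzm : ∀ i, mcSh (i % n) z = mcSh i z := by
    intro i
    have : ∀ r q, mcSh (r + n * q) z = mcSh r z := by
      intro r q
      induction q with
      | zero => simp
      | succ q ih =>
        rw [← ih]; funext s; simp only [mcSh]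
        rw [show r + n * (q + 1) + s = r + n * q + s + n by ring, hz]
    conv_rhs => rw [← Nat.mod_add_div i n]
    rw [this]
  have hC := c.C_nonneg
  have hS : ∀ i s, i % n + s ≤ n → S (i % n + s) → S ((i + s) % n) := by
    intro i s h1 h2
    rw [Nat.add_mod]
    rcases h1.lt_or_eq with h | h
    · have hs : s % n + i % n = i % n + s ∨ s = n := by
        rcases Nat.lt_or_ge s n with h' | h'
        · left; rw [Nat.mod_eq_of_lt h']; omega
        · omega
      rcases hs with hs | hs
      · rw [add_comm, hs, Nat.mod_eq_of_lt h]; exact h2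
      · omega
    · rw [← Nat.add_mod]
      have : (i + s) % n = 0 := by
        rw [← Nat.mod_add_mod, h, Nat.mod_self]
      rw [this]; exact hS0
  have small : ∀ K i, K ≤ m → c.L K (mcSh i z) ≤ m * c.C := by
    intro K i h
    refine (c.le K _).trans ?_
    have : (K:ℝ) ≤ m := by exact_mod_cast h
    nlinarith
  have hsplit : ∀ K s i, s ≤ K → c.L K (mcSh i z) ≤ c.L s (mcSh i z) + c.L (K - s) (mcSh (i + s) z) := by
    intro K s i h
    have := c.sub s (K - s) (mcSh i z)
    rwa [mcSh_sh, Nat.add_sub_cancel' h] at this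
  have hpos : ∀ K i, 0 ≤ ∑ t ∈ Finset.range K, e ((i + t) % n) := fun K i =>
    Finset.sum_nonneg fun _ _ => he _
  have al : ∀ K i, S (i % n) → c.L K (mcSh i z) ≤ ∑ t ∈ Finset.range K, e ((i + t) % n) + m * c.C := by
    intro K
    induction K using Nat.strong_induction_on with
    | _ K ih =>
      intro i hi
      obtain ⟨s, hs1, hsm, hsn, hSs, hL⟩ := nxt (i % n) (Nat.mod_lt _ hn) hi
      rw [hzm] at hL
      rcases Nat.lt_or_ge K s with h | h
      · have := small K i (by omega)
        have := hpos K i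
        linarith
      · have h1 := hsplit K s i h
        have h2 := ih (K - s) (by omega) (i + s) (hS i s hsn hSs)
        have h3 : ∑ t ∈ Finset.range K, e ((i + t) % n) = ∑ t ∈ Finset.range s, e ((i + t) % n) +
            ∑ t ∈ Finset.range (K - s), e ((i + s + t) % n) := by
          conv_lhs => rw [← Nat.add_sub_cancel' h]
          rw [Finset.sum_range_add]
          simp only [add_assoc]
        have h4 : e (i % n) ≤ ∑ t ∈ Finset.range s, e ((i + t) % n) := by
          have := Finset.single_le_sum (f := fun t => e ((i + t) % n)) (s := Finset.range s)
            (fun _ _ => he _) (Finset.mem_range.2 (by omega : 0 < s))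
          simpa using this
        rw [h3]; linarith
  obtain ⟨s, hsm, hsn, hSs⟩ := hal (i % n) (Nat.mod_lt _ hn)
  have hmC : 0 ≤ m * c.C := by positivity
  rcases Nat.lt_or_ge K s with h | h
  · have := small K i (by omega)
    have := hpos K i
    linarith
  · have h1 := hsplit K s i h
    have h2 := al (K - s) (i + s) (hS i s hsn hSs)
    have h3 : ∑ t ∈ Finset.range K, e ((i + t) % n) = ∑ t ∈ Finset.range s, e ((i + t) % n) +
        ∑ t ∈ Finset.range (K - s), e ((i + s + t) % n) := by
      conv_lhs => rw [← Nat.add_sub_cancel' h]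
      rw [Finset.sum_range_add]
      simp only [add_assoc]
    have h4 := hpos s i
    have h5 := small s i hsm
    rw [h3]; linarith

lemma mc_block_sum (B m : ℕ) (f : ℕ → ℝ) :
    ∑ i ∈ Finset.range (B * m), f i = ∑ q ∈ Finset.range B, ∑ i ∈ Finset.range m, f (q * m + i) := by
  induction B with
  | zero => simp
  | succ B ih => rw [Nat.succ_mul, Finset.sum_range_add, ih, Finset.sum_range_succ]

lemma mc_phase (c : MCode A) (d : X → A → ℝ) (hd : ∀ a b, 0 ≤ d a b) (α : ℝ) (hα : 0 < α)
    (dm : ℝ) (hdm : ∀ a b, d a b ≤ dm) (n m k j : ℕ) (hm : 0 < m) (hj : j < m) (hmn : m ≤ n)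
    (hk : k < n) (x : ℕ → X) :
    (n:ℝ) * mcM d α k n x ≤ ∑ q ∈ Finset.range ((n - j) / m), mcF c d α m (mcSh (j + q * m) x) +
      2 * m * (c.C + α * dm) + 2 * m * c.C * n / (k + 1) := by
  obtain ⟨a0⟩ := (inferInstance : Nonempty A)
  have hn : 0 < n := by omega
  have hdm0 : 0 ≤ dm := (hd (x 0) a0).trans (hdm (x 0) a0)
  have hC := c.C_nonneg
  set B := (n - j) / m with hB
  set τ := j + B * m with hτ
  have hτn : τ ≤ n := by
    have := Nat.div_mul_le_self (n - j) m
    rw [← hB] at this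
    omega
  have hτm : n < τ + m := by
    have := Nat.lt_div_mul_add (a := n - j) hm
    rw [← hB] at this
    omega
  choose g hg using fun t : ℕ => mcF_exists c d α m (mcSh t x)
  set y : Fin n → A := fun s => if s.val < j ∨ τ ≤ s.val then a0 else
    mcExt (g (j + (s.val - j) / m * m)) ((s.val - j) % m) with hy
  set z := mcPer y with hz
  have hzy : ∀ s < n, z s = if s < j ∨ τ ≤ s then a0 else
      mcExt (g (j + (s - j) / m * m)) ((s - j) % m) := by
    intro s hs
    simp only [hz, mcPer]
    rw [Nat.mod_eq_of_lt hs, mcExt_lt _ _ hs]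
  have hzb : ∀ q < B, ∀ i < m, z (j + q * m + i) = mcExt (g (j + q * m)) i := by
    intro q hq i hi
    have h1 : q * m + m ≤ B * m := by
      have := Nat.mul_le_mul_right m (Nat.succ_le_of_lt hq)
      rwa [Nat.succ_mul] at this
    have h2 : j + q * m + i - j = i + q * m := by omega
    rw [hzy _ (by omega), if_neg (by omega), h2, Nat.add_mul_mod_self_right, Nat.mod_eq_of_lt hi,
      Nat.add_mul_div_right _ _ hm, Nat.div_eq_of_lt hi, zero_add]
  set e : ℕ → ℝ := fun r => if r < j ∨ τ ≤ r then c.C else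
    if (r - j) % m = 0 then c.L m (mcSh r z) else 0 with he
  have he0 : ∀ r, 0 ≤ e r := by
    intro r; simp only [he]; split_ifs
    exacts [hC, c.nonneg _ _, le_rfl]
  set S : ℕ → Prop := fun r => (r - j) % m = 0 ∨ τ ≤ r with hS
  have hwin := mc_align c n m hn z (mcPer_per y) S e he0 (by left; simp)
    (by
      intro r hr hSr
      by_cases h1 : r < j ∨ τ ≤ r
      · refine ⟨1, le_rfl, hm, by omega, ?_, ?_⟩
        · rcases h1 with h1 | h1
          · left; rw [show r + 1 - j = 0 by omega]; simp
          · right; omega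
        · simp only [he, if_pos h1]; exact c.one _
      · have h2 : (r - j) % m = 0 := by
          rcases hSr with h | h
          · exact h
          · exact absurd (Or.inr h) h1
        push Not at h1
        have h3 := Nat.div_add_mod (r - j) m
        rw [h2, add_zero] at h3
        have h4 : (r - j) / m < B := by
          by_contra h
          push Not at h
          have := Nat.mul_le_mul_left m h
          rw [mul_comm m B] at this
          omega
        have h5 := Nat.mul_le_mul_left m (Nat.succ_le_of_lt h4)
        rw [Nat.mul_succ, mul_comm m B] at h5
        refine ⟨m, hm, le_rfl, by omega, ?_, ?_⟩
        · left; rw [show r + m - j = r - j + m by omega, Nat.add_mod_right]; exact h2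
        · simp only [he]; rw [if_neg (by omega), if_pos h2])
    (by
      intro r hr
      by_cases h1 : r < j ∨ τ ≤ r
      · refine ⟨0, by omega, by omega, ?_⟩
        rcases h1 with h1 | h1
        · left; rw [show r + 0 - j = 0 by omega]; simp
        · right; omega
      · push Not at h1
        have h3 := Nat.div_add_mod (r - j) m
        have h6 := Nat.mod_lt (r - j) hm
        have h4 : (r - j) / m < B := by
          by_contra h
          push Not at h
          have := Nat.mul_le_mul_left m h
          rw [mul_comm m B] at this
          omega
        have h5 := Nat.mul_le_mul_left m (Nat.succ_le_of_lt h4)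
        rw [Nat.mul_succ, mul_comm m B] at h5
        refine ⟨m - (r - j) % m, by omega, by omega, ?_⟩
        left
        rw [show r + (m - (r - j) % m) - j = m * ((r - j) / m) + m by omega]
        simp)
    (k + 1)
  have hH := mc_window c n k hk z (mcPer_per y)
  rw [hz, mcPer_res, ← hz] at hH
  have hsum : ∑ i ∈ Finset.range n, c.L (k+1) (mcSh i z) ≤
      (k + 1) * ∑ r ∈ Finset.range n, e r + n * (2 * m * c.C) := by
    refine (Finset.sum_le_sum fun i _ => hwin i).trans (le_of_eq ?_)
    rw [Finset.sum_add_distrib, Finset.sum_const, Finset.card_range, nsmul_eq_mul, Finset.sum_comm]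
    congr 1
    have : ∀ t ∈ Finset.range (k + 1), ∑ i ∈ Finset.range n, e ((i + t) % n) = ∑ r ∈ Finset.range n, e r := by
      intro t _
      rw [mc_shift_sum n (fun i => e (i % n)) (fun t => by simp) t]
      exact Finset.sum_congr rfl fun i hi => by rw [Nat.mod_eq_of_lt (Finset.mem_range.1 hi)]
    rw [Finset.sum_congr rfl this, Finset.sum_const, Finset.card_range, nsmul_eq_mul]
    push_cast; ring
  have hH2 : (n:ℝ) * condEmpEntropy n k y ≤ ∑ r ∈ Finset.range n, e r + 2 * m * c.C * n / (k + 1) := by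
    have hk1 : (0:ℝ) < k + 1 := by positivity
    have h1 := hH.trans hsum
    push_cast at h1
    have h2 : (k + 1 : ℝ) * (∑ r ∈ Finset.range n, e r + 2 * m * c.C * n / (k + 1)) =
      (k + 1) * ∑ r ∈ Finset.range n, e r + n * (2 * m * c.C) := by field_simp
    rw [← h2] at h1
    exact le_of_mul_le_mul_left h1 hk1
  have hM : (n:ℝ) * mcM d α k n x ≤ n * (condEmpEntropy n k y) + ∑ r ∈ Finset.range n, α * d (x r) (z r) := by
    have h1 : mcM d α k n x ≤ condEmpEntropy n k y + α * avgDist d n (fun i : Fin n => x i.val) y := by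
      exact ciInf_le (f := fun y : Fin n → A => condEmpEntropy n k y + α * avgDist d n (fun i : Fin n => x i.val) y)
        (Set.finite_range _).bddBelow y
    refine (mul_le_mul_of_nonneg_left h1 (Nat.cast_nonneg n)).trans (le_of_eq ?_)
    unfold avgDist
    rw [Finset.sum_range, ← Finset.mul_sum]
    have : ∀ i : Fin n, z i = y i := fun i => congrFun (mcPer_res y) i
    simp only [this]
    have : (n:ℝ) ≠ 0 := by positivity
    field_simp
  have hf : ∑ r ∈ Finset.range n, (e r + α * d (x r) (z r)) ≤
      ∑ q ∈ Finset.range B, mcF c d α m (mcSh (j + q * m) x) + 2 * m * (c.C + α * dm) := by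
    set f : ℕ → ℝ := fun r => e r + α * d (x r) (z r) with hf
    have hCd : 0 ≤ c.C + α * dm := by positivity
    have hfill : ∀ r, (r < j ∨ τ ≤ r) → f r ≤ c.C + α * dm := by
      intro r hr
      simp only [hf, he, if_pos hr]
      have := mul_le_mul_of_nonneg_left (hdm (x r) (z r)) hα.le
      linarith
    have h1 : n = j + B * m + (n - τ) := by omega
    conv_lhs => rw [h1]
    rw [Finset.sum_range_add, Finset.sum_range_add, mc_block_sum]
    have p1 : ∑ r ∈ Finset.range j, f r ≤ m * (c.C + α * dm) := by
      refine (Finset.sum_le_sum fun r hr => hfill r (Or.inl (Finset.mem_range.1 hr))).trans ?_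
      rw [Finset.sum_const, Finset.card_range, nsmul_eq_mul]
      have : (j:ℝ) ≤ m := by exact_mod_cast hj.le
      gcongr
    have p3 : ∑ r ∈ Finset.range (n - τ), f (j + B * m + r) ≤ m * (c.C + α * dm) := by
      refine (Finset.sum_le_sum fun r hr => hfill _ (Or.inr (by omega))).trans ?_
      rw [Finset.sum_const, Finset.card_range, nsmul_eq_mul]
      have : ((n - τ : ℕ):ℝ) ≤ m := by
        have : n - τ ≤ m := by omega
        exact_mod_cast this
      gcongr
    have p2 : ∑ q ∈ Finset.range B, ∑ i ∈ Finset.range m, f (j + (q * m + i)) =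
        ∑ q ∈ Finset.range B, mcF c d α m (mcSh (j + q * m) x) := by
      refine Finset.sum_congr rfl fun q hq => ?_
      have hq := Finset.mem_range.1 hq
      have hqB : q * m + m ≤ B * m := by
        have := Nat.mul_le_mul_right m (Nat.succ_le_of_lt hq)
        rwa [Nat.succ_mul] at this
      rw [← hg]
      simp only [hf]
      rw [Finset.sum_add_distrib, ← Finset.mul_sum]
      unfold mcCost
      congr 1
      · rw [Finset.sum_eq_single_of_mem 0 (Finset.mem_range.2 hm)]
        · simp only [he]
          rw [if_neg (by omega), if_pos (by rw [add_zero, Nat.add_sub_cancel_left]; simp)]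
          refine c.loc m _ _ (fun t ht => ?_)
          simp only [mcSh]
          exact hzb q hq t ht
        · intro i hi hi0
          have hi := Finset.mem_range.1 hi
          simp only [he]
          rw [if_neg (by omega), if_neg]
          rw [Nat.add_sub_cancel_left, add_comm, Nat.add_mul_mod_self_right, Nat.mod_eq_of_lt hi]
          exact hi0
      · congr 1
        refine Finset.sum_congr rfl fun i hi => ?_
        have hi := Finset.mem_range.1 hi
        rw [← add_assoc, hzb q hq i hi]; rfl
    rw [p2]
    linarith
  rw [Finset.sum_add_distrib] at hf
  linarith

lemma mc_upper_det (c : MCode A) (d : X → A → ℝ) (hd : ∀ a b, 0 ≤ d a b) (α : ℝ) (hα : 0 < α)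
    (dm : ℝ) (hdm : ∀ a b, d a b ≤ dm) (n m k : ℕ) (hm : 0 < m) (hmn : m ≤ n)
    (hk : k < n) (x : ℕ → X) :
    (n:ℝ) * mcM d α k n x ≤ (∑ i ∈ Finset.range n, mcF c d α m (mcSh i x)) / m +
      2 * m * (c.C + α * dm) + 2 * m * c.C * n / (k + 1) := by
  have h := Finset.sum_le_sum fun j (hj : j ∈ Finset.range m) =>
    mc_phase c d hd α hα dm hdm n m k j hm (Finset.mem_range.1 hj) hmn hk x
  rw [Finset.sum_const, Finset.card_range, nsmul_eq_mul] at h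
  simp only [add_assoc] at h
  rw [Finset.sum_add_distrib, Finset.sum_const, Finset.card_range, nsmul_eq_mul] at h
  have hF0 : ∀ x, 0 ≤ mcF c d α m x := by
    intro x
    obtain ⟨v, hv⟩ := mcF_exists c d α m x
    rw [← hv]
    exact add_nonneg (c.nonneg _ _) (mul_nonneg hα.le (Finset.sum_nonneg fun _ _ => hd _ _))
  have h2 : ∑ j ∈ Finset.range m, ∑ q ∈ Finset.range ((n - j) / m), mcF c d α m (mcSh (j + q * m) x) ≤
      ∑ i ∈ Finset.range n, mcF c d α m (mcSh i x) := by
    set G : ℕ → ℝ := fun i => if i < n then mcF c d α m (mcSh i x) else 0 with hG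
    have hG0 : ∀ i, 0 ≤ G i := fun i => by simp only [hG]; split_ifs; exacts [hF0 _, le_rfl]
    calc _ ≤ ∑ j ∈ Finset.range m, ∑ q ∈ Finset.range n, G (q * m + j) := by
          refine Finset.sum_le_sum fun j hj => ?_
          have hj := Finset.mem_range.1 hj
          refine le_trans (le_of_eq ?_) (Finset.sum_le_sum_of_subset_of_nonneg
            (Finset.range_subset_range.2 ((Nat.div_le_self (n - j) m).trans (Nat.sub_le _ _)))
            (fun _ _ _ => hG0 _))
          refine Finset.sum_congr rfl fun q hq => ?_
          have hq := Finset.mem_range.1 hq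
          have h3 := Nat.mul_le_mul_right m (Nat.succ_le_of_lt hq)
          have h4 := Nat.div_mul_le_self (n - j) m
          rw [Nat.succ_mul] at h3
          simp only [hG]
          rw [if_pos (by omega), add_comm]
      _ = ∑ i ∈ Finset.range (n * m), G i := by rw [mc_block_sum, Finset.sum_comm]
      _ = ∑ i ∈ Finset.range n, G i := by
          refine (Finset.sum_subset (Finset.range_subset_range.2 (Nat.le_mul_of_pos_right n hm)) ?_).symm
          intro i _ hi
          have hi : ¬ i < n := fun h => hi (Finset.mem_range.2 h)
          simp only [hG, if_neg hi]
      _ = _ := Finset.sum_congr rfl fun i hi => by simp only [hG, if_pos (Finset.mem_range.1 hi)]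
  have hmr : (0:ℝ) < m := by exact_mod_cast hm
  have h3 := h.trans (add_le_add_left h2 _)
  have h4 : (m:ℝ) * ((∑ i ∈ Finset.range n, mcF c d α m (mcSh i x)) / m +
      2 * m * (c.C + α * dm) + 2 * m * c.C * n / (k + 1)) = ∑ i ∈ Finset.range n, mcF c d α m (mcSh i x) +
      m * (2 * m * (c.C + α * dm) + 2 * m * c.C * n / (k + 1)) := by
    rw [add_assoc, mul_add, mul_div_cancel₀ _ hmr.ne']
  rw [← h4] at h3
  exact le_of_mul_le_mul_left h3 hmr

/-- asymptotic consequence -/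
lemma mc_upper_ae (μ : Measure (ℕ → X)) [IsProbabilityMeasure μ]
    (herg : Ergodic (fun x : ℕ → X => fun i => x (i + 1)) μ)
    (c : MCode A) (d : X → A → ℝ) (hd : ∀ a b, 0 ≤ d a b) (α : ℝ) (hα : 0 < α)
    (kn : ℕ → ℕ) (hkn1 : Tendsto kn atTop atTop)
    (hkn3 : ∀ n, 1 ≤ n → kn n < n) (m : ℕ) (hm : 0 < m) (u q : ℝ)
    (hu : ∫ x, mcF c d α m x ∂μ ≤ u * m) (hq : u < q) :
    ∀ᵐ x ∂μ, ∀ᶠ n : ℕ in atTop, mcM d α (kn n) n x ≤ q := by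
  have := mc_nonempty μ
  obtain ⟨dm, hdm⟩ : ∃ dm, ∀ a b, d a b ≤ dm := by
    refine ⟨∑ p : X × A, d p.1 p.2, fun a b => ?_⟩
    exact Finset.single_le_sum (f := fun p : X × A => d p.1 p.2) (fun p _ => hd _ _) (Finset.mem_univ (a, b))
  set D := c.C + α * dm with hD
  have hFb : ∀ x, |mcF c d α m x| ≤ D * m := mcF_bound c d α hα hd dm hdm m
  have hFm := mcF_measurable c d α m (X := X)
  have hFi : Integrable (fun x => mcF c d α m x) μ :=
    Integrable.of_bound hFm.aestronglyMeasurable (D * m) (ae_of_all _ fun x => hFb x)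
  have hmr : (0:ℝ) < m := by exact_mod_cast hm
  have hTm : ∀ i, MeasurePreserving ((fun x : ℕ → X => fun i => x (i + 1))^[i]) μ μ := fun i =>
    herg.toMeasurePreserving.iterate i
  have hk := mc_kingman herg (fun n x => ∑ i ∈ Finset.range n,
      (-mcF c d α m ((fun x : ℕ → X => fun i => x (i + 1))^[i] x)))
    (fun n => Finset.measurable_sum _ fun i _ => (hFm.comp (hTm i).measurable).neg)
    (D * m) (fun n x => by
      refine (Finset.abs_sum_le_sum_abs _ _).trans ?_
      refine (Finset.sum_le_sum fun i _ => (by rw [abs_neg]; exact hFb _ :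
        |(-mcF c d α m ((fun x : ℕ → X => fun i => x (i + 1))^[i] x))| ≤ D * m)).trans ?_
      rw [Finset.sum_const, Finset.card_range, nsmul_eq_mul, mul_comm])
    (fun n k x => by
      rw [Finset.sum_range_add]
      refine le_of_eq ?_
      congr 1
      refine Finset.sum_congr rfl fun i _ => ?_
      rw [add_comm, Function.iterate_add_apply])
    (-(u * m))
    (fun n => by
      have hi : ∀ i, ∫ x, mcF c d α m ((fun x : ℕ → X => fun i => x (i + 1))^[i] x) ∂μ =
          ∫ x, mcF c d α m x ∂μ := by
        intro i
        have h1 := integral_map (μ := μ) (hTm i).measurable.aemeasurable (f := fun x => mcF c d α m x)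
          (by rw [(hTm i).map_eq]; exact hFm.aestronglyMeasurable)
        rw [(hTm i).map_eq] at h1
        exact h1.symm
      have hIntg : ∀ i ∈ Finset.range n, Integrable (fun x : ℕ → X =>
          -mcF c d α m ((fun x : ℕ → X => fun i => x (i + 1))^[i] x)) μ :=
        fun i _ => ((hTm i).integrable_comp_of_integrable hFi).neg
      rw [integral_finsetSum _ hIntg]
      simp only [integral_neg, hi]
      rw [Finset.sum_const, Finset.card_range, nsmul_eq_mul]
      have : (0:ℝ) ≤ n := by positivity
      nlinarith)
    (-((u + (q - u) / 3) * m)) (by nlinarith)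
  have hδ : 0 < (q - u) / 3 := by linarith
  have hk2 : ∀ᶠ n : ℕ in atTop, 2 * m * c.C / ((kn n : ℝ) + 1) < (q - u) / 3 := by
    have h1 : Tendsto (fun n => (kn n : ℝ) + 1) atTop atTop :=
      tendsto_atTop_add_const_right _ _ (tendsto_natCast_atTop_atTop.comp hkn1)
    exact (h1.const_div_atTop (2 * m * c.C)).eventually (gt_mem_nhds hδ)
  have hk3 : ∀ᶠ n : ℕ in atTop, 2 * m * D / (n : ℝ) < (q - u) / 3 :=
    (tendsto_natCast_atTop_atTop.const_div_atTop (2 * m * D)).eventually (gt_mem_nhds hδ)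
  filter_upwards [hk] with x hx
  filter_upwards [hx, hk2, hk3, eventually_ge_atTop m] with n h1 h2 h3 h4
  have hn : 0 < n := by omega
  have hnr : (0:ℝ) < n := by exact_mod_cast hn
  have h5 := mc_upper_det c d hd α hα dm hdm n m (kn n) hm h4 (hkn3 n hn) x
  simp only [mcSh_iter] at h1
  rw [Finset.sum_neg_distrib] at h1
  have h6 : (∑ i ∈ Finset.range n, mcF c d α m (mcSh i x)) / m ≤ (u + (q - u) / 3) * n := by
    rw [div_le_iff₀ hmr]; linarith
  rw [div_lt_iff₀ hnr] at h3
  have h7 : 2 * m * c.C * n / ((kn n : ℝ) + 1) ≤ (q - u) / 3 * n := by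
    rw [mul_div_right_comm]
    exact mul_le_mul_of_nonneg_right h2.le hnr.le
  have h8 : (n:ℝ) * mcM d α (kn n) n x ≤ n * q := by
    rw [← hD] at h5; linarith
  exact le_of_mul_le_mul_left h8 hnr

end upperdet

open Filter MeasureTheory

set_option linter.unusedSectionVars false
set_option linter.unusedVariables false

section greedy

open Classical in
lemma mc_greedy {I J : Type*} [Fintype I] [Fintype J] [Nonempty J] (q : J → ℝ) (hq0 : ∀ y, 0 ≤ q y)
    (hq1 : ∑ y, q y = 1) (G : ℕ → I → J → Prop) (M : ℕ) :
    ∀ P : I → ℝ, (∀ x, 0 ≤ P x) → ∃ y : ℕ → J,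
      ∑ x, P x * (if ∀ i < M, ¬ G i x (y i) then 1 else 0) ≤
        ∑ x, P x * ∏ i ∈ Finset.range M, (1 - ∑ b, if G i x b then q b else 0) := by
  induction M with
  | zero =>
    intro P hP
    exact ⟨fun _ => Classical.arbitrary J, by simp⟩
  | succ M ih =>
    intro P hP
    have hr : ∀ x, (1 - ∑ b, if G M x b then q b else 0) = ∑ b, q b * (if G M x b then 0 else 1) := by
      intro x
      have h1 : (1 - ∑ b, if G M x b then q b else 0) =
          ∑ b, q b - ∑ b, if G M x b then q b else 0 := by rw [hq1]
      rw [h1, ← Finset.sum_sub_distrib]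
      refine Finset.sum_congr rfl fun b _ => ?_
      split_ifs <;> simp
    have hr0 : ∀ x, 0 ≤ (1 - ∑ b, if G M x b then q b else 0) := by
      intro x
      rw [hr]
      exact Finset.sum_nonneg fun b _ => mul_nonneg (hq0 b) (by split_ifs <;> norm_num)
    obtain ⟨y, hy⟩ := ih (fun x => P x * (1 - ∑ b, if G M x b then q b else 0))
      (fun x => mul_nonneg (hP x) (hr0 x))
    set f : J → ℝ := fun b => ∑ x, P x * (if ∀ i < M, ¬ G i x (y i) then 1 else 0) *
      (if G M x b then 0 else 1) with hf
    obtain ⟨b0, hb0⟩ := Finite.exists_min f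
    have h1 : f b0 ≤ ∑ b, q b * f b := by
      calc f b0 = ∑ b, q b * f b0 := by rw [← Finset.sum_mul, hq1, one_mul]
        _ ≤ _ := Finset.sum_le_sum fun b _ => mul_le_mul_of_nonneg_left (hb0 b) (hq0 b)
    have h2 : ∑ b, q b * f b = ∑ x, P x * (1 - ∑ b, if G M x b then q b else 0) *
        (if ∀ i < M, ¬ G i x (y i) then 1 else 0) := by
      simp only [hf, Finset.mul_sum]
      rw [Finset.sum_comm]
      refine Finset.sum_congr rfl fun x _ => ?_
      rw [hr, Finset.mul_sum, Finset.sum_mul]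
      refine Finset.sum_congr rfl fun b _ => ?_
      ring
    refine ⟨fun i => if i < M then y i else b0, ?_⟩
    refine le_trans (le_of_eq ?_) (h1.trans (h2.le.trans (hy.trans (le_of_eq ?_))))
    · simp only [hf]
      refine Finset.sum_congr rfl fun x _ => ?_
      rw [mul_assoc]
      congr 1
      have : (∀ i < M + 1, ¬ G i x (if i < M then y i else b0)) ↔
          (∀ i < M, ¬ G i x (y i)) ∧ ¬ G M x b0 := by
        constructor
        · intro h
          refine ⟨fun i hi => ?_, ?_⟩
          · have := h i (by omega); rwa [if_pos hi] at this
          · have := h M (by omega); rwa [if_neg (lt_irrefl M)] at this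
        · rintro ⟨h, h'⟩ i hi
          rcases Nat.lt_succ_iff_lt_or_eq.1 hi with hi | hi
          · rw [if_pos hi]; exact h i hi
          · subst hi; rw [if_neg (lt_irrefl _)]; exact h'
      simp only [this]
      by_cases ha : (∀ i < M, ¬ G i x (y i)) <;> by_cases hb : G M x b0 <;> simp [ha, hb]
    · refine Finset.sum_congr rfl fun x _ => ?_
      rw [Finset.prod_range_succ]; ring

open Classical in
lemma mc_oneshot {I J : Type*} [Fintype I] [Fintype J] [Nonempty J] (P : I → ℝ) (hP0 : ∀ x, 0 ≤ P x)
    (hP1 : ∑ x, P x = 1) (q : J → ℝ) (hq0 : ∀ y, 0 ≤ q y) (hq1 : ∑ y, q y = 1)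
    (ρ : I → J → ℝ) (B : ℝ) (hρ0 : ∀ x y, 0 ≤ ρ x y) (hρB : ∀ x y, ρ x y ≤ B) (m : ℕ) :
    ∃ qh : J → ℝ, (∀ y, 0 ≤ qh y) ∧ ∑ y, qh y ≤ 1 ∧ ∃ S : I → Prop,
      ∑ x, P x * (if S x then 0 else 1) ≤ Real.exp (-m) ∧
      ∀ x, S x → ∃ y, 0 < qh y ∧ -Real.logb 2 (qh y) + ρ x y ≤
        -Real.logb 2 (∑ b, q b * (2:ℝ) ^ (-ρ x b)) + Real.logb 2 (m + 1) +
        Real.logb 2 (1 + Real.log (⌈((m:ℝ) + 1) * (2:ℝ) ^ B⌉₊)) := by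
  set W : I → ℝ := fun x => ∑ b, q b * (2:ℝ) ^ (-ρ x b) with hW
  have hm1 : (0:ℝ) < m + 1 := by positivity
  have hWB : ∀ x, (2:ℝ) ^ (-B) ≤ W x := by
    intro x
    calc (2:ℝ) ^ (-B) = ∑ b, q b * (2:ℝ) ^ (-B) := by rw [← Finset.sum_mul, hq1, one_mul]
      _ ≤ _ := Finset.sum_le_sum fun b _ => mul_le_mul_of_nonneg_left
        (Real.rpow_le_rpow_of_exponent_le (by norm_num) (neg_le_neg (hρB x b))) (hq0 b)
  have hW0 : ∀ x, 0 < W x := fun x => lt_of_lt_of_le (by positivity) (hWB x)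
  set s : I → ℝ := fun x => (m + 1) / W x with hs
  have hs0 : ∀ x, 0 < s x := fun x => div_pos hm1 (hW0 x)
  set M : ℕ := ⌈((m:ℝ) + 1) * (2:ℝ) ^ B⌉₊ with hM
  have hMs : ∀ x, s x ≤ M := by
    intro x
    refine le_trans ?_ (Nat.le_ceil _)
    simp only [hs]
    rw [div_le_iff₀ (hW0 x), mul_assoc]
    refine le_mul_of_one_le_right hm1.le ?_
    have h1 := hWB x
    rw [Real.rpow_neg (by norm_num)] at h1
    have h2 : (0:ℝ) < 2 ^ B := by positivity
    calc (1:ℝ) = 2 ^ B * (2 ^ B)⁻¹ := by field_simp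
      _ ≤ _ := mul_le_mul_of_nonneg_left h1 h2.le
  have hM0 : 0 < M := Nat.ceil_pos.2 (by positivity)
  obtain ⟨G, hG⟩ : ∃ G : ℕ → I → J → Prop, ∀ i x b, G i x b ↔ ((i:ℝ) + 1) ≤ s x * (2:ℝ) ^ (-ρ x b) :=
    ⟨_, fun i x b => Iff.rfl⟩
  obtain ⟨y, hy⟩ := mc_greedy q hq0 hq1 G M P hP0
  set Hm : ℝ := ∑ i ∈ Finset.range M, 1 / ((i:ℝ) + 1) with hHm
  have hHm0 : 0 < Hm := Finset.sum_pos (fun i _ => by positivity) ⟨0, Finset.mem_range.2 hM0⟩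
  have hHm1 : Hm ≤ 1 + Real.log M := by
    have := harmonic_le_one_add_log M
    refine le_trans (le_of_eq ?_) this
    unfold harmonic
    push_cast
    simp [hHm]
  set qh : J → ℝ := fun b => (∑ i ∈ Finset.range M, if y i = b then 1 / ((i:ℝ) + 1) else 0) / Hm with hqh
  refine ⟨qh, ?_, ?_, fun x => ¬ ∀ i < M, ¬ G i x (y i), ?_, ?_⟩
  · intro b
    exact div_nonneg (Finset.sum_nonneg fun i _ => by split_ifs <;> positivity) hHm0.le
  · simp only [hqh]
    rw [← Finset.sum_div, Finset.sum_comm]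
    simp only [Finset.sum_ite_eq, Finset.mem_univ, if_true]
    rw [← hHm, div_self hHm0.ne']
  · refine le_trans (le_of_eq ?_) (hy.trans ?_)
    · refine Finset.sum_congr rfl fun x _ => ?_
      by_cases h : ∀ i < M, ¬ G i x (y i)
      · rw [if_neg (not_not.2 h), if_pos h]
      · rw [if_pos h, if_neg h]
    have key : ∀ x, ∏ i ∈ Finset.range M, (1 - ∑ b, if G i x b then q b else 0) ≤ Real.exp (-m) := by
      intro x
      have h1 : ∏ i ∈ Finset.range M, (1 - ∑ b, if G i x b then q b else 0) ≤
          ∏ i ∈ Finset.range M, Real.exp (-(∑ b, if G i x b then q b else 0)) := by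
        refine Finset.prod_le_prod (fun i _ => ?_) (fun i _ => ?_)
        · rw [sub_nonneg]
          refine le_trans ?_ hq1.le
          exact Finset.sum_le_sum fun b _ => by split_ifs; exacts [le_rfl, hq0 b]
        · have := Real.add_one_le_exp (-(∑ b, if G i x b then q b else 0))
          linarith
      refine h1.trans ?_
      rw [← Real.exp_sum]
      refine Real.exp_le_exp.2 ?_
      rw [Finset.sum_neg_distrib]
      refine neg_le_neg ?_
      rw [Finset.sum_comm]
      calc (m:ℝ) = s x * W x - 1 := by
            simp only [hs]; rw [div_mul_cancel₀ _ (hW0 x).ne']; ring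
        _ = ∑ b, q b * (s x * (2:ℝ) ^ (-ρ x b) - 1) := by
            simp only [mul_sub, mul_one, Finset.sum_sub_distrib, hq1, hW, Finset.mul_sum]
            congr 1
            refine Finset.sum_congr rfl fun b _ => by ring
        _ ≤ _ := by
            refine Finset.sum_le_sum fun b _ => ?_
            set t := s x * (2:ℝ) ^ (-ρ x b) with ht
            have ht0 : 0 ≤ t := mul_nonneg (hs0 x).le (by positivity)
            have htM : t ≤ M := by
              refine le_trans ?_ (hMs x)
              exact mul_le_of_le_one_right (hs0 x).le (Real.rpow_le_one_of_one_le_of_nonpos (by norm_num)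
                (neg_nonpos.2 (hρ0 x b)))
            have hfl : ⌊t⌋₊ ≤ M := by
              exact_mod_cast (Nat.floor_le ht0).trans htM
            calc q b * (t - 1) ≤ q b * (⌊t⌋₊ : ℝ) :=
                  mul_le_mul_of_nonneg_left (by have := Nat.lt_floor_add_one t; linarith) (hq0 b)
              _ = ∑ i ∈ Finset.range ⌊t⌋₊, q b := by
                  rw [Finset.sum_const, Finset.card_range, nsmul_eq_mul, mul_comm]
              _ = ∑ i ∈ Finset.range ⌊t⌋₊, (if G i x b then q b else 0) := by
                  refine Finset.sum_congr rfl fun i hi => ?_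
                  have hi := Finset.mem_range.1 hi
                  rw [if_pos]
                  rw [hG]
                  have h3 := (Nat.le_floor_iff ht0).1 (Nat.succ_le_of_lt hi)
                  push_cast at h3
                  exact h3
              _ ≤ _ := Finset.sum_le_sum_of_subset_of_nonneg (Finset.range_subset_range.2 hfl)
                  (fun i _ _ => by split_ifs; exacts [hq0 b, le_rfl])
    calc _ ≤ ∑ x, P x * Real.exp (-m) :=
          Finset.sum_le_sum fun x _ => mul_le_mul_of_nonneg_left (key x) (hP0 x)
      _ = _ := by rw [← Finset.sum_mul, hP1, one_mul]
  · intro x hx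
    push Not at hx
    obtain ⟨i, hi, hGi⟩ := hx
    rw [hG] at hGi
    have hi1 : (0:ℝ) < (i:ℝ) + 1 := by positivity
    have hge : 1 / ((i:ℝ) + 1) / Hm ≤ qh (y i) := by
      simp only [hqh]
      refine div_le_div_of_nonneg_right ?_ hHm0.le
      have := Finset.single_le_sum (f := fun i' : ℕ => if y i' = y i then 1 / ((i':ℝ) + 1) else 0)
        (s := Finset.range M) (fun i' _ => by split_ifs <;> positivity) (Finset.mem_range.2 hi)
      simpa using this
    have hp : 0 < 1 / ((i:ℝ) + 1) / Hm := by positivity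
    refine ⟨y i, lt_of_lt_of_le hp hge, ?_⟩
    have h1 := Real.logb_le_logb_of_le (b := 2) (by norm_num) hp hge
    rw [Real.logb_div (by positivity) hHm0.ne', one_div, Real.logb_inv] at h1
    have h2 := Real.logb_le_logb_of_le (b := 2) (by norm_num) hi1 hGi
    rw [Real.logb_mul (hs0 x).ne' (by positivity), Real.logb_rpow (by norm_num) (by norm_num)] at h2
    simp only [hs] at h2
    rw [Real.logb_div hm1.ne' (hW0 x).ne'] at h2
    have h3 := Real.logb_le_logb_of_le (b := 2) (by norm_num) hHm0 hHm1
    linarith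

end greedy

open Filter MeasureTheory

set_option linter.unusedSectionVars false
set_option linter.unusedVariables false

section achiev

variable {X : Type*} [Fintype X] [DecidableEq X] [MeasurableSpace X] [DiscreteMeasurableSpace X]
variable {A : Type*} [Fintype A] [DecidableEq A] [Nonempty A]

lemma mc_soft {I J : Type*} [Fintype I] [Fintype J] (ν : I × J → ℝ) (h0 : ∀ p, 0 ≤ ν p)
    (P : I → ℝ) (hP : ∀ w, ∑ b, ν (w, b) = P w) (Q : J → ℝ) (hQ : ∀ b, ∑ w, ν (w, b) = Q b)
    (ρ : I → J → ℝ) (Z : I → ℝ) (hZ : ∀ w, Z w = ∑ b, Q b * (2:ℝ) ^ (-ρ w b)) (hZ0 : ∀ w, 0 < Z w) :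
    ∑ w, P w * (-Real.logb 2 (Z w)) ≤ mutualInfo ν + ∑ p : I × J, ν p * ρ p.1 p.2 := by
  have hln : 0 < Real.log 2 := Real.log_pos (by norm_num)
  have hP0 : ∀ w, 0 ≤ P w := fun w => by rw [← hP]; exact Finset.sum_nonneg fun b _ => h0 _
  have hQ0 : ∀ w, 0 ≤ Q w := fun w => by rw [← hQ]; exact Finset.sum_nonneg fun b _ => h0 _
  have hPν : ∀ w b, ν (w, b) ≤ P w := fun w b => by
    rw [← hP]; exact Finset.single_le_sum (f := fun b => ν (w, b)) (fun b _ => h0 _) (Finset.mem_univ b)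
  have hQν : ∀ w b, ν (w, b) ≤ Q b := fun w b => by
    rw [← hQ]; exact Finset.single_le_sum (f := fun w => ν (w, b)) (fun b _ => h0 _) (Finset.mem_univ w)
  have key : ∀ w b, ν (w, b) * (Real.logb 2 (P w) + Real.logb 2 (Q b) - ρ w b - Real.logb 2 (ν (w, b))
      - Real.logb 2 (Z w)) ≤ (P w * (Q b * (2:ℝ) ^ (-ρ w b)) / Z w - ν (w, b)) / Real.log 2 := by
    intro w b
    have h2 : (0:ℝ) < (2:ℝ) ^ (-ρ w b) := by positivity
    rcases (h0 (w, b)).eq_or_lt with h | h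
    · rw [← h]
      simp only [zero_mul, sub_zero]
      exact div_nonneg (div_nonneg (mul_nonneg (hP0 w) (mul_nonneg (hQ0 b) h2.le)) (hZ0 w).le) hln.le
    · have hPp := h.trans_le (hPν w b)
      have hQp := h.trans_le (hQν w b)
      have ht : 0 < P w * (Q b * (2:ℝ) ^ (-ρ w b)) / (ν (w, b) * Z w) :=
        div_pos (mul_pos hPp (mul_pos hQp h2)) (mul_pos h (hZ0 w))
      have h3 := Real.log_le_sub_one_of_pos ht
      have h4 : Real.logb 2 (P w * (Q b * (2:ℝ) ^ (-ρ w b)) / (ν (w, b) * Z w)) =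
          Real.logb 2 (P w) + Real.logb 2 (Q b) - ρ w b - Real.logb 2 (ν (w, b)) - Real.logb 2 (Z w) := by
        rw [Real.logb_div (mul_pos hPp (mul_pos hQp h2)).ne' (mul_pos h (hZ0 w)).ne',
          Real.logb_mul hPp.ne' (mul_pos hQp h2).ne', Real.logb_mul hQp.ne' h2.ne',
          Real.logb_mul h.ne' (hZ0 w).ne', Real.logb_rpow (by norm_num) (by norm_num)]
        ring
      rw [← h4, Real.logb, ← mul_div_assoc]
      refine div_le_div_of_nonneg_right ?_ hln.le
      calc _ ≤ ν (w, b) * (P w * (Q b * (2:ℝ) ^ (-ρ w b)) / (ν (w, b) * Z w) - 1) :=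
            mul_le_mul_of_nonneg_left h3 h.le
        _ = _ := by
            have := (hZ0 w).ne'
            have := h.ne'
            field_simp
  have hsum : ∑ w, ∑ b, ν (w, b) * (Real.logb 2 (P w) + Real.logb 2 (Q b) - ρ w b - Real.logb 2 (ν (w, b))
      - Real.logb 2 (Z w)) ≤ 0 := by
    refine Finset.sum_nonpos fun w _ => ?_
    refine (Finset.sum_le_sum fun b _ => key w b).trans (le_of_eq ?_)
    rw [← Finset.sum_div, Finset.sum_sub_distrib, ← Finset.sum_div, ← Finset.mul_sum, ← hZ, hP,
      mul_div_cancel_right₀ _ (hZ0 w).ne', sub_self, zero_div]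
  have e1 : ∑ w, ∑ b, ν (w, b) * Real.logb 2 (P w) = ∑ w, P w * Real.logb 2 (P w) :=
    Finset.sum_congr rfl fun w _ => by rw [← Finset.sum_mul, hP]
  have e2 : ∑ w, ∑ b, ν (w, b) * Real.logb 2 (Q b) = ∑ b, Q b * Real.logb 2 (Q b) := by
    rw [Finset.sum_comm]
    exact Finset.sum_congr rfl fun w _ => by rw [← Finset.sum_mul, hQ]
  have e3 : ∑ w, ∑ b, ν (w, b) * Real.logb 2 (Z w) = ∑ w, P w * Real.logb 2 (Z w) :=
    Finset.sum_congr rfl fun w _ => by rw [← Finset.sum_mul, hP]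
  simp only [mul_sub, mul_add, Finset.sum_sub_distrib, Finset.sum_add_distrib, e1, e2, e3] at hsum
  unfold mutualInfo shannonEntropy
  simp only [hP, hQ, Fintype.sum_prod_type, mul_neg, Finset.sum_neg_distrib]
  linarith

lemma mc_prod (N : ℕ) (Q : (Fin N → A) → ℝ) (hQ0 : ∀ b, 0 ≤ Q b) (hQ1 : ∑ b, Q b = 1)
    (ρ : X → A → ℝ) (Z : (Fin N → X) → ℝ)
    (hZ : ∀ w, Z w = ∑ b, Q b * (2:ℝ) ^ (-∑ i, ρ (w i) (b i))) (L : ℕ) :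
    ∃ q : (Fin (N * L) → A) → ℝ, (∀ v, 0 ≤ q v) ∧ ∑ v, q v = 1 ∧
      ∀ x : ℕ → X, ∑ v, q v * (2:ℝ) ^ (-∑ i : Fin (N * L), ρ (x i.val) (v i)) =
        ∏ l ∈ Finset.range L, Z (mcRes N (mcSh (N * l) x)) := by
  induction L with
  | zero => 
    refine ⟨fun _ => 1, fun _ => zero_le_one, ?_, fun x => ?_⟩
    · have : (Finset.univ : Finset (Fin (N * 0) → A)) = {fun i => Classical.arbitrary A} := by
        ext v; simp only [Finset.mem_univ, Finset.mem_singleton, true_iff]; funext i; exact absurd i.2 (by simp)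
      rw [this]; simp
    · have : (Finset.univ : Finset (Fin (N * 0) → A)) = {fun i => Classical.arbitrary A} := by
        ext v; simp only [Finset.mem_univ, Finset.mem_singleton, true_iff]; funext i; exact absurd i.2 (by simp)
      rw [this]; simp
  | succ L ih =>
    obtain ⟨q, q0, q1, hq⟩ := ih
    refine ⟨fun (v : Fin (N * L + N) → A) => q (mcRes (N * L) (mcExt v)) * Q (mcRes N (mcSh (N * L) (mcExt v))),
      fun v => mul_nonneg (q0 _) (hQ0 _), ?_, fun x => ?_⟩
    · have := mc_split_sum (N * L) N q (fun y : ℕ → A => Q (mcRes N y))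
        (fun y y' h => by rw [mcRes_congr h])
      simp only [mcRes_ext, q1, hQ1, mul_one] at this
      exact this
    · have := mc_split_sum (N * L) N (fun u : Fin (N * L) → A => q u * (2:ℝ) ^ (-∑ i : Fin (N * L), ρ (x i.val) (u i)))
        (fun y : ℕ → A => Q (mcRes N y) * (2:ℝ) ^ (-∑ i : Fin N, ρ (x (N * L + i.val)) (y i.val)))
        (fun y y' h => by
          rw [mcRes_congr h]
          congr 3
          exact Finset.sum_congr rfl fun i _ => by rw [h i i.2])
      rw [hq x] at this
      rw [Finset.prod_range_succ, hZ (mcRes N (mcSh (N * L) x))]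
      have e : ∑ w : Fin N → A, (fun y : ℕ → A => Q (mcRes N y) * (2:ℝ) ^ (-∑ i : Fin N, ρ (x (N * L + i.val)) (y i.val))) (mcExt w) =
          ∑ b, Q b * (2:ℝ) ^ (-∑ i, ρ (mcRes N (mcSh (N * L) x) i) (b i)) := by
        refine Finset.sum_congr rfl fun b _ => ?_
        simp only [mcRes_ext]
        congr 3
        refine Finset.sum_congr rfl fun i _ => ?_
        rw [mcExt_lt b i.val i.2]; rfl
      rw [e] at this
      rw [← this]
      refine Finset.sum_congr rfl fun (v : Fin (N * L + N) → A) _ => ?_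
      have hs : ∑ i : Fin (N * L + N), ρ (x i.val) (v i) =
          ∑ i : Fin (N * L), ρ (x i.val) (mcRes (N * L) (mcExt v) i) +
          ∑ i : Fin N, ρ (x (N * L + i.val)) (mcSh (N * L) (mcExt v) i.val) := by
        rw [Fin.sum_univ_add]
        congr 1
        · refine Finset.sum_congr rfl fun i _ => ?_
          simp only [mcRes]
          rw [mcExt_lt v i.val (by omega)]
          rfl
        · refine Finset.sum_congr rfl fun i _ => ?_
          simp only [mcSh]
          rw [mcExt_lt v (N * L + i.val) (by omega)]
          rfl
      have hs' : (2:ℝ) ^ (-∑ i : Fin (N * L + N), ρ (x i.val) (v i)) =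
          (2:ℝ) ^ (-∑ i : Fin (N * L), ρ (x i.val) (mcRes (N * L) (mcExt v) i)) *
          (2:ℝ) ^ (-∑ i : Fin N, ρ (x (N * L + i.val)) (mcSh (N * L) (mcExt v) i.val)) := by
        rw [hs, neg_add, Real.rpow_add (by norm_num)]
      show _ * (2:ℝ) ^ (-∑ i : Fin (N * L + N), ρ (x i.val) (v i)) = _
      rw [hs']
      ring

end achiev

open Filter MeasureTheory

set_option linter.unusedSectionVars false
set_option linter.unusedVariables false

section achiev2

variable {X : Type*} [Fintype X] [DecidableEq X] [MeasurableSpace X] [DiscreteMeasurableSpace X]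
variable {A : Type*} [Fintype A] [DecidableEq A] [Nonempty A]

lemma mc_block_code (m : ℕ) (hm : 2 ≤ m) (qh : (Fin m → A) → ℝ) (hq0 : ∀ y, 0 ≤ qh y) (hq1 : ∑ y, qh y ≤ 1) :
    ∃ c : MCode A, c.C = Real.logb 2 (2 * Fintype.card A) ∧ ∀ v : Fin m → A, 0 < qh v →
      c.L m (mcExt v) ≤ -Real.logb 2 (qh v) + 1 := by
  have hA : (0:ℝ) < Fintype.card A := by exact_mod_cast Fintype.card_pos
  obtain ⟨c, hc, hL⟩ := mc_exists_code (A := A)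
    (fun n v => if n = 1 then 1 / (2 * Fintype.card A) else if n = m then qh (mcRes m (mcExt v)) / 2 else 0)
    (by
      intro n v
      split_ifs
      · positivity
      · exact div_nonneg (hq0 _) (by norm_num)
      · exact le_rfl)
    (by intro v; rw [if_pos rfl]; positivity)
    (fun n => (if n = 1 then 1 / 2 else 0) + (if n = m then 1 / 2 else 0))
    (by
      intro n
      rw [Finset.sum_add_distrib]
      have h1 : ∑ j ∈ Finset.range n, (if j + 1 = 1 then (1:ℝ) / 2 else 0) ≤ 1 / 2 := by
        have : ∀ j, (if j + 1 = 1 then (1:ℝ) / 2 else 0) = if 0 = j then 1 / 2 else 0 := by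
          intro j; congr 1; simp [eq_comm]
        simp only [this, Finset.sum_ite_eq]
        split_ifs <;> norm_num
      have h2 : ∑ j ∈ Finset.range n, (if j + 1 = m then (1:ℝ) / 2 else 0) ≤ 1 / 2 := by
        have : ∀ j, (if j + 1 = m then (1:ℝ) / 2 else 0) = if m - 1 = j then 1 / 2 else 0 := by
          intro j; congr 1; apply propext; omega
        simp only [this, Finset.sum_ite_eq]
        split_ifs <;> norm_num
      linarith)
    (by
      intro n hn
      by_cases h1 : n = 1
      · subst h1
        have h2 : ¬ 1 = m := by omega
        simp only [if_true, h2, if_false, Finset.sum_const, Finset.card_univ, nsmul_eq_mul]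
        rw [Fintype.card_fun]
        simp only [Fintype.card_fin, pow_one, add_zero]
        apply le_of_eq
        field_simp
      · simp only [h1, if_false]
        by_cases h2 : n = m
        · subst h2
          simp only [if_true, mcRes_ext]
          rw [← Finset.sum_div]
          linarith
        · simp [h2])
    (Real.logb 2 (2 * Fintype.card A))
    (by
      intro v
      rw [if_pos rfl, one_div, Real.logb_inv, neg_neg])
  refine ⟨c, hc, fun v hv => ?_⟩
  have h1 : ¬ m = 1 := by omega
  have := hL m (by omega) (mcExt v) (by
    simp only [h1, if_false, if_true, mcRes_ext]; linarith)
  simp only [h1, if_false, if_true, mcRes_ext] at this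
  rw [Real.logb_div hv.ne' (by norm_num), Real.logb_self_eq_one (by norm_num)] at this
  linarith

lemma mc_block_bound (μ : Measure (ℕ → X)) [IsProbabilityMeasure μ] (d : X → A → ℝ) (hd : ∀ a b, 0 ≤ d a b)
    (α : ℝ) (hα : 0 < α) (dm : ℝ) (hdm0 : 0 ≤ dm) (hdm : ∀ a b, d a b ≤ dm) (m : ℕ) (hm : 2 ≤ m)
    (q : (Fin m → A) → ℝ) (hq0 : ∀ y, 0 ≤ q y) (hq1 : ∑ y, q y = 1) :
    ∃ c : MCode A, ∫ x, mcF c d α m x ∂μ ≤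
      ∑ w, mcP μ m w * (-Real.logb 2 (∑ b, q b * (2:ℝ) ^ (-∑ i, α * d (w i) (b i)))) +
      (2 * Real.logb 2 (m + 1) + (Real.logb 2 (2 + α * dm) + 1 + (Real.logb 2 (2 * Fintype.card A) + α * dm))) := by
  classical
  have hX : Nonempty X := mc_nonempty μ
  have hA : (1:ℝ) ≤ Fintype.card A := by exact_mod_cast Fintype.card_pos
  have hαd : 0 ≤ α * dm := mul_nonneg hα.le hdm0
  obtain ⟨qh, h0, h1, S, hS, hSx⟩ := mc_oneshot (mcP μ m) (mcP_nonneg μ m) (mcP_sum μ m) q hq0 hq1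
    (fun w b => ∑ i, α * d (w i) (b i)) (α * dm * m)
    (fun w b => Finset.sum_nonneg fun i _ => mul_nonneg hα.le (hd _ _))
    (fun w b => by
      calc _ ≤ ∑ i : Fin m, α * dm := Finset.sum_le_sum fun i _ => mul_le_mul_of_nonneg_left (hdm _ _) hα.le
        _ = _ := by simp; ring) m
  obtain ⟨c, hc, hL⟩ := mc_block_code m hm qh h0 h1
  refine ⟨c, ?_⟩
  have hm0 : (0:ℝ) ≤ m := Nat.cast_nonneg m
  have hlog : Real.logb 2 (1 + Real.log (⌈((m:ℝ) + 1) * (2:ℝ) ^ (α * dm * m)⌉₊)) ≤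
      Real.logb 2 (m + 1) + Real.logb 2 (2 + α * dm) := by
    set y := ((m:ℝ) + 1) * (2:ℝ) ^ (α * dm * m) with hy
    have hp : (1:ℝ) ≤ (2:ℝ) ^ (α * dm * m) := Real.one_le_rpow (by norm_num) (mul_nonneg hαd hm0)
    have hy1 : 1 ≤ y := by nlinarith
    have hc1 : (1:ℝ) ≤ (⌈y⌉₊ : ℝ) := hy1.trans (Nat.le_ceil y)
    have hc2 : (⌈y⌉₊ : ℝ) ≤ 2 * y := by
      have := Nat.ceil_lt_add_one (a := y) (by linarith)
      linarith
    have hl : Real.log (⌈y⌉₊ : ℝ) ≤ 1 + m + α * dm * m := by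
      refine (Real.log_le_log (by linarith) hc2).trans ?_
      rw [Real.log_mul (by norm_num) (by linarith), hy, Real.log_mul (by linarith) (by linarith),
        Real.log_rpow (by norm_num)]
      have l2 : Real.log 2 ≤ 1 := by have := Real.log_two_lt_d9; linarith
      have lm := Real.log_le_sub_one_of_pos (show (0:ℝ) < m + 1 by linarith)
      have := mul_le_mul_of_nonneg_left l2 (mul_nonneg hαd hm0)
      linarith
    have hl0 : 0 ≤ Real.log (⌈y⌉₊ : ℝ) := Real.log_nonneg hc1
    rw [← Real.logb_mul (by linarith) (by linarith)]
    refine Real.logb_le_logb_of_le (by norm_num) (by linarith) ?_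
    nlinarith
  have hW1 : ∀ w : Fin m → X, 0 ≤ -Real.logb 2 (∑ b, q b * (2:ℝ) ^ (-∑ i, α * d (w i) (b i))) := by
    intro w
    rw [neg_nonneg]
    refine Real.logb_nonpos (by norm_num) (Finset.sum_nonneg fun b _ => mul_nonneg (hq0 b) (by positivity)) ?_
    refine le_trans (Finset.sum_le_sum fun b _ => mul_le_of_le_one_right (hq0 b) ?_) hq1.le
    exact Real.rpow_le_one_of_one_le_of_nonpos (by norm_num)
      (neg_nonpos.2 (Finset.sum_nonneg fun i _ => mul_nonneg hα.le (hd _ _)))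
  have hl1 : 0 ≤ Real.logb 2 ((m:ℝ) + 1) := Real.logb_nonneg (by norm_num) (by linarith)
  have hl2 : 0 ≤ Real.logb 2 (2 + α * dm) := Real.logb_nonneg (by norm_num) (by linarith)
  have hl3 : 0 ≤ Real.logb 2 (2 * (Fintype.card A : ℝ)) := Real.logb_nonneg (by norm_num) (by linarith)
  have hpt : ∀ w : Fin m → X, mcF c d α m (mcExt w) ≤
      -Real.logb 2 (∑ b, q b * (2:ℝ) ^ (-∑ i, α * d (w i) (b i))) +
      (2 * Real.logb 2 (m + 1) + (Real.logb 2 (2 + α * dm) + 1)) +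
      (if S w then 0 else 1) * ((Real.logb 2 (2 * Fintype.card A) + α * dm) * m) := by
    intro w
    by_cases h : S w
    · rw [if_pos h, zero_mul, add_zero]
      obtain ⟨y, hy0, hy⟩ := hSx w h
      refine (mcF_le c d α m (mcExt w) (mcExt y)).trans ?_
      unfold mcCost
      have h3 := hL y hy0
      have h4 : α * ∑ i ∈ Finset.range m, d (mcExt w i) (mcExt y i) = ∑ i, α * d (w i) (y i) := by
        rw [Finset.sum_range, Finset.mul_sum]
        exact Finset.sum_congr rfl fun i _ => by rw [mcExt_lt w i.val i.2, mcExt_lt y i.val i.2]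
      rw [h4]
      linarith
    · rw [if_neg h, one_mul]
      have h3 := (le_abs_self _).trans (mcF_bound c d α hα hd dm hdm m (mcExt w))
      rw [hc] at h3
      have := hW1 w
      linarith
  have hI : ∫ x, mcF c d α m x ∂μ = ∑ w, mcP μ m w * mcF c d α m (mcExt w) := by
    rw [← mc_integral μ m (fun w => mcF c d α m (mcExt w))]
    congr 1
    funext x
    exact mcF_congr c d α m _ _ fun t ht => (mcExt_res x t ht).symm
  rw [hI]
  have hD0 : 0 ≤ (Real.logb 2 (2 * Fintype.card A) + α * dm) := by linarith
  have hexp : (m:ℝ) * Real.exp (-m) ≤ 1 := by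
    have := Real.add_one_le_exp (m:ℝ)
    rw [Real.exp_neg, ← div_eq_mul_inv, div_le_one (Real.exp_pos _)]
    linarith
  calc _ ≤ ∑ w, mcP μ m w * (-Real.logb 2 (∑ b, q b * (2:ℝ) ^ (-∑ i, α * d (w i) (b i))) +
      (2 * Real.logb 2 (m + 1) + (Real.logb 2 (2 + α * dm) + 1)) +
      (if S w then 0 else 1) * ((Real.logb 2 (2 * Fintype.card A) + α * dm) * m)) :=
        Finset.sum_le_sum fun w _ => mul_le_mul_of_nonneg_left (hpt w) (mcP_nonneg μ m w)
    _ = ∑ w, mcP μ m w * (-Real.logb 2 (∑ b, q b * (2:ℝ) ^ (-∑ i, α * d (w i) (b i)))) +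
        (2 * Real.logb 2 (m + 1) + (Real.logb 2 (2 + α * dm) + 1)) +
        (∑ w, mcP μ m w * (if S w then 0 else 1)) * ((Real.logb 2 (2 * Fintype.card A) + α * dm) * m) := by
        simp only [mul_add, Finset.sum_add_distrib, ← mul_assoc, ← Finset.sum_mul, mcP_sum, one_mul]
    _ ≤ _ := by
        have := mul_le_mul_of_nonneg_right hS (mul_nonneg hD0 hm0)
        have h5 := mul_le_mul_of_nonneg_left hexp hD0
        nlinarith

lemma mc_log_small (K ε : ℝ) (hε : 0 < ε) : ∀ᶠ m : ℕ in atTop, 2 * Real.logb 2 ((m:ℝ) + 1) + K ≤ ε * m := by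
  have hln : 0 < Real.log 2 := Real.log_pos (by norm_num)
  have h1 := (Real.isLittleO_log_id_atTop.bound (show 0 < ε * Real.log 2 / 8 by positivity))
  have h2 : Tendsto (fun m : ℕ => (m:ℝ) + 1) atTop atTop :=
    tendsto_atTop_add_const_right _ _ tendsto_natCast_atTop_atTop
  filter_upwards [h2.eventually h1, eventually_ge_atTop 1, eventually_ge_atTop ⌈2 * |K| / ε⌉₊] with m hm hm1 hm2
  have hm1' : (1:ℝ) ≤ m := by exact_mod_cast hm1
  have hm2' : 2 * |K| / ε ≤ m := (Nat.le_ceil _).trans (by exact_mod_cast hm2)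
  rw [div_le_iff₀ hε] at hm2'
  simp only [id, Real.norm_eq_abs] at hm
  rw [abs_of_nonneg (Real.log_nonneg (by linarith)), abs_of_nonneg (by linarith)] at hm
  have h3 : Real.logb 2 ((m:ℝ) + 1) ≤ ε / 8 * (m + 1) := by
    rw [Real.logb, div_le_iff₀ hln]; linarith
  have := le_abs_self K
  nlinarith

lemma mc_achieve (μ : Measure (ℕ → X)) [IsProbabilityMeasure μ]
    (herg : Ergodic (fun x : ℕ → X => fun i => x (i + 1)) μ) (d : X → A → ℝ) (hd : ∀ a b, 0 ≤ d a b)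
    (α : ℝ) (hα : 0 < α) (N : ℕ) (hN : 1 ≤ N) (ν : (Fin N → X) × (Fin N → A) → ℝ) (hν : mcFeas μ N ν)
    (ε : ℝ) (hε : 0 < ε) :
    ∃ c : MCode A, ∃ m : ℕ, 0 < m ∧ ∫ x, mcF c d α m x ∂μ ≤ (mcVal d α N ν + ε) * m := by
  have hX : Nonempty X := mc_nonempty μ
  obtain ⟨dm, hdm0, hdm⟩ : ∃ dm : ℝ, 0 ≤ dm ∧ ∀ a b, d a b ≤ dm :=
    ⟨∑ a, ∑ b, d a b, Finset.sum_nonneg fun a _ => Finset.sum_nonneg fun b _ => hd a b, fun a b =>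
      (Finset.single_le_sum (f := fun b => d a b) (fun b _ => hd a b) (Finset.mem_univ b)).trans
        (Finset.single_le_sum (f := fun a => ∑ b, d a b) (fun a _ => Finset.sum_nonneg fun b _ => hd a b)
          (Finset.mem_univ a))⟩
  obtain ⟨hν0, hν1, hνP⟩ := hν
  obtain ⟨Q, hQ⟩ : ∃ Q : (Fin N → A) → ℝ, ∀ b, ∑ w, ν (w, b) = Q b := ⟨_, fun b => rfl⟩
  have hQ0 : ∀ b, 0 ≤ Q b := fun b => by rw [← hQ]; exact Finset.sum_nonneg fun w _ => hν0 _
  have hQ1 : ∑ b, Q b = 1 := by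
    rw [← hν1, Fintype.sum_prod_type, Finset.sum_comm]
    exact Finset.sum_congr rfl fun b _ => (hQ b).symm
  obtain ⟨Z, hZ⟩ : ∃ Z : (Fin N → X) → ℝ, ∀ w, Z w = ∑ b, Q b * (2:ℝ) ^ (-∑ i, α * d (w i) (b i)) :=
    ⟨_, fun w => rfl⟩
  have hZ0 : ∀ w, 0 < Z w := by
    intro w
    rw [hZ]
    obtain ⟨b, hb⟩ : ∃ b, 0 < Q b := by
      by_contra! h
      have : ∑ b, Q b ≤ 0 := Finset.sum_nonpos fun b _ => h b
      linarith
    exact Finset.sum_pos' (fun b _ => mul_nonneg (hQ0 b) (by positivity))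
      ⟨b, Finset.mem_univ _, mul_pos hb (by positivity)⟩
  have hsoft := mc_soft ν hν0 (mcP μ N) hνP Q hQ (fun w b => ∑ i, α * d (w i) (b i)) Z hZ hZ0
  have hN' : (0:ℝ) < N := by exact_mod_cast hN
  have hval : mutualInfo ν + ∑ p : (Fin N → X) × (Fin N → A), ν p * (∑ i, α * d (p.1 i) (p.2 i)) =
      N * mcVal d α N ν := by
    unfold mcVal avgDist
    rw [mul_add, mul_div_cancel₀ _ hN'.ne']
    congr 1
    rw [Finset.mul_sum, Finset.mul_sum]
    refine Finset.sum_congr rfl fun p _ => ?_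
    rw [← Finset.mul_sum]
    field_simp
  rw [hval] at hsoft
  obtain ⟨m0, hm0⟩ := eventually_atTop.1 (mc_log_small
    (Real.logb 2 (2 + α * dm) + 1 + (Real.logb 2 (2 * Fintype.card A) + α * dm)) ε hε)
  obtain ⟨L, hL⟩ : ∃ L : ℕ, L = m0 + 2 := ⟨_, rfl⟩
  have hmL : L ≤ N * L := Nat.le_mul_of_pos_left _ hN
  obtain ⟨q, q0, q1, hq⟩ := mc_prod (X := X) N Q hQ0 hQ1 (fun a b => α * d a b) Z hZ L
  obtain ⟨c, hc⟩ := mc_block_bound μ d hd α hα dm hdm0 hdm (N * L) (by omega) q q0 q1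
  refine ⟨c, N * L, by omega, hc.trans ?_⟩
  have hsm := hm0 (N * L) (by omega)
  have hIntg : ∑ w, mcP μ (N * L) w *
      (-Real.logb 2 (∑ b, q b * (2:ℝ) ^ (-∑ i, α * d (w i) (b i)))) ≤ mcVal d α N ν * ((N * L : ℕ) : ℝ) := by
    rw [← mc_integral μ (N * L) (fun w => -Real.logb 2 (∑ b, q b * (2:ℝ) ^ (-∑ i, α * d (w i) (b i))))]
    have e1 : ∀ x : ℕ → X, -Real.logb 2 (∑ b, q b * (2:ℝ) ^ (-∑ i, α * d (mcRes (N * L) x i) (b i))) =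
        ∑ l ∈ Finset.range L, -Real.logb 2 (Z (mcRes N (mcSh (N * l) x))) := by
      intro x
      have := hq x
      simp only [mcRes]
      rw [this, Real.logb_prod _ _ (fun l _ => (hZ0 _).ne'), Finset.sum_neg_distrib]
    simp only [e1]
    have hmeas : ∀ l, Measurable (fun x : ℕ → X => -Real.logb 2 (Z (mcRes N (mcSh (N * l) x)))) := by
      intro l
      have h1 : Measurable (fun w : Fin N → X => -Real.logb 2 (Z w)) := measurable_of_finite _
      have h2 : Measurable (fun x : ℕ → X => mcRes N (mcSh (N * l) x)) :=
        measurable_pi_lambda _ fun i => measurable_pi_apply _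
      exact h1.comp h2
    have hintg : ∀ l ∈ Finset.range L, Integrable (fun x : ℕ → X => -Real.logb 2 (Z (mcRes N (mcSh (N * l) x)))) μ := by
      intro l _
      refine Integrable.of_bound (hmeas l).aestronglyMeasurable (∑ w, |Real.logb 2 (Z w)|) (ae_of_all _ fun x => ?_)
      rw [Real.norm_eq_abs, abs_neg]
      exact Finset.single_le_sum (f := fun w => |Real.logb 2 (Z w)|) (fun w _ => abs_nonneg _) (Finset.mem_univ _)
    rw [integral_finsetSum _ hintg]
    have e2 : ∀ l, ∫ x, -Real.logb 2 (Z (mcRes N (mcSh (N * l) x))) ∂μ = ∑ w, mcP μ N w * (-Real.logb 2 (Z w)) := by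
      intro l
      rw [← mc_integral μ N (fun w => -Real.logb 2 (Z w))]
      have hmp := herg.toMeasurePreserving.iterate (N * l)
      have hm' : Measurable (fun x : ℕ → X => -Real.logb 2 (Z (mcRes N x))) := by
        have := hmeas 0
        simpa only [mul_zero, mcSh_zero] using this
      rw [← hmp.map_eq, integral_map hmp.measurable.aemeasurable hm'.aestronglyMeasurable, hmp.map_eq]
      congr 1
      funext x
      have : Nonempty X := hX
      rw [show (fun (x : ℕ → X) i => x (i + 1))^[N * l] x = mcSh (N * l) x from mcSh_iter _ _]
    simp only [e2, Finset.sum_const, Finset.card_range, nsmul_eq_mul]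
    calc _ ≤ (L:ℝ) * (N * mcVal d α N ν) := mul_le_mul_of_nonneg_left hsoft (Nat.cast_nonneg _)
      _ = _ := by push_cast; ring
  linarith

end achiev2

open Filter MeasureTheory

set_option linter.unusedSectionVars false
set_option linter.unusedVariables false

section final

variable {X : Type*} [Fintype X] [DecidableEq X] [MeasurableSpace X] [DiscreteMeasurableSpace X]
variable {A : Type*} [Fintype A] [DecidableEq A] [Nonempty A]

lemma mc_V_le (μ : Measure (ℕ → X)) (d : X → A → ℝ) (hd : ∀ a b, 0 ≤ d a b) (α : ℝ) (N : ℕ) (hN : 1 ≤ N)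
    (ν : (Fin N → X) × (Fin N → A) → ℝ) (hν : mcFeas μ N ν) :
    (⨅ (D : ℝ) (_ : 0 ≤ D), RDfun (Xh := A) μ d D + ((α * D : ℝ) : EReal)) ≤ ((mcVal d α N ν : ℝ) : EReal) := by
  have hD : 0 ≤ ∑ p : (Fin N → X) × (Fin N → A), ν p * avgDist d N p.1 p.2 :=
    Finset.sum_nonneg fun p _ => mul_nonneg (hν.1 p)
      (div_nonneg (Finset.sum_nonneg fun i _ => hd _ _) (Nat.cast_nonneg _))
  refine (iInf₂_le _ hD).trans ?_
  unfold mcVal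
  rw [EReal.coe_add]
  refine add_le_add ?_ le_rfl
  refine (iInf_le (fun n : {m : ℕ // 1 ≤ m} => RDn (Xh := A) μ d n _) ⟨N, hN⟩).trans ?_
  exact sInf_le ⟨ν, hν.1, hν.2.1, hν.2.2, le_rfl, rfl⟩

lemma mc_V_lt (μ : Measure (ℕ → X)) (d : X → A → ℝ) (α : ℝ) (hα : 0 < α) (c : ℝ)
    (h : (⨅ (D : ℝ) (_ : 0 ≤ D), RDfun (Xh := A) μ d D + ((α * D : ℝ) : EReal)) < (c : EReal)) :
    ∃ N, 1 ≤ N ∧ ∃ ν : (Fin N → X) × (Fin N → A) → ℝ, mcFeas μ N ν ∧ mcVal d α N ν < c := by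
  obtain ⟨D, hD⟩ := iInf_lt_iff.1 h
  obtain ⟨hD0, hD⟩ := iInf_lt_iff.1 hD
  have h1 : RDfun (Xh := A) μ d D < ((c - α * D : ℝ) : EReal) := by
    by_contra hn
    rw [not_lt] at hn
    have := add_le_add hn (le_refl ((α * D : ℝ) : EReal))
    rw [← EReal.coe_add, sub_add_cancel] at this
    exact absurd hD (not_lt.2 this)
  obtain ⟨⟨N, hN⟩, h2⟩ := iInf_lt_iff.1 h1
  obtain ⟨r, ⟨ν, a1, a2, a3, a4, rfl⟩, hr⟩ := sInf_lt_iff.1 h2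
  refine ⟨N, hN, ν, ⟨a1, a2, a3⟩, ?_⟩
  have hr' := EReal.coe_lt_coe_iff.1 hr
  unfold mcVal
  have := mul_le_mul_of_nonneg_left a4 hα.le
  dsimp only at hr'
  linarith

end final

/-- Universality of the MCMC-based fixed-slope lossy coder: for a stationary
ergodic source, slope `α > 0`, context orders `k_n → ∞` with `k_n/log n → 0`
and `k_n < n`, any temperature parameters `T₀^{(n)} > n·Δ_{n,x}` (with
`T₀^{(n)} > 0`), the cooling schedule `β_t = ln(⌊t/n⌋ + 1)/T₀^{(n)}`, and any
initial distributions `μ₀`, the expected value under the distribution after `r`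
steps of the annealed Gibbs sampler of `H_{k_n}(y) + α d_n(xⁿ, y)` converges,
as `r → ∞` and then `n → ∞`, to `inf_{D ≥ 0} [R(D) + αD]`, almost surely. -/
theorem mcmc_fixed_slope_universal {X Xh : Type*} [Fintype X] [DecidableEq X]
    [MeasurableSpace X] [DiscreteMeasurableSpace X]
    [Fintype Xh] [DecidableEq Xh] [Nonempty Xh]
    (μ : Measure (ℕ → X)) [IsProbabilityMeasure μ]
    (herg : Ergodic (fun x : ℕ → X => fun i => x (i + 1)) μ)
    (d : X → Xh → ℝ) (hd : ∀ a b, 0 ≤ d a b)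
    (α : ℝ) (hα : 0 < α)
    (kn : ℕ → ℕ) (hkn1 : Tendsto kn atTop atTop)
    (hkn2 : Tendsto (fun n => (kn n : ℝ) / Real.log n) atTop (nhds 0))
    (hkn3 : ∀ n, 1 ≤ n → kn n < n) :
    ∀ᵐ x ∂μ, ∀ T₀ : ℕ → ℝ, (∀ n, 0 < T₀ n) →
      (∀ n : ℕ, (n : ℝ) * energySpan n (lossyEnergy d α kn n x) < T₀ n) →
      ∀ μ₀ : (n : ℕ) → (Fin n → Xh) → ℝ, (∀ n, IsDist (μ₀ n)) →
      ∃ L : ℕ → ℝ,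
        (∀ n : ℕ, Tendsto (fun r : ℕ =>
            ∑ y : Fin n → Xh,
              Matrix.vecMul (μ₀ n)
                (Pprod (fun t => gibbs n (lossyEnergy d α kn n x)
                    (Real.log ((t / n + 1 : ℕ) : ℝ) / T₀ n)) 0 r) y *
                (condEmpEntropy n (kn n) y +
                  α * avgDist d n (fun i : Fin n => x i.val) y))
          atTop (nhds (L n))) ∧
        Tendsto (fun n => (L n : EReal)) atTop
          (nhds (⨅ (D : ℝ) (_ : 0 ≤ D), RDfun (Xh := Xh) μ d D + ((α * D : ℝ) : EReal))) := by
  have hlow : ∀ᵐ x ∂μ, ∀ q : ℚ, (((q : ℝ)) : EReal) <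
      (⨅ (D : ℝ) (_ : 0 ≤ D), RDfun (Xh := Xh) μ d D + ((α * D : ℝ) : EReal)) →
      ∀ᶠ n in atTop, (q : ℝ) ≤ mcM (A := Xh) d α (kn n) n x := by
    rw [ae_all_iff]
    intro q
    by_cases hq : (((q : ℝ)) : EReal) <
      (⨅ (D : ℝ) (_ : 0 ≤ D), RDfun (Xh := Xh) μ d D + ((α * D : ℝ) : EReal))
    · obtain ⟨q', h1, h2⟩ := EReal.lt_iff_exists_real_btwn.1 hq
      have := mc_lower μ herg d hd α hα kn hkn2 hkn3 q'
        (fun n hn ν hν => EReal.coe_le_coe_iff.1 (h2.le.trans (mc_V_le μ d hd α n hn ν hν)))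
        q (EReal.coe_lt_coe_iff.1 h1)
      filter_upwards [this] with x hx _ using hx
    · exact ae_of_all _ fun x h => absurd h hq
  have hupp : ∀ᵐ x ∂μ, ∀ q : ℚ, 
      (⨅ (D : ℝ) (_ : 0 ≤ D), RDfun (Xh := Xh) μ d D + ((α * D : ℝ) : EReal)) < (((q : ℝ)) : EReal) →
      ∀ᶠ n in atTop, mcM (A := Xh) d α (kn n) n x ≤ (q : ℝ) := by
    rw [ae_all_iff]
    intro q
    by_cases hq : (⨅ (D : ℝ) (_ : 0 ≤ D), RDfun (Xh := Xh) μ d D + ((α * D : ℝ) : EReal)) <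
      (((q : ℝ)) : EReal)
    · obtain ⟨N, hN, ν, hν, hv⟩ := mc_V_lt μ d α hα q hq
      obtain ⟨c, m, hm, hc⟩ := mc_achieve μ herg d hd α hα N hN ν hν (((q:ℝ) - mcVal d α N ν) / 2) (by linarith)
      have := mc_upper_ae μ herg c d hd α hα kn hkn1 hkn3 m hm _ (q : ℝ) hc (by linarith)
      filter_upwards [this] with x hx _ using hx
    · exact ae_of_all _ fun x h => absurd h hq
  filter_upwards [hlow, hupp] with x hl hu T₀ hT hT' μ₀ hμ₀
  refine ⟨fun n => if n = 0 then 0 else mcM (A := Xh) d α (kn n) n x, fun n => ?_, ?_⟩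
  · beta_reduce
    by_cases hn : n = 0
    · subst hn
      rw [if_pos rfl]
      refine tendsto_const_nhds.congr' ?_
      filter_upwards [eventually_ge_atTop 1] with r hr
      obtain ⟨r, rfl⟩ := Nat.exists_eq_add_of_le' hr
      rw [mc_Pprod_succ]
      have hg : ∀ β, gibbs 0 (lossyEnergy d α kn 0 x) β = 0 := by
        intro β
        funext u v
        simp [gibbs]
      rw [hg, mul_zero, Matrix.vecMul_zero]
      simp
    · rw [if_neg hn]
      have hn0 : 0 < n := Nat.pos_of_ne_zero hn
      have hn' : (0:ℝ) < n := by exact_mod_cast hn0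
      have h := mc_anneal hn0 (lossyEnergy d α kn n x) (T₀ n) (hT n) (hT' n) (μ₀ n) (hμ₀ n)
      have h2 := h.const_mul ((n:ℝ)⁻¹)
      have e : (n:ℝ)⁻¹ * (⨅ y, lossyEnergy d α kn n x y) = mcM (A := Xh) d α (kn n) n x := by
        unfold mcM
        rw [Real.mul_iInf_of_nonneg (by positivity)]
        refine iInf_congr fun y => ?_
        unfold lossyEnergy
        rw [inv_mul_cancel_left₀ hn'.ne']
      rw [e] at h2
      refine h2.congr fun r => ?_
      rw [Finset.mul_sum]
      refine Finset.sum_congr rfl fun y _ => ?_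
      unfold lossyEnergy
      field_simp
  · rw [tendsto_order]
    constructor
    · intro a ha
      obtain ⟨q, h1, h2⟩ := EReal.lt_iff_exists_rat_btwn.1 ha
      filter_upwards [hl q h2, eventually_ge_atTop 1] with n hn hn1
      rw [if_neg (by omega)]
      exact h1.trans_le (EReal.coe_le_coe_iff.2 hn)
    · intro a ha
      obtain ⟨q, h1, h2⟩ := EReal.lt_iff_exists_rat_btwn.1 ha
      filter_upwards [hu q h1, eventually_ge_atTop 1] with n hn hn1
      rw [if_neg (by omega)]
      exact (EReal.coe_le_coe_iff.2 hn).trans_lt h2
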